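/- Let B₁, B₂ ∈ C^{k-1,α}(D), k ≥ 1, 0 < α < 1, and let 𝒱 be the real vector space of all solutions u ∈ C^{k,α}(D;ℂⁿ) of ∂u/∂ζ̄ = B₁u + B₂ū. Then there exists a finite-dimensional subspace V ⊆ 𝒱 such that for every ζ ∈ D̄ the jet evaluation map j^k_ζ : V → (ℂⁿ)^{k+1}, u ↦ (∂_ζ^j u(ζ))_{0 ≤ j ≤ k}, is surjective. -/

import Mathlib

open Complex MeasureTheory Real Matrix

/-- The open unit disc in `ℂ`. -/
def unitDisc : Set ℂ := Metric.ball (0 : ℂ) 1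

/-- Componentwise complex conjugate of a vector in `ℂⁿ`. -/
def vecConj {n : ℕ} (u : Fin n → ℂ) : Fin n → ℂ := fun j => (starRingEnd ℂ) (u j)

/-- The Wirtinger derivative `∂_ζ̄ f = (∂f/∂ξ + i ∂f/∂η)/2`. -/
noncomputable def wirtingerZbar {E : Type*} [NormedAddCommGroup E] [NormedSpace ℂ E]
    (f : ℂ → E) : ℂ → E :=
  fun ζ => (1 / 2 : ℂ) • (fderiv ℝ f ζ 1 + Complex.I • fderiv ℝ f ζ Complex.I)

/-- The Wirtinger derivative `∂_ζ f` computed with derivatives within a set `s`. -/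
noncomputable def wirtingerZWithin {E : Type*} [NormedAddCommGroup E] [NormedSpace ℂ E]
    (s : Set ℂ) (f : ℂ → E) : ℂ → E :=
  fun ζ => (1 / 2 : ℂ) •
    (fderivWithin ℝ f s ζ 1 - Complex.I • fderivWithin ℝ f s ζ Complex.I)

/-- Membership in the Hölder space `C^{k,α}(s)`. -/
def HolderOn {E : Type*} [NormedAddCommGroup E] [NormedSpace ℝ E]
    (k : ℕ) (α : ℝ) (s : Set ℂ) (f : ℂ → E) : Prop :=
  ContDiffOn ℝ k f s ∧ ∃ C > 0, ∀ x ∈ s, ∀ y ∈ s,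
    ‖iteratedFDerivWithin ℝ k f s x - iteratedFDerivWithin ℝ k f s y‖ ≤ C * ‖x - y‖ ^ α

/-- The real-linear map with partial derivatives `a`, `b`. -/
noncomputable def D2 (a b : ℂ) : ℂ →L[ℝ] ℂ :=
  Complex.reCLM.smulRight a + Complex.imCLM.smulRight b

lemma D2_apply (a b z : ℂ) : D2 a b z = (z.re : ℂ) * a + (z.im : ℂ) * b := by
  simp [D2]

lemma D2_one (a b : ℂ) : D2 a b 1 = a := by simp [D2_apply]
lemma D2_I (a b : ℂ) : D2 a b Complex.I = b := by simp [D2_apply]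

lemma clm_ext_one_I {L M : ℂ →L[ℝ] ℂ} (h1 : L 1 = M 1) (h2 : L Complex.I = M Complex.I) :
    L = M := by
  ext z
  have : z = z.re • (1 : ℂ) + z.im • Complex.I := by
    simp [Complex.re_add_im]
  rw [this, map_add, map_add, map_smul, map_smul, map_smul, map_smul, h1, h2]

lemma eq_D2 (L : ℂ →L[ℝ] ℂ) : L = D2 (L 1) (L Complex.I) :=
  clm_ext_one_I (by rw [D2_one]) (by rw [D2_I])

/-- bounded and Hölder on a set -/
def H0 (α : ℝ) (s : Set ℂ) (f : ℂ → ℂ) : Prop :=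
  ∃ C : ℝ, 0 ≤ C ∧ (∀ x ∈ s, ‖f x‖ ≤ C) ∧ ∀ x ∈ s, ∀ y ∈ s, ‖f x - f y‖ ≤ C * ‖x - y‖ ^ α

/-- The Hölder class, recursively through partial derivatives. -/
def Hol (α : ℝ) (s : Set ℂ) : ℕ → (ℂ → ℂ) → Prop
  | 0, f => H0 α s f
  | m + 1, f => H0 α s f ∧ ∃ g₁ g₂ : ℂ → ℂ,
      (∀ x ∈ s, HasFDerivWithinAt f (D2 (g₁ x) (g₂ x)) s x) ∧ Hol α s m g₁ ∧ Hol α s m g₂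

lemma rpow_aux {α M K d : ℝ} (hα₀ : 0 < α) (hα₁ : α < 1) (hM : 0 ≤ M) (hK : 0 ≤ K) (hd : 0 ≤ d)
    {v : ℝ} (h1 : v ≤ M) (h2 : v ≤ K * d) : v ≤ (M + K) * d ^ α := by
  have hp : 0 ≤ d ^ α := Real.rpow_nonneg hd _
  rcases le_total d 1 with h | h
  · have : d ≤ d ^ α := by
      conv_lhs => rw [← Real.rpow_one d]
      rcases hd.eq_or_lt with h0 | h0
      · rw [← h0, Real.zero_rpow one_ne_zero, Real.zero_rpow hα₀.ne']
      · exact Real.rpow_le_rpow_of_exponent_ge h0 h hα₁.le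
    nlinarith [mul_le_mul_of_nonneg_left this hK, mul_nonneg hM hp]
  · have : 1 ≤ d ^ α := Real.one_le_rpow h hα₀.le
    nlinarith [mul_nonneg hK hp]

lemma H0.of_lip {α : ℝ} (hα₀ : 0 < α) (hα₁ : α < 1) {s : Set ℂ} {f : ℂ → ℂ} {M K : ℝ}
    (hM : 0 ≤ M) (hK : 0 ≤ K)
    (h1 : ∀ x ∈ s, ‖f x‖ ≤ M) (h2 : ∀ x ∈ s, ∀ y ∈ s, ‖f x - f y‖ ≤ K * ‖x - y‖) :
    H0 α s f := by
  refine ⟨2 * M + K, by positivity, fun x hx => (h1 x hx).trans (by linarith), fun x hx y hy => ?_⟩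
  exact rpow_aux hα₀ hα₁ (by positivity) hK (norm_nonneg _)
    ((norm_sub_le _ _).trans (by linarith [h1 x hx, h1 y hy])) (h2 x hx y hy)

lemma H0.congr {α : ℝ} {s : Set ℂ} {f g : ℂ → ℂ} (h : H0 α s f) (hfg : Set.EqOn g f s) :
    H0 α s g := by
  obtain ⟨C, hC, h1, h2⟩ := h
  refine ⟨C, hC, fun x hx => by rw [hfg hx]; exact h1 x hx, fun x hx y hy => ?_⟩
  rw [hfg hx, hfg hy]; exact h2 x hx y hy

lemma H0.mono {α : ℝ} {s t : Set ℂ} {f : ℂ → ℂ} (h : H0 α s f) (hst : t ⊆ s) : H0 α t f := by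
  obtain ⟨C, hC, h1, h2⟩ := h
  exact ⟨C, hC, fun x hx => h1 x (hst hx), fun x hx y hy => h2 x (hst hx) y (hst hy)⟩

lemma H0.add {α : ℝ} {s : Set ℂ} {f g : ℂ → ℂ} (hf : H0 α s f) (hg : H0 α s g) :
    H0 α s (fun z => f z + g z) := by
  obtain ⟨C, hC, h1, h2⟩ := hf
  obtain ⟨D, hD, k1, k2⟩ := hg
  refine ⟨C + D, by positivity, fun x hx => (norm_add_le _ _).trans (add_le_add (h1 x hx) (k1 x hx)),
    fun x hx y hy => ?_⟩
  have : f x + g x - (f y + g y) = (f x - f y) + (g x - g y) := by ring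
  rw [this, add_mul]
  exact (norm_add_le _ _).trans (add_le_add (h2 x hx y hy) (k2 x hx y hy))

lemma H0.mul {α : ℝ} {s : Set ℂ} {f g : ℂ → ℂ} (hf : H0 α s f) (hg : H0 α s g) :
    H0 α s (fun z => f z * g z) := by
  obtain ⟨C, hC, h1, h2⟩ := hf
  obtain ⟨D, hD, k1, k2⟩ := hg
  refine ⟨2 * (C * D), by positivity, fun x hx => ?_, fun x hx y hy => ?_⟩
  · rw [norm_mul]
    have := mul_le_mul (h1 x hx) (k1 x hx) (norm_nonneg _) hC
    nlinarith [mul_nonneg hC hD]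
  · have : f x * g x - f y * g y = (f x - f y) * g x + f y * (g x - g y) := by ring
    rw [this]
    refine (norm_add_le _ _).trans ?_
    rw [norm_mul, norm_mul]
    have e1 := mul_le_mul (h2 x hx y hy) (k1 x hx) (norm_nonneg _)
      (by positivity : 0 ≤ C * ‖x - y‖ ^ α)
    have e2 := mul_le_mul (h1 y hy) (k2 x hx y hy) (norm_nonneg _) hC
    nlinarith

lemma H0.conj {α : ℝ} {s : Set ℂ} {f : ℂ → ℂ} (hf : H0 α s f) :
    H0 α s (fun z => (starRingEnd ℂ) (f z)) := by
  obtain ⟨C, hC, h1, h2⟩ := hf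
  refine ⟨C, hC, fun x hx => by simpa using h1 x hx, fun x hx y hy => ?_⟩
  rw [← map_sub, RCLike.norm_conj]; exact h2 x hx y hy

lemma H0.const {α : ℝ} {s : Set ℂ} (c : ℂ) : H0 α s (fun _ => c) :=
  ⟨‖c‖, norm_nonneg _, fun _ _ => le_rfl, fun x _ y _ => by
    simp only [sub_self, norm_zero]; positivity⟩

lemma Hol.h0 {α : ℝ} {s : Set ℂ} {m : ℕ} {f : ℂ → ℂ} (h : Hol α s m f) : H0 α s f := by
  cases m with
  | zero => exact h
  | succ m => exact h.1

lemma Hol.pred {α : ℝ} {s : Set ℂ} {m : ℕ} {f : ℂ → ℂ} (h : Hol α s (m + 1) f) : Hol α s m f := by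
  induction m generalizing f with
  | zero => exact h.1
  | succ m ih =>
    obtain ⟨h0, g₁, g₂, hd, h1, h2⟩ := h
    exact ⟨h0, g₁, g₂, hd, ih h1, ih h2⟩

lemma Hol.le {α : ℝ} {s : Set ℂ} {m l : ℕ} {f : ℂ → ℂ} (h : Hol α s m f) (hl : l ≤ m) :
    Hol α s l f := by
  induction m with
  | zero => obtain rfl : l = 0 := by omega
            exact h
  | succ m ih =>
    rcases Nat.lt_or_ge l (m + 1) with h' | h'
    · exact ih h.pred (by omega)
    · obtain rfl : l = m + 1 := by omega
      exact h

lemma Hol.congr {α : ℝ} {s : Set ℂ} {m : ℕ} {f g : ℂ → ℂ} (h : Hol α s m f)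
    (hfg : Set.EqOn g f s) : Hol α s m g := by
  cases m with
  | zero => exact H0.congr h hfg
  | succ m =>
    obtain ⟨h0, g₁, g₂, hd, h1, h2⟩ := h
    exact ⟨h0.congr hfg, g₁, g₂, fun x hx => (hd x hx).congr hfg (hfg hx), h1, h2⟩

lemma Hol.mono {α : ℝ} {s t : Set ℂ} {m : ℕ} {f : ℂ → ℂ} (h : Hol α s m f) (hst : t ⊆ s) :
    Hol α t m f := by
  induction m generalizing f with
  | zero => exact H0.mono h hst
  | succ m ih =>
    obtain ⟨h0, g₁, g₂, hd, h1, h2⟩ := h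
    exact ⟨h0.mono hst, g₁, g₂, fun x hx => (hd x (hst hx)).mono hst, ih h1, ih h2⟩

lemma Hol.const {α : ℝ} {s : Set ℂ} (m : ℕ) (c : ℂ) : Hol α s m (fun _ => c) := by
  induction m generalizing c with
  | zero => exact H0.const c
  | succ m ih =>
    refine ⟨H0.const c, fun _ => 0, fun _ => 0, fun x _ => ?_, ih 0, ih 0⟩
    have : D2 0 0 = 0 := by simp [D2]
    rw [this]; exact hasFDerivWithinAt_const _ _ _

lemma Hol.add {α : ℝ} {s : Set ℂ} {m : ℕ} {f g : ℂ → ℂ} (hf : Hol α s m f) (hg : Hol α s m g) :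
    Hol α s m (fun z => f z + g z) := by
  induction m generalizing f g with
  | zero => exact H0.add hf hg
  | succ m ih =>
    obtain ⟨h0, g₁, g₂, hd, h1, h2⟩ := hf
    obtain ⟨k0, k₁, k₂, kd, k1, k2⟩ := hg
    refine ⟨h0.add k0, _, _, fun x hx => ?_, ih h1 k1, ih h2 k2⟩
    refine ((hd x hx).add (kd x hx)).congr_fderiv ?_
    apply clm_ext_one_I <;> simp [D2_one, D2_I]

lemma Hol.mul {α : ℝ} {s : Set ℂ} {m : ℕ} {f g : ℂ → ℂ} (hf : Hol α s m f) (hg : Hol α s m g) :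
    Hol α s m (fun z => f z * g z) := by
  induction m generalizing f g with
  | zero => exact H0.mul hf hg
  | succ m ih =>
    have hf' := hf.pred
    have hg' := hg.pred
    obtain ⟨h0, g₁, g₂, hd, h1, h2⟩ := hf
    obtain ⟨k0, k₁, k₂, kd, k1, k2⟩ := hg
    refine ⟨h0.mul k0, _, _, fun x hx => ?_, (ih hf' k1).add (ih h1 hg'),
      (ih hf' k2).add (ih h2 hg')⟩
    refine ((hd x hx).mul (kd x hx)).congr_fderiv ?_
    apply clm_ext_one_I <;> simp [D2_one, D2_I] <;> ring

lemma Hol.conj {α : ℝ} {s : Set ℂ} {m : ℕ} {f : ℂ → ℂ} (hf : Hol α s m f) :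
    Hol α s m (fun z => (starRingEnd ℂ) (f z)) := by
  induction m generalizing f with
  | zero => exact H0.conj hf
  | succ m ih =>
    obtain ⟨h0, g₁, g₂, hd, h1, h2⟩ := hf
    refine ⟨h0.conj, _, _, fun x hx => ?_, ih h1, ih h2⟩
    refine (Complex.conjCLE.toContinuousLinearMap.hasFDerivAt.comp_hasFDerivWithinAt x
      (hd x hx)).congr_fderiv ?_
    apply clm_ext_one_I <;> simp [D2_one, D2_I]

lemma Hol.smul {α : ℝ} {s : Set ℂ} {m : ℕ} {f : ℂ → ℂ} (c : ℂ) (hf : Hol α s m f) :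
    Hol α s m (fun z => c * f z) := (Hol.const m c).mul hf

lemma Hol.sum {α : ℝ} {s : Set ℂ} {m : ℕ} {ι : Type*} (t : Finset ι) {f : ι → ℂ → ℂ}
    (hf : ∀ i ∈ t, Hol α s m (f i)) : Hol α s m (fun z => ∑ i ∈ t, f i z) := by
  classical
  induction t using Finset.induction_on with
  | empty => simpa using Hol.const m 0
  | insert a t ha ih =>
    simp only [Finset.sum_insert ha]
    exact (hf a (by simp)).add (ih fun i hi => hf i (by simp [hi]))

lemma Hol.of_smooth {α : ℝ} (hα₀ : 0 < α) (hα₁ : α < 1) {f : ℂ → ℂ} (m : ℕ)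
    (hf : ContDiff ℝ (⊤ : ℕ∞) f) (hc : HasCompactSupport f) : Hol α Set.univ m f := by
  have key : ∀ f : ℂ → ℂ, ContDiff ℝ (⊤ : ℕ∞) f → HasCompactSupport f → H0 α Set.univ f := by
    intro f hf hc
    obtain ⟨M, hM⟩ := hc.exists_bound_of_continuous hf.continuous
    obtain ⟨K, hK⟩ := hf.lipschitzWith_of_hasCompactSupport hc (by simp)
    refine H0.of_lip hα₀ hα₁ (M := |M|) (K := K) (abs_nonneg _) K.2
      (fun x _ => (hM x).trans (le_abs_self _)) (fun x _ y _ => ?_)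
    simpa [dist_eq_norm] using hK.dist_le_mul x y
  induction m generalizing f with
  | zero => exact key f hf hc
  | succ m ih =>
    have hd : ContDiff ℝ (⊤ : ℕ∞) (fderiv ℝ f) := hf.fderiv_right (by simp)
    refine ⟨key f hf hc, fun x => fderiv ℝ f x 1, fun x => fderiv ℝ f x Complex.I,
      fun x _ => ?_, ih (hd.clm_apply contDiff_const) ?_, ih (hd.clm_apply contDiff_const) ?_⟩
    · rw [← eq_D2]
      exact ((hf.differentiable (by simp)) x).hasFDerivAt.hasFDerivWithinAt
    · exact (hc.fderiv ℝ).comp_left (g := fun L : ℂ →L[ℝ] ℂ => L 1) (by simp)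
    · exact (hc.fderiv ℝ).comp_left (g := fun L : ℂ →L[ℝ] ℂ => L Complex.I) (by simp)

/-- Radial cutoff profile. -/
noncomputable def Xc (s : ℝ) : ℝ := Real.smoothTransition (2 - s)
lemma Xc_one {s : ℝ} (h : s ≤ 1) : Xc s = 1 := Real.smoothTransition.one_of_one_le (by linarith)
lemma Xc_zero {s : ℝ} (h : 2 ≤ s) : Xc s = 0 := Real.smoothTransition.zero_of_nonpos (by linarith)
lemma Xc_contDiff {n : ℕ∞} : ContDiff ℝ n Xc :=
  Real.smoothTransition.contDiff.comp (contDiff_const.sub contDiff_id)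

/-- Cutoff: `1` for `c|z|² ≤ 1`, `0` for `c|z|² ≥ 2`. -/
noncomputable def cut (c : ℝ) (z : ℂ) : ℂ := (Xc (c * Complex.normSq z) : ℂ)

lemma contDiff_normSq {n : ℕ∞} : ContDiff ℝ n (fun z : ℂ => Complex.normSq z) := by
  have : (fun z : ℂ => Complex.normSq z) = fun z : ℂ => z.re * z.re + z.im * z.im := by
    ext z; exact Complex.normSq_apply z
  rw [this]
  exact (Complex.reCLM.contDiff.mul Complex.reCLM.contDiff).add
    (Complex.imCLM.contDiff.mul Complex.imCLM.contDiff)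

lemma cut_contDiff (c : ℝ) {n : ℕ∞} : ContDiff ℝ n (cut c) :=
  Complex.ofRealCLM.contDiff.comp (Xc_contDiff.comp (contDiff_const.mul contDiff_normSq))

lemma cut_one {c : ℝ} {z : ℂ} (h : c * Complex.normSq z ≤ 1) : cut c z = 1 := by
  simp [cut, Xc_one h]
lemma cut_zero {c : ℝ} {z : ℂ} (h : 2 ≤ c * Complex.normSq z) : cut c z = 0 := by
  simp [cut, Xc_zero h]

lemma cut_hcs {c : ℝ} (hc : 0 < c) : HasCompactSupport (cut c) := by
  apply HasCompactSupport.of_support_subset_isCompact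
    (isCompact_closedBall (0 : ℂ) (2 / c + 1))
  intro z hz
  by_contra h
  apply hz
  apply cut_zero
  rw [Metric.mem_closedBall, dist_zero_right, not_le] at h
  rw [Complex.normSq_eq_norm_sq]
  have h2 : 0 < 2 / c := by positivity
  have : 2 = c * (2 / c) := by field_simp
  rw [this]
  apply mul_le_mul_of_nonneg_left _ hc.le
  nlinarith

lemma Hol.of_smooth_ball {α : ℝ} (hα₀ : 0 < α) (hα₁ : α < 1) {f : ℂ → ℂ} (m : ℕ)
    (hf : ContDiff ℝ (⊤ : ℕ∞) f) : Hol α (Metric.closedBall 0 1) m f := by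
  have : Hol α Set.univ m (fun z => cut 1 z * f z) :=
    Hol.of_smooth hα₀ hα₁ m ((cut_contDiff 1).mul hf) ((cut_hcs one_pos).mul_right)
  refine (this.mono (Set.subset_univ _)).congr fun z hz => ?_
  simp only [Metric.mem_closedBall, dist_zero_right] at hz
  simp only
  rw [cut_one, one_mul]
  rw [Complex.normSq_eq_norm_sq]; nlinarith [norm_nonneg z]

lemma H0.continuous {α : ℝ} (hα₀ : 0 < α) {f : ℂ → ℂ} (h : H0 α Set.univ f) : Continuous f := by
  obtain ⟨C, hC, -, h2⟩ := h
  rw [continuous_iff_continuousAt]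
  intro x
  rw [ContinuousAt, tendsto_iff_norm_sub_tendsto_zero]
  have : Filter.Tendsto (fun y => C * ‖y - x‖ ^ α) (nhds x) (nhds (C * ‖x - x‖ ^ α)) := by
    apply ContinuousAt.tendsto (f := fun y => C * ‖y - x‖ ^ α)
    apply ContinuousAt.mul continuousAt_const
    apply ContinuousAt.rpow_const (by fun_prop) (Or.inr hα₀.le)
  rw [sub_self, norm_zero, Real.zero_rpow hα₀.ne', mul_zero] at this
  exact squeeze_zero (fun _ => norm_nonneg _) (fun y => h2 y trivial x trivial) this

lemma Hol.contDiff {α : ℝ} (hα₀ : 0 < α) {m : ℕ} {f : ℂ → ℂ} (h : Hol α Set.univ m f) :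
    ContDiff ℝ m f := by
  induction m generalizing f with
  | zero => exact contDiff_zero.2 (H0.continuous hα₀ h)
  | succ m ih =>
    obtain ⟨h0, g₁, g₂, hd, h1, h2⟩ := h
    have hd' : ∀ x, HasFDerivAt f (D2 (g₁ x) (g₂ x)) x := fun x => by
      simpa using hd x trivial
    rw [Nat.cast_add, Nat.cast_one, contDiff_succ_iff_fderiv]
    refine ⟨fun x => (hd' x).differentiableAt, by simp, ?_⟩
    have : fderiv ℝ f = fun x => D2 (g₁ x) (g₂ x) := funext fun x => (hd' x).fderiv
    rw [this]
    unfold D2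
    exact (contDiff_const.smulRight (ih h1)).add (contDiff_const.smulRight (ih h2))

/-- closed unit disc -/
abbrev DD : Set ℂ := Metric.closedBall (0 : ℂ) 1

lemma closure_unitDisc : closure unitDisc = DD := closure_ball _ one_ne_zero

lemma DD_uniqueDiff : UniqueDiffOn ℝ DD := by
  apply uniqueDiffOn_convex (convex_closedBall _ _)
  rw [interior_closedBall _ one_ne_zero]
  exact ⟨0, by simp⟩

lemma H0.of_contDiffOn {α : ℝ} (hα₀ : 0 < α) (hα₁ : α < 1) {f : ℂ → ℂ}
    (hf : ContDiffOn ℝ 1 f DD) : H0 α DD f := by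
  obtain ⟨M, hM⟩ := (isCompact_closedBall (0 : ℂ) 1).exists_bound_of_continuousOn hf.continuousOn
  obtain ⟨K, hK⟩ := (isCompact_closedBall (0 : ℂ) 1).exists_bound_of_continuousOn
    (hf.continuousOn_fderivWithin DD_uniqueDiff le_rfl)
  refine H0.of_lip hα₀ hα₁ (M := |M|) (K := |K|) (abs_nonneg _) (abs_nonneg _)
      (fun x hx => (hM x hx).trans (le_abs_self _)) (fun x hx y hy => ?_)
  exact (convex_closedBall (0 : ℂ) 1).norm_image_sub_le_of_norm_fderivWithin_le
    (hf.differentiableOn one_ne_zero)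
    (fun z hz => (hK z hz).trans (le_abs_self _)) hy hx

lemma Hol.of_holderOn {α : ℝ} (hα₀ : 0 < α) (hα₁ : α < 1) {m : ℕ} {f : ℂ → ℂ}
    (hf : HolderOn m α DD f) : Hol α DD m f := by
  induction m generalizing f with
  | zero =>
    obtain ⟨hc, C, hC, h⟩ := hf
    obtain ⟨M, hM⟩ := (isCompact_closedBall (0 : ℂ) 1).exists_bound_of_continuousOn hc.continuousOn
    refine ⟨|M| + C, by positivity, fun x hx => ?_, fun x hx y hy => ?_⟩
    · linarith [hM x hx, le_abs_self M]
    · have h' := h x hx y hy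
      rw [iteratedFDerivWithin_zero_eq_comp, Function.comp_apply, Function.comp_apply,
        ← map_sub, LinearIsometryEquiv.norm_map] at h'
      refine h'.trans ?_
      apply mul_le_mul_of_nonneg_right _ (by positivity)
      linarith [abs_nonneg M]
  | succ m ih =>
    obtain ⟨hc, C, hC, h⟩ := hf
    have hd : ContDiffOn ℝ m (fderivWithin ℝ f DD) DD := hc.fderivWithin DD_uniqueDiff (by simp)
    have key : ∀ e : ℂ, HolderOn m α DD (fun x => fderivWithin ℝ f DD x e) := by
      intro e
      refine ⟨hd.clm_apply contDiffOn_const, (‖ContinuousLinearMap.apply ℝ ℂ e‖ + 1) * C,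
        by positivity, fun x hx y hy => ?_⟩
      have e1 : ∀ x ∈ DD, iteratedFDerivWithin ℝ m (fun x => fderivWithin ℝ f DD x e) DD x
          = (ContinuousLinearMap.apply ℝ ℂ e).compContinuousMultilinearMap
            (iteratedFDerivWithin ℝ m (fderivWithin ℝ f DD) DD x) := by
        intro x hx
        exact (ContinuousLinearMap.apply ℝ ℂ e).iteratedFDerivWithin_comp_left
          (hd x hx) DD_uniqueDiff hx le_rfl
      have e2 := h x hx y hy
      rw [iteratedFDerivWithin_succ_eq_comp_right DD_uniqueDiff hx,
        iteratedFDerivWithin_succ_eq_comp_right DD_uniqueDiff hy, Function.comp_apply,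
        Function.comp_apply] at e2
      have e2' := (((continuousMultilinearCurryRightEquiv' ℝ m ℂ ℂ).symm).norm_map
        (iteratedFDerivWithin ℝ m (fderivWithin ℝ f DD) DD x -
          iteratedFDerivWithin ℝ m (fderivWithin ℝ f DD) DD y)).symm.trans_le
        (le_of_eq_of_le (congrArg norm (LinearIsometryEquiv.map_sub _ _ _)) e2)
      rw [e1 x hx, e1 y hy]
      have e3 : ∀ (L : (ℂ →L[ℝ] ℂ) →L[ℝ] ℂ) (p q : ContinuousMultilinearMap ℝ (fun _ : Fin m => ℂ) (ℂ →L[ℝ] ℂ)),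
          L.compContinuousMultilinearMap p - L.compContinuousMultilinearMap q =
          L.compContinuousMultilinearMap (p - q) := by
        intro L p q; ext v; simp
      rw [e3]
      refine (ContinuousLinearMap.norm_compContinuousMultilinearMap_le _ _).trans ?_
      rw [mul_assoc]
      exact mul_le_mul (by linarith) e2' (norm_nonneg _) (by positivity)
    refine ⟨H0.of_contDiffOn hα₀ hα₁ (hc.of_le (by simp)), fun x => fderivWithin ℝ f DD x 1,
      fun x => fderivWithin ℝ f DD x Complex.I, fun x hx => ?_, ih (key _), ih (key _)⟩
    rw [← eq_D2]
    exact (hc.differentiableOn (by simp) x hx).hasFDerivWithinAt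

lemma Hol.iter {α : ℝ} (hα₀ : 0 < α) {m : ℕ} {f : ℂ → ℂ} (h : Hol α Set.univ m f) :
    ∃ C, 0 ≤ C ∧ ∀ x y, ‖iteratedFDeriv ℝ m f x - iteratedFDeriv ℝ m f y‖ ≤ C * ‖x - y‖ ^ α := by
  induction m generalizing f with
  | zero =>
    obtain ⟨C, hC, h1, h2⟩ := h
    refine ⟨C, hC, fun x y => ?_⟩
    rw [iteratedFDeriv_zero_eq_comp, Function.comp_apply, Function.comp_apply,
        ← map_sub, LinearIsometryEquiv.norm_map]
    exact h2 x trivial y trivial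
  | succ m ih =>
    obtain ⟨h0, g₁, g₂, hd, h1, h2⟩ := h
    have hd' : ∀ x, HasFDerivAt f (D2 (g₁ x) (g₂ x)) x := fun x => by
      simpa using hd x trivial
    obtain ⟨C₁, hC₁, k1⟩ := ih h1
    obtain ⟨C₂, hC₂, k2⟩ := ih h2
    let L₁ : ℂ →L[ℝ] (ℂ →L[ℝ] ℂ) := ContinuousLinearMap.smulRightL ℝ ℂ ℂ Complex.reCLM
    let L₂ : ℂ →L[ℝ] (ℂ →L[ℝ] ℂ) := ContinuousLinearMap.smulRightL ℝ ℂ ℂ Complex.imCLM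
    have hf : fderiv ℝ f = (L₁ ∘ g₁) + (L₂ ∘ g₂) := by
      ext1 x
      rw [(hd' x).fderiv]; rfl
    have e : ∀ x, iteratedFDeriv ℝ m (fderiv ℝ f) x =
        L₁.compContinuousMultilinearMap (iteratedFDeriv ℝ m g₁ x) +
        L₂.compContinuousMultilinearMap (iteratedFDeriv ℝ m g₂ x) := by
      intro x
      rw [hf, iteratedFDeriv_add_apply, L₁.iteratedFDeriv_comp_left (h1.contDiff hα₀).contDiffAt le_rfl,
        L₂.iteratedFDeriv_comp_left (h2.contDiff hα₀).contDiffAt le_rfl]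
      · exact (L₁.contDiff.comp (h1.contDiff hα₀)).contDiffAt
      · exact (L₂.contDiff.comp (h2.contDiff hα₀)).contDiffAt
    refine ⟨‖L₁‖ * C₁ + ‖L₂‖ * C₂, by positivity, fun x y => ?_⟩
    rw [iteratedFDeriv_succ_eq_comp_right, iteratedFDeriv_succ_eq_comp_right, Function.comp_apply, Function.comp_apply]
    refine le_of_eq_of_le ((congrArg norm (LinearIsometryEquiv.map_sub _ _ _).symm).trans
      (((continuousMultilinearCurryRightEquiv' ℝ m ℂ ℂ).symm).norm_map
        (iteratedFDeriv ℝ m (fderiv ℝ f) x - iteratedFDeriv ℝ m (fderiv ℝ f) y))) ?_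
    rw [e, e]
    have e3 : ∀ (L M : ℂ →L[ℝ] (ℂ →L[ℝ] ℂ)) (p q r s : ContinuousMultilinearMap ℝ (fun _ : Fin m => ℂ) ℂ),
          L.compContinuousMultilinearMap p + M.compContinuousMultilinearMap q -
          (L.compContinuousMultilinearMap r + M.compContinuousMultilinearMap s)  =
          L.compContinuousMultilinearMap (p - r) + M.compContinuousMultilinearMap (q - s) := by
        intro L M p q r s; ext v; simp; ring
    rw [e3]
    refine (ContinuousMultilinearMap.opNorm_add_le _ _).trans ?_
    rw [add_mul, mul_assoc, mul_assoc]
    refine add_le_add ?_ ?_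
    · exact (ContinuousLinearMap.norm_compContinuousMultilinearMap_le _ _).trans
        (mul_le_mul_of_nonneg_left (k1 x y) (norm_nonneg _))
    · exact (ContinuousLinearMap.norm_compContinuousMultilinearMap_le _ _).trans
        (mul_le_mul_of_nonneg_left (k2 x y) (norm_nonneg _))

lemma HolderOn.of_hol {α : ℝ} (hα₀ : 0 < α) {m n : ℕ} {u : ℂ → Fin n → ℂ}
    (h : ∀ i, Hol α Set.univ m (fun z => u z i)) : HolderOn m α DD u := by
  have hu : ContDiff ℝ m u := contDiff_pi.2 fun i => (h i).contDiff hα₀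
  refine ⟨hu.contDiffOn, ?_⟩
  choose C hC hb using fun i => (h i).iter hα₀
  let S : Fin n → (ℂ →L[ℝ] (Fin n → ℂ)) := fun i => ContinuousLinearMap.single ℝ (fun _ => ℂ) i
  have hsum : u = fun z => ∑ i, (S i ∘ (fun z => u z i)) z := by
    ext z j
    simp [S, Finset.sum_apply, Pi.single_apply]
  have e : ∀ x, iteratedFDeriv ℝ m u x = ∑ i, (S i).compContinuousMultilinearMap
      (iteratedFDeriv ℝ m (fun z => u z i) x) := by
    intro x
    conv_lhs => rw [hsum]
    rw [iteratedFDeriv_fun_sum_apply]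
    · refine Finset.sum_congr rfl fun i _ => ?_
      exact (S i).iteratedFDeriv_comp_left ((h i).contDiff hα₀).contDiffAt le_rfl
    · intro i _
      exact ((S i).contDiff.comp ((h i).contDiff hα₀)).contDiffAt
  refine ⟨(∑ i, ‖S i‖ * C i) + 1, ?_, fun x hx y hy => ?_⟩
  · have : 0 ≤ ∑ i, ‖S i‖ * C i := Finset.sum_nonneg fun i _ => mul_nonneg (norm_nonneg _) (hC i)
    linarith
  · rw [iteratedFDerivWithin_eq_iteratedFDeriv DD_uniqueDiff hu.contDiffAt hx,
      iteratedFDerivWithin_eq_iteratedFDeriv DD_uniqueDiff hu.contDiffAt hy, e, e,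
      ← Finset.sum_sub_distrib]
    refine (norm_sum_le _ _).trans ?_
    rw [add_mul, Finset.sum_mul]
    have : 0 ≤ 1 * ‖x - y‖ ^ α := by positivity
    refine le_trans (Finset.sum_le_sum fun i _ => ?_) (le_add_of_nonneg_right this)
    have e3 : ∀ (L : ℂ →L[ℝ] (Fin n → ℂ)) (p q : ContinuousMultilinearMap ℝ (fun _ : Fin m => ℂ) ℂ),
          L.compContinuousMultilinearMap p - L.compContinuousMultilinearMap q =
          L.compContinuousMultilinearMap (p - q) := by
        intro L p q; ext v; simp
    rw [e3, mul_assoc]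
    exact (ContinuousLinearMap.norm_compContinuousMultilinearMap_le _ _).trans
        (mul_le_mul_of_nonneg_left (hb i x y) (norm_nonneg _))

/-- reflection maps -/
noncomputable def rfl' (p : ℕ) (z : ℂ) : ℂ := ((starRingEnd ℂ) z)⁻¹ ^ (p + 1) * z⁻¹ ^ p

lemma rfl'_zero (z : ℂ) : rfl' 0 z = ((starRingEnd ℂ) z)⁻¹ := by simp [rfl']
lemma rfl'_succ (p : ℕ) (z : ℂ) :
    rfl' (p + 1) z = rfl' p z * (((starRingEnd ℂ) z)⁻¹ * z⁻¹) := by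
  simp only [rfl']; ring

lemma rfl'_circle (p : ℕ) {z : ℂ} (hz : ‖z‖ = 1) : rfl' p z = z := by
  have h0 : z ≠ 0 := by rintro rfl; simp at hz
  have h1 : ((starRingEnd ℂ) z)⁻¹ = z := by
    apply inv_eq_of_mul_eq_one_left
    rw [Complex.mul_conj, Complex.normSq_eq_norm_sq, hz]; simp
  rw [rfl', h1, pow_succ, mul_comm (z ^ p), mul_assoc, ← mul_pow, mul_inv_cancel₀ h0, one_pow,
    mul_one]

lemma lip_mul_aux {s : Set ℂ} {f g : ℂ → ℂ} {K L : ℝ}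
    (hf : ∀ x ∈ s, ‖f x‖ ≤ 1) (hg : ∀ x ∈ s, ‖g x‖ ≤ 1)
    (hf' : ∀ x ∈ s, ∀ y ∈ s, ‖f x - f y‖ ≤ K * ‖x - y‖)
    (hg' : ∀ x ∈ s, ∀ y ∈ s, ‖g x - g y‖ ≤ L * ‖x - y‖) :
    (∀ x ∈ s, ‖f x * g x‖ ≤ 1) ∧
    ∀ x ∈ s, ∀ y ∈ s, ‖f x * g x - f y * g y‖ ≤ (K + L) * ‖x - y‖ := by
  constructor
  · intro x hx
    rw [norm_mul]; exact mul_le_one₀ (hf x hx) (norm_nonneg _) (hg x hx)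
  · intro x hx y hy
    have : f x * g x - f y * g y = (f x - f y) * g x + f y * (g x - g y) := by ring
    rw [this]
    refine (norm_add_le _ _).trans ?_
    rw [norm_mul, norm_mul]
    have e1 := mul_le_mul (hf' x hx y hy) (hg x hx) (norm_nonneg _)
      ((norm_nonneg _).trans (hf' x hx y hy))
    have e2 := mul_le_mul (hf y hy) (hg' x hx y hy) (norm_nonneg _) zero_le_one
    linarith

/-- closed exterior -/
abbrev EE : Set ℂ := {z : ℂ | 1 ≤ ‖z‖}

lemma rfl'_lip (p : ℕ) : (∀ x ∈ EE, ‖rfl' p x‖ ≤ 1) ∧ ∃ K : ℝ, 0 ≤ K ∧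
    ∀ x ∈ EE, ∀ y ∈ EE, ‖rfl' p x - rfl' p y‖ ≤ K * ‖x - y‖ := by
  have inv1 : ∀ x ∈ EE, ‖x⁻¹‖ ≤ 1 := fun x hx => by
    rw [norm_inv]; exact inv_le_one_of_one_le₀ hx
  have inv2 : ∀ x ∈ EE, ∀ y ∈ EE, ‖x⁻¹ - y⁻¹‖ ≤ 1 * ‖x - y‖ := fun x hx y hy => by
    have hx' : x ≠ 0 := by rintro rfl; simp at hx; linarith
    have hy' : y ≠ 0 := by rintro rfl; simp at hy; linarith
    have : x⁻¹ - y⁻¹ = x⁻¹ * y⁻¹ * (y - x) := by field_simp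
    rw [this, norm_mul, norm_mul, norm_sub_rev y x]
    exact mul_le_mul_of_nonneg_right (mul_le_one₀ (inv1 x hx) (norm_nonneg _) (inv1 y hy))
      (norm_nonneg _)
  have c1 : ∀ x ∈ EE, ‖((starRingEnd ℂ) x)⁻¹‖ ≤ 1 := fun x hx => by
    rw [← map_inv₀, RCLike.norm_conj]; exact inv1 x hx
  have c2 : ∀ x ∈ EE, ∀ y ∈ EE, ‖((starRingEnd ℂ) x)⁻¹ - ((starRingEnd ℂ) y)⁻¹‖ ≤ 1 * ‖x - y‖ :=
    fun x hx y hy => by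
    rw [← map_inv₀, ← map_inv₀, ← map_sub, RCLike.norm_conj]; exact inv2 x hx y hy
  induction p with
  | zero =>
    simp only [rfl'_zero]
    exact ⟨c1, 1, zero_le_one, c2⟩
  | succ p ih =>
    obtain ⟨h1, K, hK, h2⟩ := ih
    simp only [rfl'_succ]
    obtain ⟨k1, k2⟩ := lip_mul_aux c1 inv1 c2 inv2
    obtain ⟨l1, l2⟩ := lip_mul_aux h1 k1 h2 k2
    exact ⟨l1, _, by positivity, l2⟩

lemma rfl'_deriv (p : ℕ) {z : ℂ} (hz : z ≠ 0) : ∃ L : ℂ →L[ℝ] ℂ, HasFDerivAt (rfl' p) L z ∧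
    L z = -(2 * p + 1) * rfl' p z ∧ L (Complex.I * z) = Complex.I * rfl' p z := by
  have hb : HasFDerivAt (fun w : ℂ => w⁻¹) ((ContinuousLinearMap.toSpanSingleton ℂ
      (-(z ^ 2)⁻¹)).restrictScalars ℝ) z :=
    (hasDerivAt_inv hz).hasFDerivAt.restrictScalars ℝ
  have ha := HasFDerivAt.comp (𝕜 := ℝ) z ((Complex.conjCLE : ℂ →L[ℝ] ℂ).hasFDerivAt (x := z⁻¹)) hb
  have ha' := HasFDerivAt.congr_of_eventuallyEq (f₁ := fun w : ℂ => ((starRingEnd ℂ) w)⁻¹) ha (Filter.Eventually.of_forall fun w => by simp)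
  have hz' : (starRingEnd ℂ) z ≠ 0 := by simpa using hz
  induction p with
  | zero =>
    have : rfl' 0 = fun w : ℂ => ((starRingEnd ℂ) w)⁻¹ := funext rfl'_zero
    rw [this]
    refine ⟨_, ha', ?_, ?_⟩
    · simp; field_simp
    · simp; field_simp
  | succ p ih =>
    obtain ⟨L, h1, h2, h3⟩ := ih
    have : rfl' (p + 1) = fun w : ℂ => rfl' p w * (((starRingEnd ℂ) w)⁻¹ * w⁻¹) :=
      funext (rfl'_succ p)
    rw [this]
    refine ⟨_, h1.mul (ha'.mul hb), ?_, ?_⟩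
    · simp [h2]; field_simp; ring
    · simp [h3]; field_simp; ring

/-- extension by reflection -/
noncomputable def EL (N : ℕ) (l : ℕ → ℂ) (f : ℂ → ℂ) (z : ℂ) : ℂ :=
  if ‖z‖ ≤ 1 then f z else ∑ p ∈ Finset.range N, l p * f (rfl' p z)

lemma EL_in {N : ℕ} {l : ℕ → ℂ} {f : ℂ → ℂ} {z : ℂ} (hz : z ∈ DD) : EL N l f z = f z := by
  rw [EL, if_pos (by simpa using hz)]

lemma EL_out {N : ℕ} {l : ℕ → ℂ} (hl : ∑ p ∈ Finset.range N, l p = 1) {f : ℂ → ℂ} {z : ℂ}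
    (hz : z ∈ EE) : EL N l f z = ∑ p ∈ Finset.range N, l p * f (rfl' p z) := by
  by_cases h : ‖z‖ ≤ 1
  · have h1 : ‖z‖ = 1 := le_antisymm h hz
    rw [EL, if_pos h]
    simp only [rfl'_circle _ h1]
    rw [← Finset.sum_mul, hl, one_mul]
  · rw [EL, if_neg h]

lemma crossing {x y : ℂ} (hx : x ∈ DD) (hy : y ∈ EE) :
    ∃ p, ‖p‖ = 1 ∧ ‖x - p‖ ≤ ‖x - y‖ ∧ ‖p - y‖ ≤ ‖x - y‖ := by
  have hx' : ‖x‖ ≤ 1 := by simpa using hx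
  have hc : ContinuousOn (fun t : ℝ => ‖x + t • (y - x)‖) (Set.Icc 0 1) := by fun_prop
  have := intermediate_value_Icc zero_le_one hc
  have h1 : (1 : ℝ) ∈ Set.Icc (‖x + (0 : ℝ) • (y - x)‖) (‖x + (1 : ℝ) • (y - x)‖) := by
    simp only [zero_smul, add_zero, one_smul, add_sub_cancel]
    exact ⟨hx', hy⟩
  obtain ⟨t, ⟨ht0, ht1⟩, ht⟩ := this h1
  refine ⟨x + t • (y - x), ht, ?_, ?_⟩
  · have : x - (x + t • (y - x)) = t • (x - y) := by simp; ring
    rw [this, norm_smul, Real.norm_of_nonneg ht0]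
    exact mul_le_of_le_one_left (norm_nonneg _) ht1
  · have : x + t • (y - x) - y = (1 - t) • (x - y) := by simp; ring
    rw [this, norm_smul, Real.norm_of_nonneg (by linarith)]
    exact mul_le_of_le_one_left (norm_nonneg _) (by linarith)

lemma H0.EL {α : ℝ} (hα₀ : 0 < α) {N : ℕ} {l : ℕ → ℂ} (hl : ∑ p ∈ Finset.range N, l p = 1)
    {f : ℂ → ℂ} (hf : H0 α DD f) : H0 α Set.univ (EL N l f) := by
  -- exterior part
  have hext : H0 α EE (fun z => ∑ p ∈ Finset.range N, l p * f (rfl' p z)) := by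
    apply Hol.sum (m := 0)
    intro p _
    apply Hol.smul (m := 0)
    obtain ⟨C, hC, h1, h2⟩ := hf
    obtain ⟨k1, K, hK, k2⟩ := rfl'_lip p
    have hm : ∀ x ∈ EE, rfl' p x ∈ DD := fun x hx => by simpa using k1 x hx
    refine ⟨C + C * K ^ α, by positivity, fun x hx => ?_, fun x hx y hy => ?_⟩
    · have : 0 ≤ C * K ^ α := by positivity
      linarith [h1 _ (hm x hx)]
    · refine (h2 _ (hm x hx) _ (hm y hy)).trans ?_
      have e1 : ‖rfl' p x - rfl' p y‖ ^ α ≤ (K * ‖x - y‖) ^ α :=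
        Real.rpow_le_rpow (norm_nonneg _) (k2 x hx y hy) hα₀.le
      rw [Real.mul_rpow hK (norm_nonneg _)] at e1
      have e2 := mul_le_mul_of_nonneg_left e1 hC
      have : 0 ≤ C * ‖x - y‖ ^ α := by positivity
      nlinarith
  obtain ⟨C, hC, h1, h2⟩ := hf.congr (g := _root_.EL N l f) fun z hz => EL_in hz
  obtain ⟨D, hD, k1, k2⟩ := hext.congr (g := _root_.EL N l f) fun z hz => EL_out hl hz
  have hmix : ∀ x ∈ DD, ∀ y ∈ EE, ‖_root_.EL N l f x - _root_.EL N l f y‖ ≤ (C + D) * ‖x - y‖ ^ α := by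
    intro x hx y hy
    obtain ⟨p, hp, hp1, hp2⟩ := crossing hx hy
    have a1 := h2 x hx p (by simp [hp])
    have a2 := k2 p (by simp [hp]) y hy
    have b1 : ‖x - p‖ ^ α ≤ ‖x - y‖ ^ α := Real.rpow_le_rpow (norm_nonneg _) hp1 hα₀.le
    have b2 : ‖p - y‖ ^ α ≤ ‖x - y‖ ^ α := Real.rpow_le_rpow (norm_nonneg _) hp2 hα₀.le
    have := norm_sub_le_norm_sub_add_norm_sub (_root_.EL N l f x) (_root_.EL N l f p) (_root_.EL N l f y)
    nlinarith [mul_le_mul_of_nonneg_left b1 hC, mul_le_mul_of_nonneg_left b2 hD]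
  have hdich : ∀ x : ℂ, x ∈ DD ∨ x ∈ EE := fun x => by
    simpa using le_total ‖x‖ 1
  refine ⟨C + D, by positivity, fun x _ => ?_, fun x _ y _ => ?_⟩
  · rcases hdich x with h | h
    · linarith [h1 x h]
    · linarith [k1 x h]
  · have hp : 0 ≤ ‖x - y‖ ^ α := by positivity
    rcases hdich x with h | h <;> rcases hdich y with h' | h'
    · nlinarith [h2 x h y h']
    · exact hmix x h y h'
    · rw [norm_sub_rev, norm_sub_rev x y]; exact hmix y h' x h
    · nlinarith [k2 x h y h']

/-- linear map from polar data -/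
noncomputable def PL (z A B : ℂ) : ℂ →L[ℝ] ℂ :=
  (D2 A B).comp ((ContinuousLinearMap.mul ℝ ℂ) z⁻¹)

lemma PL_apply (z A B h : ℂ) : PL z A B h = ((z⁻¹ * h).re : ℂ) * A + ((z⁻¹ * h).im : ℂ) * B := by
  simp [PL, D2_apply]

lemma eq_PL {z : ℂ} (hz : z ≠ 0) (L : ℂ →L[ℝ] ℂ) : L = PL z (L z) (L (Complex.I * z)) := by
  ext h
  have : h = (z⁻¹ * h).re • z + (z⁻¹ * h).im • (Complex.I * z) := by
    have e := Complex.re_add_im (z⁻¹ * h)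
    have : h = (z⁻¹ * h) * z := by field_simp
    conv_lhs => rw [this, ← e]
    simp only [Complex.real_smul]; ring
  rw [PL_apply]
  conv_lhs => rw [this]
  rw [map_add, map_smul, map_smul, Complex.real_smul, Complex.real_smul]

lemma EL_deriv {N : ℕ} {l : ℕ → ℂ} (hl : ∑ p ∈ Finset.range N, l p = 1)
    (hl' : ∑ p ∈ Finset.range N, l p * (-(2 * p + 1)) = 1)
    {f g₁ g₂ : ℂ → ℂ} (hf : ∀ x ∈ DD, HasFDerivWithinAt f (D2 (g₁ x) (g₂ x)) DD x)
    {z : ℂ} (hz : z ≠ 0) :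
    HasFDerivAt (EL N l f)
      (PL z (EL N (fun p => l p * (-(2 * p + 1))) (fun w => D2 (g₁ w) (g₂ w) w) z)
        (EL N l (fun w => D2 (g₁ w) (g₂ w) (Complex.I * w)) z)) z := by
  set T := (PL z (EL N (fun p => l p * (-(2 * p + 1))) (fun w => D2 (g₁ w) (g₂ w) w) z)
        (EL N l (fun w => D2 (g₁ w) (g₂ w) (Complex.I * w)) z)) with hT
  have hin : z ∈ DD → HasFDerivWithinAt (EL N l f) T DD z := by
    intro h
    rw [hT, EL_in h, EL_in h, ← eq_PL hz]
    exact (hf z h).congr (fun w hw => EL_in hw) (EL_in h)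
  have hout : z ∈ EE → HasFDerivWithinAt (EL N l f) T EE z := by
    intro h
    choose L hL1 hL2 hL3 using fun p => rfl'_deriv p hz
    have hm : ∀ p, Set.MapsTo (rfl' p) EE DD := fun p x hx => by simpa using (rfl'_lip p).1 x hx
    have h1 : HasFDerivWithinAt (fun z => ∑ p ∈ Finset.range N, l p * f (rfl' p z))
        (∑ p ∈ Finset.range N, l p • ((D2 (g₁ (rfl' p z)) (g₂ (rfl' p z))).comp (L p))) EE z := by
      apply HasFDerivWithinAt.fun_sum
      intro p _
      exact ((hf _ (hm p h)).comp z (hL1 p).hasFDerivWithinAt (hm p)).const_mul (l p)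
    have h2 := h1.congr (fun w hw => EL_out hl hw) (EL_out (f := f) hl h)
    refine h2.congr_fderiv ?_
    rw [hT, EL_out hl' h, EL_out hl h]
    rw [eq_PL hz (∑ p ∈ Finset.range N, l p • ((D2 (g₁ (rfl' p z)) (g₂ (rfl' p z))).comp (L p)))]
    congr 1
    · rw [_root_.sum_apply]
      refine Finset.sum_congr rfl fun p _ => ?_
      have : ∀ (M : ℂ →L[ℝ] ℂ) (w : ℂ), M (-(2 * (p : ℂ) + 1) * w) = (-(2 * (p : ℂ) + 1)) * M w := by
        intro M w
        have := M.map_smul (-(2 * (p : ℝ) + 1)) w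
        simpa using this
      rw [_root_.smul_apply, ContinuousLinearMap.comp_apply, hL2, this, smul_eq_mul]
      ring
    · rw [_root_.sum_apply]
      refine Finset.sum_congr rfl fun p _ => ?_
      simp [hL3]
  rcases lt_trichotomy ‖z‖ 1 with h | h | h
  · exact (hin (by simpa using h.le)).hasFDerivAt
      (Metric.closedBall_mem_nhds_of_mem (by simpa using h))
  · have h3 := (hin (by simp [h])).union (hout (by simp [h]))
    have : DD ∪ EE = Set.univ := by
      ext w; simpa using le_total ‖w‖ 1
    rw [this] at h3
    simpa using h3
  · refine (hout h.le).hasFDerivAt ?_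
    exact Filter.mem_of_superset ((isOpen_lt continuous_const continuous_norm).mem_nhds h)
      (fun w (hw : 1 < ‖w‖) => hw.le)

/-- smooth functions supported in a closed annulus -/
def Ann (ψ : ℂ → ℂ) : Prop := ContDiff ℝ (⊤ : ℕ∞) ψ ∧ ∀ z, ψ z ≠ 0 → 1 / 2 ≤ ‖z‖ ∧ ‖z‖ ≤ 2

lemma Ann.hcs {ψ : ℂ → ℂ} (h : Ann ψ) : HasCompactSupport ψ :=
  HasCompactSupport.of_support_subset_isCompact (isCompact_closedBall (0 : ℂ) 2)
    fun z hz => by simpa using (h.2 z hz).2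

lemma Ann.evt {ψ : ℂ → ℂ} (h : Ann ψ) : ∀ᶠ z in nhds (0 : ℂ), ψ z = 0 := by
  filter_upwards [Metric.ball_mem_nhds (0 : ℂ) (by norm_num : (0 : ℝ) < 1 / 2)] with z hz
  by_contra hne
  have := (h.2 z hne).1
  simp at hz; linarith

lemma Ann.fderiv {ψ : ℂ → ℂ} (h : Ann ψ) (e : ℂ) : Ann (fun z => fderiv ℝ ψ z e) := by
  refine ⟨(h.1.fderiv_right (by simp)).clm_apply contDiff_const, fun z hz => ?_⟩
  have hcl : IsClosed {z : ℂ | 1 / 2 ≤ ‖z‖ ∧ ‖z‖ ≤ 2} :=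
    (isClosed_le continuous_const continuous_norm).inter
      (isClosed_le continuous_norm continuous_const)
  by_contra hne
  apply hz
  have : ψ =ᶠ[nhds z] fun _ => 0 := by
    filter_upwards [hcl.isOpen_compl.mem_nhds hne] with w hw
    by_contra h'
    exact hw (h.2 w h')
  simp [this.fderiv_eq]

lemma Ann.mul {ψ : ℂ → ℂ} (h : Ann ψ) {g : ℂ → ℂ} (hg : ∀ z ≠ 0, ContDiffAt ℝ (⊤ : ℕ∞) g z) :
    Ann (fun z => ψ z * g z) := by
  refine ⟨contDiff_iff_contDiffAt.2 fun z => ?_, fun z hz => h.2 z (left_ne_zero_of_mul hz)⟩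
  by_cases hz : z = 0
  · subst hz
    apply (contDiffAt_const (c := (0 : ℂ))).congr_of_eventuallyEq
    filter_upwards [h.evt] with w hw
    simp [hw]
  · exact h.1.contDiffAt.mul (hg z hz)

lemma Hol.EL {α : ℝ} (hα₀ : 0 < α) (hα₁ : α < 1) {N m : ℕ} {l : ℕ → ℂ}
    (hl : ∀ i ≤ m, ∑ p ∈ Finset.range N, l p * (-(2 * p + 1)) ^ i = 1)
    {f : ℂ → ℂ} (hf : Hol α DD m f) {ψ : ℂ → ℂ} (hψ : Ann ψ) :
    Hol α Set.univ m (fun z => ψ z * EL N l f z) := by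
  induction m generalizing l f ψ with
  | zero =>
    exact (Hol.of_smooth hα₀ hα₁ 0 hψ.1 hψ.hcs).mul
      (H0.EL hα₀ (by simpa using hl 0 le_rfl) hf)
  | succ m ih =>
    have hl0 : ∑ p ∈ Finset.range N, l p = 1 := by simpa using hl 0 (by omega)
    have hl1 : ∑ p ∈ Finset.range N, l p * (-(2 * p + 1)) = 1 := by simpa using hl 1 (by omega)
    have hlm : ∀ i ≤ m, ∑ p ∈ Finset.range N, (l p * (-(2 * p + 1))) * (-(2 * p + 1)) ^ i = 1 := by
      intro i hi
      refine Eq.trans (Finset.sum_congr rfl fun p _ => by ring) (hl (i + 1) (by omega))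
    have hf' := hf.pred
    obtain ⟨h0, g₁, g₂, hd, h1, h2⟩ := hf
    have hre : Hol α DD m (fun z => (z.re : ℂ)) := Hol.of_smooth_ball hα₀ hα₁ m
      (Complex.ofRealCLM.contDiff.comp Complex.reCLM.contDiff)
    have him : Hol α DD m (fun z => (z.im : ℂ)) := Hol.of_smooth_ball hα₀ hα₁ m
      (Complex.ofRealCLM.contDiff.comp Complex.imCLM.contDiff)
    have hs : Hol α DD m (fun w => D2 (g₁ w) (g₂ w) w) := by
      simp only [D2_apply]
      exact (hre.mul h1).add (him.mul h2)
    have ht : Hol α DD m (fun w => D2 (g₁ w) (g₂ w) (Complex.I * w)) := by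
      refine ((him.smul (-1)).mul h1 |>.add (hre.mul h2)).congr fun w _ => ?_
      simp [D2_apply]
    have hinv : ∀ e : ℂ, ∀ z ≠ 0, ContDiffAt ℝ (⊤ : ℕ∞) (fun z : ℂ => z⁻¹ * e) z := fun e z hz =>
      (contDiffAt_inv ℝ hz).mul contDiffAt_const
    have hR : ∀ e : ℂ, Ann (fun z => ψ z * (((z⁻¹ * e).re : ℝ) : ℂ)) := fun e =>
      hψ.mul fun z hz => (Complex.ofRealCLM.contDiff.comp Complex.reCLM.contDiff).contDiffAt.comp z
        (hinv e z hz)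
    have hI : ∀ e : ℂ, Ann (fun z => ψ z * (((z⁻¹ * e).im : ℝ) : ℂ)) := fun e =>
      hψ.mul fun z hz => (Complex.ofRealCLM.contDiff.comp Complex.imCLM.contDiff).contDiffAt.comp z
        (hinv e z hz)
    have hlle : ∀ i ≤ m, ∑ p ∈ Finset.range N, l p * (-(2 * p + 1)) ^ i = 1 :=
      fun i hi => hl i (by omega)
    have key := fun e : ℂ => ((ih hlle hf' (hψ.fderiv e)).add (ih hlm hs (hR e))).add
      (ih hlle ht (hI e))
    refine ⟨((Hol.of_smooth hα₀ hα₁ 0 hψ.1 hψ.hcs).h0).mul (H0.EL hα₀ hl0 h0), _, _,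
      fun z _ => ?_, key 1, key Complex.I⟩
    rw [hasFDerivWithinAt_univ]
    by_cases hz : z = 0
    · subst hz
      have e1 : ψ =ᶠ[nhds 0] fun _ => 0 := hψ.evt
      have e2 : fderiv ℝ ψ 0 = 0 := by simp [e1.fderiv_eq]
      have e3 : ψ 0 = 0 := e1.self_of_nhds
      have e4 : (fun z => ψ z * _root_.EL N l f z) =ᶠ[nhds 0] fun _ => 0 := by
        filter_upwards [hψ.evt] with w hw
        simp [hw]
      refine ((hasFDerivAt_const (0 : ℂ) (0 : ℂ)).congr_of_eventuallyEq e4).congr_fderiv ?_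
      apply clm_ext_one_I <;> simp [D2_one, D2_I, e2, e3]
    · have e1 := (hψ.1.differentiable (by simp) z).hasFDerivAt
      refine (e1.mul (EL_deriv hl0 hl1 hd hz)).congr_fderiv ?_
      apply clm_ext_one_I <;> simp only [D2_one, D2_I] <;> simp [PL_apply] <;> ring

lemma exists_weights (m : ℕ) : ∃ l : ℕ → ℂ,
    ∀ i ≤ m, ∑ p ∈ Finset.range (m + 1), l p * (-(2 * p + 1)) ^ i = 1 := by
  let v : ℕ → ℂ := fun p => -(2 * p + 1)
  have hv : Set.InjOn v (Finset.range (m + 1)) := by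
    intro a _ b _ h
    simp only [v, neg_inj, add_left_inj] at h
    have := mul_left_cancel₀ two_ne_zero h
    exact_mod_cast this
  refine ⟨fun p => (Lagrange.basis (Finset.range (m + 1)) v p).eval 1, fun i hi => ?_⟩
  have h := Lagrange.eq_interpolate (f := (Polynomial.X ^ i : Polynomial ℂ)) hv (by
    rw [Polynomial.degree_X_pow, Finset.card_range]; exact_mod_cast Nat.lt_succ_of_le hi)
  have h2 := congrArg (Polynomial.eval 1) h
  rw [Lagrange.interpolate_apply, Polynomial.eval_finsetSum] at h2
  simp at h2
  refine Eq.trans (Finset.sum_congr rfl fun p _ => ?_) h2.symm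
  simp only [v]; ring

lemma Hol.cutin {α : ℝ} (hα₀ : 0 < α) (hα₁ : α < 1) {m : ℕ} 
    {f : ℂ → ℂ} (hf : Hol α DD m f) {ψ : ℂ → ℂ} (hψ : ContDiff ℝ (⊤ : ℕ∞) ψ) 
    (hs : ∀ z, ψ z ≠ 0 → ‖z‖ ^ 2 ≤ 2 / 3) :
    Hol α Set.univ m (fun z => ψ z * f z) := by
  have hsub : {z : ℂ | ‖z‖ ^ 2 ≤ 2 / 3} ⊆ Metric.ball 0 1 := fun z hz => by
    have : ‖z‖ ^ 2 ≤ 2 / 3 := hz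
    simp; nlinarith [norm_nonneg z]
  have hcs : ∀ ψ : ℂ → ℂ, (∀ z, ψ z ≠ 0 → ‖z‖ ^ 2 ≤ 2 / 3) → HasCompactSupport ψ := fun ψ hs =>
    HasCompactSupport.of_support_subset_isCompact (isCompact_closedBall (0 : ℂ) 1)
      fun z hz => Metric.ball_subset_closedBall (hsub (hs z hz))
  have hcl : IsClosed {z : ℂ | ‖z‖ ^ 2 ≤ 2 / 3} :=
    isClosed_le (by fun_prop) continuous_const
  have key : ∀ f ψ : ℂ → ℂ, H0 α DD f → ContDiff ℝ (⊤ : ℕ∞) ψ → (∀ z, ψ z ≠ 0 → ‖z‖ ^ 2 ≤ 2 / 3) →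
      H0 α Set.univ (fun z => ψ z * f z) := by
    intro f ψ hf hψ hs
    have h1 := H0.EL hα₀ (N := 1) (l := fun _ => 1) (by simp) hf
    refine ((Hol.of_smooth hα₀ hα₁ 0 hψ (hcs ψ hs)).h0.mul h1).congr fun z _ => ?_
    by_cases hz : ψ z = 0
    · simp [hz]
    · simp only
      rw [EL_in]
      exact Metric.ball_subset_closedBall (hsub (hs z hz))
  induction m generalizing f ψ with
  | zero => exact key f ψ hf hψ hs
  | succ m ih =>
    have hf' := hf.pred
    obtain ⟨h0, g₁, g₂, hd, h1, h2⟩ := hf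
    have hdψ : ∀ z, ¬ ‖z‖ ^ 2 ≤ 2 / 3 → ψ =ᶠ[nhds z] fun _ => 0 := by
      intro z hz
      filter_upwards [hcl.isOpen_compl.mem_nhds hz] with w hw
      by_contra h'
      exact hw (hs w h')
    have hsd : ∀ e z, fderiv ℝ ψ z e ≠ 0 → ‖z‖ ^ 2 ≤ 2 / 3 := by
      intro e z hz
      by_contra hne
      apply hz
      simp [(hdψ z hne).fderiv_eq]
    have hsm : ∀ e, ContDiff ℝ (⊤ : ℕ∞) (fun z => fderiv ℝ ψ z e) := fun e =>
      (hψ.fderiv_right (by simp)).clm_apply contDiff_const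
    refine ⟨key f ψ h0 hψ hs, _, _, fun z _ => ?_,
      (ih hf' (hsm 1) (hsd 1)).add (ih h1 hψ hs),
      (ih hf' (hsm Complex.I) (hsd Complex.I)).add (ih h2 hψ hs)⟩
    rw [hasFDerivWithinAt_univ]
    by_cases hz : ‖z‖ ^ 2 ≤ 2 / 3
    · have e1 := (hψ.differentiable (by simp) z).hasFDerivAt
      have hzb := hsub hz
      have e2 := (hd z (Metric.ball_subset_closedBall hzb)).hasFDerivAt
        (Metric.closedBall_mem_nhds_of_mem hzb)
      refine (e1.mul e2).congr_fderiv ?_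
      apply clm_ext_one_I <;> simp [D2_one, D2_I] <;> ring
    · have e1 := hdψ z hz
      have e2 : fderiv ℝ ψ z = 0 := by simp [e1.fderiv_eq]
      have e3 : ψ z = 0 := e1.self_of_nhds
      have e4 : (fun z => ψ z * f z) =ᶠ[nhds z] fun _ => 0 := by
        filter_upwards [e1] with w hw
        simp [hw]
      refine ((hasFDerivAt_const (0 : ℂ) z).congr_of_eventuallyEq e4).congr_fderiv ?_
      apply clm_ext_one_I <;> simp [D2_one, D2_I, e2, e3]

theorem exists_extension {α : ℝ} (hα₀ : 0 < α) (hα₁ : α < 1) {m : ℕ} {f : ℂ → ℂ}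
    (hf : Hol α DD m f) : ∃ g : ℂ → ℂ, Hol α Set.univ m g ∧ (∀ z ∈ DD, g z = f z) ∧
      ∀ z, 2 < ‖z‖ → g z = 0 := by
  obtain ⟨l, hl⟩ := exists_weights m
  have hψ : Ann (fun z => cut 1 z - cut 3 z) := by
    refine ⟨(cut_contDiff 1).sub (cut_contDiff 3), fun z hz => ?_⟩
    constructor
    · by_contra h
      apply hz
      have : ‖z‖ ^ 2 ≤ 1 / 4 := by nlinarith [norm_nonneg z]
      show cut 1 z - cut 3 z = 0
      rw [cut_one, cut_one, sub_self] <;> rw [Complex.normSq_eq_norm_sq] <;> linarith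
    · by_contra h
      apply hz
      have : 4 ≤ ‖z‖ ^ 2 := by nlinarith [norm_nonneg z]
      show cut 1 z - cut 3 z = 0
      rw [cut_zero, cut_zero, sub_self] <;> rw [Complex.normSq_eq_norm_sq] <;> linarith
  have h1 := Hol.EL hα₀ hα₁ hl hf hψ
  have h2 := Hol.cutin hα₀ hα₁ hf (cut_contDiff 3) (fun z hz => by
    by_contra h
    apply hz
    apply cut_zero
    rw [Complex.normSq_eq_norm_sq]; linarith)
  refine ⟨_, h1.add h2, fun z hz => ?_, fun z hz => ?_⟩
  · have : ‖z‖ ≤ 1 := by simpa using hz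
    rw [EL_in hz, cut_one (c := 1)]
    · ring
    · rw [Complex.normSq_eq_norm_sq]; nlinarith [norm_nonneg z]
  · have : 4 ≤ ‖z‖ ^ 2 := by nlinarith [norm_nonneg z]
    rw [cut_zero, cut_zero]
    · simp
    all_goals rw [Complex.normSq_eq_norm_sq]; linarith

/-- scaled average -/
noncomputable def AA (ρ : ℂ → ℂ) (s : ℝ) (f : ℂ → ℂ) (x : ℂ) : ℂ := ∫ t, ρ t * f (x - s * t)

/-- partial derivative in the direction `e` -/
noncomputable def pd (e : ℂ) (f : ℂ → ℂ) : ℂ → ℂ := fun z => fderiv ℝ f z e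

/-- test functions -/
def TF (ρ : ℂ → ℂ) : Prop := ContDiff ℝ (⊤ : ℕ∞) ρ ∧ HasCompactSupport ρ

lemma TF.pd {ρ : ℂ → ℂ} (h : TF ρ) (e : ℂ) : TF (pd e ρ) :=
  ⟨(h.1.fderiv_right (by simp)).clm_apply contDiff_const, h.2.fderiv_apply (𝕜 := ℝ) e⟩

lemma TF.integrable {ρ : ℂ → ℂ} (h : TF ρ) : Integrable ρ :=
  h.1.continuous.integrable_of_hasCompactSupport h.2

/-- bounded continuous -/
def BC (f : ℂ → ℂ) : Prop := Continuous f ∧ ∃ M : ℝ, 0 ≤ M ∧ ∀ x, ‖f x‖ ≤ M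

lemma H0.bc {α : ℝ} (hα₀ : 0 < α) {f : ℂ → ℂ} (h : H0 α Set.univ f) : BC f := by
  refine ⟨h.continuous hα₀, ?_⟩
  obtain ⟨C, hC, h1, -⟩ := h
  exact ⟨C, hC, fun x => h1 x trivial⟩

lemma AA_integrable {ρ : ℂ → ℂ} (h : Integrable ρ) {f : ℂ → ℂ} (hf : BC f) (s : ℝ) (x : ℂ) :
    Integrable (fun t => ρ t * f (x - s * t)) := by
  obtain ⟨hc, M, hM, hb⟩ := hf
  refine h.mul_bdd (c := M) ?_ (Filter.Eventually.of_forall fun t => hb _)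
  exact (by fun_prop : Continuous fun t : ℂ => f (x - s * t)).aestronglyMeasurable

lemma AA_bound {ρ : ℂ → ℂ} {f : ℂ → ℂ} {M : ℝ} (h : Integrable ρ) (hb : ∀ x, ‖f x‖ ≤ M)
    (s : ℝ) (x : ℂ) : ‖AA ρ s f x‖ ≤ (∫ t, ‖ρ t‖) * M := by
  rw [← integral_mul_const]
  refine norm_integral_le_of_norm_le (h.norm.mul_const M) (Filter.Eventually.of_forall fun t => ?_)
  rw [norm_mul]
  exact mul_le_mul_of_nonneg_left (hb _) (norm_nonneg _)

lemma AA_deriv {ρ : ℂ → ℂ} (h : TF ρ) {s : ℝ} (hs : 0 < s) {f : ℂ → ℂ} (hf : BC f) (x : ℂ) :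
    HasFDerivAt (AA ρ s f) (D2 (s⁻¹ * AA (pd 1 ρ) s f x) (s⁻¹ * AA (pd Complex.I ρ) s f x)) x := by
  have hs' : (s : ℂ) ≠ 0 := by exact_mod_cast hs.ne'
  have hfs : Continuous (fun y : ℂ => f (s * y)) := by have := hf.1; fun_prop
  have h1 := h.2.hasFDerivAt_convolution_left (μ := volume) (ContinuousLinearMap.mul ℝ ℂ)
    (h.1.of_le (by norm_cast)) (g := fun y : ℂ => f (s * y))
    hfs.locallyIntegrable ((s : ℂ)⁻¹ * x)
  have h2 : HasFDerivAt (fun x : ℂ => (s : ℂ)⁻¹ * x) ((ContinuousLinearMap.mul ℝ ℂ) (s : ℂ)⁻¹) x :=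
    ((ContinuousLinearMap.mul ℝ ℂ) (s : ℂ)⁻¹).hasFDerivAt
  have h3 := h1.comp x h2
  have key : ∀ t : ℂ, (s : ℂ) * ((s : ℂ)⁻¹ * x - t) = x - s * t := fun t => by field_simp
  have e0 : AA ρ s f = (convolution ρ (fun y : ℂ => f (s * y)) (ContinuousLinearMap.mul ℝ ℂ) volume) ∘
      (fun x : ℂ => (s : ℂ)⁻¹ * x) := by
    funext x
    have key : ∀ t : ℂ, (s : ℂ) * ((s : ℂ)⁻¹ * x - t) = x - s * t := fun t => by field_simp
    simp [AA, convolution, key]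
  rw [e0]
  refine h3.congr_fderiv ?_
  have e1 : ∀ e : ℂ, (convolution (fderiv ℝ ρ) (fun y : ℂ => f (s * y))
      ((ContinuousLinearMap.mul ℝ ℂ).precompL ℂ) volume ((s : ℂ)⁻¹ * x)) e = AA (pd e ρ) s f x := by
    intro e
    rw [convolution, ContinuousLinearMap.integral_apply]
    · simp [AA, pd, key]
    · exact ((h.2.fderiv (𝕜 := ℝ)).convolutionExists_left _
        (h.1.continuous_fderiv (by simp)) hfs.locallyIntegrable _)
  have e2 : ∀ (L : ℂ →L[ℝ] ℂ) (e : ℂ), L ((s : ℂ)⁻¹ * e) = (s : ℂ)⁻¹ * L e := by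
    intro L e
    have := L.map_smul (s⁻¹) e
    simpa using this
  apply clm_ext_one_I <;> simp only [D2_one, D2_I, ContinuousLinearMap.comp_apply,
    ContinuousLinearMap.mul_apply', e2, e1, Complex.ofReal_inv]

lemma TF.integral_pd {ρ : ℂ → ℂ} (h : TF ρ) : ∫ t, _root_.pd 1 ρ t = 0 ∧ ∫ t, _root_.pd Complex.I ρ t = 0 := by
  have hc : BC (fun _ => 1) := ⟨continuous_const, 1, zero_le_one, fun _ => by simp⟩
  have h1 := AA_deriv h one_pos hc 0
  have h2 : AA ρ 1 (fun _ => 1) = fun _ => ∫ t, ρ t := by funext x; simp [AA]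
  rw [h2] at h1
  have h3 := h1.unique (hasFDerivAt_const _ _)
  have a := congrArg (fun L => L 1) h3
  have b := congrArg (fun L => L Complex.I) h3
  simp [D2_one, D2_I, AA] at a b
  exact ⟨a, b⟩

/-- Lipschitz from partials -/
lemma lip_of_partials {f g₁ g₂ : ℂ → ℂ} {C : ℝ} (hC : 0 ≤ C) (hd : ∀ x, HasFDerivAt f (D2 (g₁ x) (g₂ x)) x)
    (h1 : ∀ x, ‖g₁ x‖ ≤ C) (h2 : ∀ x, ‖g₂ x‖ ≤ C) (x y : ℂ) : ‖f x - f y‖ ≤ (2 * C) * ‖x - y‖ := by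
  refine Convex.norm_image_sub_le_of_norm_hasFDerivWithin_le (s := Set.univ)
    (fun z _ => (hd z).hasFDerivWithinAt) (fun z _ => ?_) convex_univ trivial trivial
  refine ContinuousLinearMap.opNorm_le_bound _ (by positivity) fun w => ?_
  rw [D2_apply]
  refine (norm_add_le _ _).trans ?_
  rw [norm_mul, norm_mul, Complex.norm_real, Complex.norm_real]
  have a := Complex.abs_re_le_norm w
  have b := Complex.abs_im_le_norm w
  have := mul_le_mul a (h1 z) (norm_nonneg _) (norm_nonneg _)
  have := mul_le_mul b (h2 z) (norm_nonneg _) (norm_nonneg _)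
  simp only [Real.norm_eq_abs]
  linarith

lemma D2_norm_le {a b : ℂ} {C : ℝ} (h1 : ‖a‖ ≤ C) (h2 : ‖b‖ ≤ C) : ‖D2 a b‖ ≤ 2 * C := by
  have hC := (norm_nonneg _).trans h1
  refine ContinuousLinearMap.opNorm_le_bound _ (by positivity) fun w => ?_
  rw [D2_apply]
  refine (norm_add_le _ _).trans ?_
  rw [norm_mul, norm_mul, Complex.norm_real, Complex.norm_real]
  have a := Complex.abs_re_le_norm w
  have b := Complex.abs_im_le_norm w
  have := mul_le_mul a h1 (norm_nonneg _) (norm_nonneg _)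
  have := mul_le_mul b h2 (norm_nonneg _) (norm_nonneg _)
  simp only [Real.norm_eq_abs]
  linarith

lemma AA_holder {α : ℝ} (hα₀ : 0 < α) {ρ : ℂ → ℂ} (h : TF ρ) (h0 : ∫ t, ρ t = 0) {f : ℂ → ℂ}
    (hf : H0 α Set.univ f) : ∃ C : ℝ, 0 ≤ C ∧ ∀ s : ℝ, 0 < s → ∀ x, ‖AA ρ s f x‖ ≤ C * s ^ α := by
  have hbc := hf.bc hα₀
  obtain ⟨M, hM, h1, h2⟩ := hf
  have hintg : Integrable (fun t => ‖ρ t‖ * ‖t‖ ^ α) := by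
    refine Continuous.integrable_of_hasCompactSupport ?_ h.2.norm.mul_right
    exact h.1.continuous.norm.mul (continuous_norm.rpow_const fun _ => Or.inr hα₀.le)
  refine ⟨(∫ t, ‖ρ t‖ * ‖t‖ ^ α) * M, mul_nonneg (integral_nonneg fun t => by positivity) hM,
    fun s hs x => ?_⟩
  have e1 : AA ρ s f x = ∫ t, ρ t * (f (x - s * t) - f x) := by
    simp only [mul_sub]
    rw [integral_sub (AA_integrable h.integrable hbc s x) (h.integrable.mul_const _),
      integral_mul_const, h0, AA]
    simp
  rw [e1, mul_assoc, ← integral_mul_const]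
  refine norm_integral_le_of_norm_le (hintg.mul_const _) (Filter.Eventually.of_forall fun t => ?_)
  rw [norm_mul, mul_assoc]
  refine mul_le_mul_of_nonneg_left ?_ (norm_nonneg _)
  refine (h2 _ trivial _ trivial).trans (le_of_eq ?_)
  have : ‖x - s * t - x‖ = s * ‖t‖ := by simp [abs_of_pos hs]
  rw [this, Real.mul_rpow hs.le (norm_nonneg _)]; ring

/-- dyadic summation -/
lemma H0.tsum {α : ℝ} (hα₀ : 0 < α) (hα₁ : α < 1) {g : ℕ → ℂ → ℂ} {A : ℝ} (hA : 0 ≤ A)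
    (h1 : ∀ j x, ‖g j x‖ ≤ A * ((1 / 2 : ℝ) ^ α) ^ j)
    (h2 : ∀ j x y, ‖g j x - g j y‖ ≤ A * ((2 : ℝ) ^ (1 - α)) ^ j * ‖x - y‖) :
    H0 α Set.univ (fun x => ∑' j, g j x) := by
  set r : ℝ := (1 / 2 : ℝ) ^ α with hr
  set q : ℝ := (2 : ℝ) ^ (1 - α) with hq
  have hr0 : 0 < r := by positivity
  have hr1 : r < 1 := Real.rpow_lt_one (by norm_num) (by norm_num) hα₀
  have hq1 : 1 < q := Real.one_lt_rpow (by norm_num) (by linarith)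
  have hqr : q = 2 * r := by
    rw [hq, hr, Real.rpow_sub (by norm_num), Real.rpow_one, one_div, Real.inv_rpow (by norm_num)]
    rfl
  have hs : ∀ x, Summable (fun j => g j x) := fun x =>
    Summable.of_norm_bounded ((summable_geometric_of_lt_one hr0.le hr1).mul_left A) (fun j => h1 j x)
  have hb : ∀ x, ‖∑' j, g j x‖ ≤ A * (1 - r)⁻¹ := fun x =>
    tsum_of_norm_bounded ((hasSum_geometric_of_lt_one hr0.le hr1).mul_left A) (fun j => h1 j x)
  have h1r : 0 < (1 - r)⁻¹ := inv_pos.2 (by linarith)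
  have hq' : 0 < (q - 1)⁻¹ := inv_pos.2 (by linarith)
  refine ⟨A * (q - 1)⁻¹ * q + 2 * A * (1 - r)⁻¹ * r⁻¹ + 2 * (A * (1 - r)⁻¹), by positivity,
    fun x _ => (hb x).trans ?_, fun x _ y _ => ?_⟩
  · have : 0 ≤ A * (q - 1)⁻¹ * q + 2 * A * (1 - r)⁻¹ * r⁻¹ := by positivity
    have : 0 ≤ A * (1 - r)⁻¹ := by positivity
    linarith
  · set d := ‖x - y‖ with hd
    have hdα : 0 ≤ d ^ α := by positivity
    have hP1 : 0 ≤ A * (q - 1)⁻¹ * q := by positivity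
    have hP2 : 0 ≤ 2 * A * (1 - r)⁻¹ * r⁻¹ := by positivity
    have hP3 : 0 ≤ 2 * (A * (1 - r)⁻¹) := by positivity
    rcases (norm_nonneg (x - y)).eq_or_lt with h0 | h0
    · have : x = y := by rw [← sub_eq_zero, ← norm_eq_zero, ← h0]
      subst this
      simp only [sub_self, norm_zero]; positivity
    rcases le_total d 1 with hle | hle
    · obtain ⟨J, hJ1, hJ2⟩ := exists_nat_pow_near_of_lt_one h0 hle (by norm_num : (0:ℝ) < 1 / 2)
        (by norm_num)
      have hpow : ∀ i : ℕ, ((1 / 2 : ℝ) ^ i) ^ α = r ^ i := fun i => by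
        rw [hr, ← Real.rpow_natCast, ← Real.rpow_natCast, ← Real.rpow_mul (by norm_num),
          ← Real.rpow_mul (by norm_num), mul_comm]
      have f1 : r ^ (J + 1) ≤ d ^ α := by
        rw [← hpow]; exact Real.rpow_le_rpow (by positivity) hJ1.le hα₀.le
      have f2 : q ^ J * d ≤ d ^ α := by
        have : d ^ (1 - α) ≤ ((1 / 2 : ℝ) ^ J) ^ (1 - α) :=
          Real.rpow_le_rpow h0.le hJ2 (by linarith)
        have e : q ^ J * ((1 / 2 : ℝ) ^ J) ^ (1 - α) = 1 := by
          rw [hq, ← Real.rpow_natCast, ← Real.rpow_mul (by norm_num), mul_comm (1 - α),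
            Real.rpow_mul (by norm_num), Real.rpow_natCast, ← Real.mul_rpow (by positivity) (by positivity),
            ← mul_pow]
          norm_num
        have e2 : d = d ^ (1 - α) * d ^ α := by
          rw [← Real.rpow_add h0]; simp [hd]
        have hqJ : 0 < q ^ J := by positivity
        calc q ^ J * d = (q ^ J * d ^ (1 - α)) * d ^ α := by rw [mul_assoc, ← e2]
          _ ≤ (q ^ J * ((1 / 2 : ℝ) ^ J) ^ (1 - α)) * d ^ α := by gcongr
          _ = d ^ α := by rw [e, one_mul]
      have e3 : ∑' j, g j x - ∑' j, g j y = ∑ j ∈ Finset.range J, (g j x - g j y)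
          + ∑' j, (g (j + J) x - g (j + J) y) := by
        rw [← (hs x).tsum_sub (hs y), ((hs x).sub (hs y)).sum_add_tsum_nat_add J]
      rw [e3]
      have a1 : ‖∑ j ∈ Finset.range J, (g j x - g j y)‖ ≤ A * (q - 1)⁻¹ * q * d ^ α := by
        calc ‖∑ j ∈ Finset.range J, (g j x - g j y)‖ ≤ ∑ j ∈ Finset.range J, A * q ^ j * d :=
              norm_sum_le_of_le _ fun j _ => h2 j x y
          _ = A * (∑ j ∈ Finset.range J, q ^ j) * d := by rw [Finset.mul_sum, Finset.sum_mul]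
          _ = A * ((q ^ J - 1) * (q - 1)⁻¹) * d := by rw [geom_sum_eq hq1.ne', div_eq_mul_inv]
          _ ≤ A * (q ^ J * (q - 1)⁻¹) * d := by gcongr; linarith
          _ = A * (q - 1)⁻¹ * (q ^ J * d) := by ring
          _ ≤ A * (q - 1)⁻¹ * d ^ α := by gcongr
          _ ≤ A * (q - 1)⁻¹ * q * d ^ α := by
            exact mul_le_mul_of_nonneg_right (le_mul_of_one_le_right (by positivity) hq1.le) hdα
      have a2 : ‖∑' j, (g (j + J) x - g (j + J) y)‖ ≤ 2 * A * (1 - r)⁻¹ * r⁻¹ * d ^ α := by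
        have : ‖∑' j, (g (j + J) x - g (j + J) y)‖ ≤ (2 * A * r ^ J) * (1 - r)⁻¹ := by
          refine tsum_of_norm_bounded ((hasSum_geometric_of_lt_one hr0.le hr1).mul_left _) fun j => ?_
          refine (norm_sub_le _ _).trans ?_
          have := h1 (j + J) x
          have := h1 (j + J) y
          rw [pow_add] at *
          nlinarith
        refine this.trans ?_
        have : r ^ J = r ^ (J + 1) * r⁻¹ := by rw [pow_succ]; field_simp
        rw [this]
        calc 2 * A * (r ^ (J + 1) * r⁻¹) * (1 - r)⁻¹ ≤ 2 * A * (d ^ α * r⁻¹) * (1 - r)⁻¹ := by gcongr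
          _ = _ := by ring
      refine (norm_add_le _ _).trans ((add_le_add a1 a2).trans ?_)
      nlinarith [mul_nonneg hP3 hdα]
    · have : 1 ≤ d ^ α := Real.one_le_rpow hle hα₀.le
      have h3 := (norm_sub_le (∑' j, g j x) (∑' j, g j y)).trans (add_le_add (hb x) (hb y))
      refine h3.trans ?_
      nlinarith [mul_nonneg hP1 hdα, mul_nonneg hP2 hdα]

/-- Gaussian Cauchy kernel -/
noncomputable def GN (τ : ℝ) (ζ : ℂ) : ℂ := (Real.exp (-(τ / 2) * ‖ζ‖ ^ 2) : ℂ) / (π * ζ)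

lemma GN_norm (τ : ℝ) (ζ : ℂ) : ‖GN τ ζ‖ = (fun r : ℝ => Real.exp (-(τ / 2) * r ^ 2) / (π * r)) ‖ζ‖ := by
  rw [GN, norm_div, norm_mul, Complex.norm_real, Complex.norm_real, Real.norm_of_nonneg (by positivity),
    Real.norm_of_nonneg Real.pi_pos.le]

lemma GN_meas (τ : ℝ) : Measurable (GN τ) := by
  unfold GN; fun_prop

lemma GN_integrable {τ : ℝ} (hτ : 0 < τ) : Integrable (GN τ) := by
  rw [← integrable_norm_iff (GN_meas τ).aestronglyMeasurable]
  simp_rw [GN_norm]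
  rw [integrable_fun_norm_addHaar (μ := volume) (f := fun r : ℝ => Real.exp (-(τ / 2) * r ^ 2) / (π * r))]
  have h1 : Integrable (fun x : ℝ => π⁻¹ * Real.exp (-(τ / 2) * x ^ 2)) :=
    (integrable_exp_neg_mul_sq (by positivity)).const_mul _
  refine (h1.integrableOn (s := Set.Ioi 0)).congr_fun (fun x hx => ?_) measurableSet_Ioi
  have : x ≠ 0 := ne_of_gt hx
  simp [Complex.finrank_real_complex]
  field_simp

lemma GN_integral {τ : ℝ} (hτ : 0 < τ) : ∫ ζ, ‖GN τ ζ‖ = √(π / (τ / 2)) := by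
  simp_rw [GN_norm]
  rw [integral_fun_norm_addHaar volume (fun r : ℝ => Real.exp (-(τ / 2) * r ^ 2) / (π * r))]
  have : ∫ y in Set.Ioi (0 : ℝ), y ^ (Module.finrank ℝ ℂ - 1) • (Real.exp (-(τ / 2) * y ^ 2) / (π * y))
      = ∫ y in Set.Ioi (0 : ℝ), π⁻¹ * Real.exp (-(τ / 2) * y ^ 2) := by
    refine setIntegral_congr_fun measurableSet_Ioi fun x hx => ?_
    have : x ≠ 0 := ne_of_gt hx
    simp [Complex.finrank_real_complex]
    field_simp
  rw [this, integral_const_mul, integral_gaussian_Ioi]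
  simp [Complex.finrank_real_complex, Measure.real, Complex.volume_ball]
  field_simp

/-- truncated Cauchy kernel -/
noncomputable def kk (t : ℂ) : ℂ := cut (1 / 16) t / (π * t)
/-- dyadic block -/
noncomputable def kap (t : ℂ) : ℂ := (cut (1 / 16) t - cut (1 / 4) t) / (π * t)
/-- error kernel -/
noncomputable def etk (t : ℂ) : ℂ := (((1 / 16) * deriv Xc ((1 / 16) * Complex.normSq t) / π : ℝ) : ℂ)

lemma kk_integrable : Integrable kk := by
  have hc : Continuous (fun t => cut (1 / 16) t * (Real.exp ((1 / 2) * ‖t‖ ^ 2) : ℂ)) := by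
    have := (cut_contDiff (1 / 16) (n := 0)).continuous
    fun_prop
  have hs : HasCompactSupport (fun t => cut (1 / 16) t * (Real.exp ((1 / 2) * ‖t‖ ^ 2) : ℂ)) :=
    (cut_hcs (by norm_num)).mul_right
  obtain ⟨M, hM⟩ := hs.exists_bound_of_continuous hc
  have h1 := (GN_integrable one_pos).bdd_mul (c := M) hc.aestronglyMeasurable
    (Filter.Eventually.of_forall hM)
  refine h1.congr (Filter.Eventually.of_forall fun t => ?_)
  simp only [kk, GN]
  have : (Real.exp ((1 / 2) * ‖t‖ ^ 2) : ℂ) * (Real.exp (-(1 / 2) * ‖t‖ ^ 2) : ℂ) = 1 := by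
    rw [← Complex.ofReal_mul, ← Real.exp_add]; simp
  rw [mul_div_assoc', mul_assoc, this, mul_one]

lemma cut_two (t : ℂ) : cut (1 / 4) t = cut (1 / 16) (2 * t) := by
  simp only [cut, Complex.normSq_mul]
  congr 2
  norm_num; ring

lemma kap_zero_near : ∀ᶠ t in nhds (0 : ℂ), kap t = 0 := by
  filter_upwards [Metric.ball_mem_nhds (0 : ℂ) one_pos] with t ht
  have : ‖t‖ < 1 := by simpa using ht
  have : Complex.normSq t ≤ 1 := by rw [Complex.normSq_eq_norm_sq]; nlinarith [norm_nonneg t]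
  rw [kap, cut_one, cut_one] <;> [simp; linarith; linarith]

lemma kap_TF : TF kap := by
  constructor
  · refine contDiff_iff_contDiffAt.2 fun z => ?_
    by_cases hz : z = 0
    · subst hz
      exact (contDiffAt_const (c := (0 : ℂ))).congr_of_eventuallyEq kap_zero_near
    · have h1 : ContDiffAt ℝ (⊤ : ℕ∞) (fun t : ℂ => (π : ℂ) * t) z := contDiffAt_const.mul contDiffAt_id
      have h2 := h1.inv (by simp [hz, Real.pi_ne_zero])
      exact ((cut_contDiff (1 / 16)).contDiffAt.sub (cut_contDiff (1 / 4)).contDiffAt).mul h2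
  · have h1 : HasCompactSupport (fun t => cut (1 / 16) t - cut (1 / 4) t) :=
      (cut_hcs (by norm_num)).sub (cut_hcs (by norm_num))
    have : kap = fun t => (cut (1 / 16) t - cut (1 / 4) t) * (π * t)⁻¹ := by
      funext t; rw [kap, div_eq_mul_inv]
    rw [this]; exact h1.mul_right

lemma kk_split (t : ℂ) : kk t = kap t + 2 * kk (2 * t) := by
  simp only [kk, kap, cut_two]
  by_cases ht : t = 0
  · simp [ht]
  · have : (π : ℂ) ≠ 0 := by exact_mod_cast Real.pi_ne_zero
    field_simp
    ring

lemma AA_scale (ρ : ℂ → ℂ) (s : ℝ) (f : ℂ → ℂ) (x : ℂ) :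
    AA (fun t => ρ (2 * t)) s f x = (1 / 4) * AA ρ (s / 2) f x := by
  have h := Measure.integral_comp_smul (volume : Measure ℂ)
    (fun t => ρ t * f (x - (s / 2 : ℝ) * t)) 2
  rw [Complex.finrank_real_complex] at h
  simp only [AA]
  have e : ∀ t : ℂ, ρ (2 * t) * f (x - s * t) =
      (fun t => ρ t * f (x - (s / 2 : ℝ) * t)) ((2 : ℝ) • t) := by
    intro t
    simp only [Complex.real_smul]
    push_cast
    congr 2
    ring
  simp_rw [e]
  rw [h]
  norm_num

lemma kk_int2 : Integrable (fun t => 2 * kk (2 * t)) := by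
  have : Integrable (fun t : ℂ => kk ((2 : ℝ) • t)) := kk_integrable.comp_smul two_ne_zero
  simpa using this.const_mul 2

lemma AA_kk_step {f : ℂ → ℂ} (hf : BC f) (s : ℝ) (x : ℂ) :
    AA kk s f x = AA kap s f x + (1 / 2) * AA kk (s / 2) f x := by
  have h1 : AA kk s f x = AA kap s f x + AA (fun t => 2 * kk (2 * t)) s f x := by
    simp only [AA]
    rw [← integral_add (AA_integrable kap_TF.integrable hf s x) (AA_integrable kk_int2 hf s x)]
    refine integral_congr_ae (Filter.Eventually.of_forall fun t => ?_)
    simp only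
    rw [kk_split t]; ring
  rw [h1]
  congr 1
  have h2 : AA (fun t => 2 * kk (2 * t)) s f x = 2 * AA (fun t => kk (2 * t)) s f x := by
    simp only [AA, mul_assoc]
    rw [integral_const_mul]
  rw [h2, AA_scale]; ring

lemma AA_kk_sum {f : ℂ → ℂ} (hf : BC f) (x : ℂ) :
    HasSum (fun j : ℕ => (1 / 2 : ℂ) ^ j * AA kap ((1 / 2 : ℝ) ^ j) f x) (AA kk 1 f x) := by
  obtain ⟨hc, M, hM, hb⟩ := id hf
  have h1 : ∀ N : ℕ, AA kk 1 f x = ∑ j ∈ Finset.range N, (1 / 2 : ℂ) ^ j * AA kap ((1 / 2 : ℝ) ^ j) f x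
      + (1 / 2) ^ N * AA kk ((1 / 2 : ℝ) ^ N) f x := by
    intro N
    induction N with
    | zero => simp
    | succ N ih =>
      rw [ih, Finset.sum_range_succ, AA_kk_step hf ((1 / 2 : ℝ) ^ N)]
      have : (1 / 2 : ℝ) ^ N / 2 = (1 / 2 : ℝ) ^ (N + 1) := by ring
      rw [this]; ring
  have hs : Summable (fun j : ℕ => (1 / 2 : ℂ) ^ j * AA kap ((1 / 2 : ℝ) ^ j) f x) := by
    refine Summable.of_norm_bounded
      ((summable_geometric_two).mul_right ((∫ t, ‖kap t‖) * M)) fun j => ?_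
    rw [norm_mul, norm_pow]
    have := AA_bound kap_TF.integrable hb ((1 / 2 : ℝ) ^ j) x
    simp only [norm_div, norm_one, Complex.norm_ofNat]
    gcongr
  rw [hs.hasSum_iff_tendsto_nat]
  have h2 : ∀ N, ∑ j ∈ Finset.range N, (1 / 2 : ℂ) ^ j * AA kap ((1 / 2 : ℝ) ^ j) f x =
    AA kk 1 f x - (1 / 2) ^ N * AA kk ((1 / 2 : ℝ) ^ N) f x := fun N => by rw [h1 N]; ring
  simp_rw [h2]
  have h3 : Filter.Tendsto (fun N : ℕ => (1 / 2 : ℂ) ^ N * AA kk ((1 / 2 : ℝ) ^ N) f x) Filter.atTop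
      (nhds 0) := by
    refine squeeze_zero_norm (a := fun N : ℕ => (1 / 2 : ℝ) ^ N * ((∫ t, ‖kk t‖) * M)) (fun N => ?_) ?_
    · rw [norm_mul, norm_pow]
      have := AA_bound kk_integrable hb ((1 / 2 : ℝ) ^ N) x
      simp only [norm_div, norm_one, Complex.norm_ofNat]
      gcongr
    · have := (tendsto_pow_atTop_nhds_zero_of_lt_one (r := (1 / 2 : ℝ)) (by norm_num) (by norm_num)).mul_const
        ((∫ t, ‖kk t‖) * M)
      simpa using this
  simpa using h3.const_sub (AA kk 1 f x)

lemma etk_TF : TF etk := by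
  have hX : ContDiff ℝ (⊤ : ℕ∞) (deriv Xc) := by
    have := (Xc_contDiff (n := ⊤))
    exact (contDiff_infty_iff_deriv.1 this).2
  constructor
  · exact Complex.ofRealCLM.contDiff.comp
      ((contDiff_const.mul (hX.comp (contDiff_const.mul contDiff_normSq))).div_const _)
  · refine HasCompactSupport.of_support_subset_isCompact (isCompact_closedBall (0 : ℂ) 6) fun z hz => ?_
    by_contra h
    have h6 : 6 < ‖z‖ := by simpa using h
    apply hz
    have h2 : 2 < (1 / 16) * Complex.normSq z := by
      rw [Complex.normSq_eq_norm_sq]; nlinarith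
    have : Xc =ᶠ[nhds ((1 / 16) * Complex.normSq z)] fun _ => 0 := by
      filter_upwards [Ioi_mem_nhds h2] with s hs
      exact Xc_zero (le_of_lt hs)
    rw [etk, this.deriv_eq]; simp

lemma etk_zero {t : ℂ} (h : ‖t‖ < 4) : etk t = 0 := by
  have h2 : (1 / 16) * Complex.normSq t < 1 := by
    rw [Complex.normSq_eq_norm_sq]; nlinarith [norm_nonneg t]
  have : Xc =ᶠ[nhds ((1 / 16) * Complex.normSq t)] fun _ => 1 := by
    filter_upwards [Iio_mem_nhds h2] with s hs
    exact Xc_one (le_of_lt hs)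
  rw [etk, this.deriv_eq]; simp

lemma etk_integral : ∫ t, etk t = -1 := by
  have h0 : ∫ t, etk t = ((∫ t : ℂ, (fun r : ℝ => (1 / 16) * deriv Xc ((1 / 16) * r ^ 2) / π) ‖t‖ : ℝ) : ℂ) := by
    rw [← integral_complex_ofReal]
    simp only [etk, Complex.normSq_eq_norm_sq]
  rw [h0, integral_fun_norm_addHaar volume (fun r : ℝ => (1 / 16) * deriv Xc ((1 / 16) * r ^ 2) / π)]
  have hder : ∀ r : ℝ, HasDerivAt (fun r : ℝ => (1 / (2 * π)) * Xc ((1 / 16) * r ^ 2))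
      (r * ((1 / 16) * deriv Xc ((1 / 16) * r ^ 2) / π)) r := by
    intro r
    have a : HasDerivAt Xc (deriv Xc ((1 / 16) * r ^ 2)) ((1 / 16) * r ^ 2) :=
      ((Xc_contDiff (n := 1)).differentiable (by simp) _).hasDerivAt
    have b : HasDerivAt (fun r : ℝ => (1 / 16) * r ^ 2) ((1 / 16) * (2 * r)) r := by
      simpa using (hasDerivAt_pow 2 r).const_mul (1 / 16 : ℝ)
    refine ((a.comp r b).const_mul (1 / (2 * π))).congr_deriv ?_
    field_simp
  have hcont : Continuous (fun r : ℝ => r * ((1 / 16) * deriv Xc ((1 / 16) * r ^ 2) / π)) := by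
    have : Continuous (deriv Xc) := (Xc_contDiff (n := 1)).continuous_deriv (by simp)
    fun_prop
  have hev : ∀ᶠ r : ℝ in Filter.atTop, (1 / (2 * π)) * Xc ((1 / 16) * r ^ 2) = 0 := by
    filter_upwards [Filter.eventually_ge_atTop 6] with r hr
    rw [Xc_zero, mul_zero]; nlinarith
  have hz : ∀ r : ℝ, 6 < r → (r * ((1 / 16) * deriv Xc ((1 / 16) * r ^ 2) / π)) = 0 := by
    intro r hr
    have h2 : 2 < (1 / 16) * r ^ 2 := by nlinarith
    have : Xc =ᶠ[nhds ((1 / 16) * r ^ 2)] fun _ => 0 := by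
      filter_upwards [Ioi_mem_nhds h2] with s hs
      exact Xc_zero (le_of_lt hs)
    rw [this.deriv_eq]; simp
  have hintg : IntegrableOn (fun r : ℝ => r * ((1 / 16) * deriv Xc ((1 / 16) * r ^ 2) / π)) (Set.Ioi 0) := by
    have h1 : IntegrableOn (fun r : ℝ => r * ((1 / 16) * deriv Xc ((1 / 16) * r ^ 2) / π)) (Set.Icc 0 6) :=
      hcont.continuousOn.integrableOn_Icc
    refine IntegrableOn.of_forall_sdiff_eq_zero h1 measurableSet_Ioi fun r hr => hz r ?_
    by_contra h
    exact hr.2 ⟨le_of_lt hr.1, not_lt.1 h⟩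
  have key := integral_Ioi_of_hasDerivAt_of_tendsto (a := 0) (m := 0)
    (hder 0).continuousAt.continuousWithinAt (fun x _ => hder x) hintg
    (tendsto_const_nhds.congr' (hev.mono fun r hr => hr.symm))
  have key2 : ∫ y in Set.Ioi (0 : ℝ), y ^ (Module.finrank ℝ ℂ - 1) •
      ((1 / 16) * deriv Xc ((1 / 16) * y ^ 2) / π) = - (1 / (2 * π)) := by
    rw [Complex.finrank_real_complex]
    simp only [Nat.add_one_sub_one, pow_one, smul_eq_mul]
    rw [key]; simp [Xc_one]
  rw [key2]
  simp [Complex.finrank_real_complex, Measure.real, Complex.volume_ball]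

lemma cut_hasFDeriv (c : ℝ) (z : ℂ) : HasFDerivAt (cut c)
    (D2 (2 * c * z.re * deriv Xc (c * Complex.normSq z)) (2 * c * z.im * deriv Xc (c * Complex.normSq z))) z := by
  have a : HasDerivAt Xc (deriv Xc (c * Complex.normSq z)) (c * Complex.normSq z) :=
    ((Xc_contDiff (n := 1)).differentiable (by simp) _).hasDerivAt
  have hre : HasFDerivAt (fun w : ℂ => w.re) Complex.reCLM z := Complex.reCLM.hasFDerivAt
  have him : HasFDerivAt (fun w : ℂ => w.im) Complex.imCLM z := Complex.imCLM.hasFDerivAt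
  have b : HasFDerivAt (fun w : ℂ => c * (w.re * w.re + w.im * w.im))
      (c • (z.re • Complex.reCLM + z.re • Complex.reCLM + (z.im • Complex.imCLM + z.im • Complex.imCLM))) z :=
    ((hre.mul hre).add (him.mul him)).const_mul c
  rw [Complex.normSq_apply] at a
  have d := a.comp_hasFDerivAt z b
  have e := Complex.ofRealCLM.hasFDerivAt.comp z d
  have : cut c = Complex.ofRealCLM ∘ Xc ∘ (fun w : ℂ => c * (w.re * w.re + w.im * w.im)) := by
    funext w; simp [cut, Complex.normSq_apply]
  rw [this]
  refine e.congr_fderiv ?_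
  apply clm_ext_one_I <;> simp [D2_one, D2_I, Complex.normSq_apply] <;> ring

lemma kap_dbar (t : ℂ) : pd 1 kap t + Complex.I * pd Complex.I kap t = 2 * (etk t - 4 * etk (2 * t)) := by
  by_cases ht : t = 0
  · subst ht
    have h0 : fderiv ℝ kap 0 = fderiv ℝ (fun _ : ℂ => (0 : ℂ)) 0 :=
      (show kap =ᶠ[nhds 0] fun _ => 0 from kap_zero_near).fderiv_eq
    have h1 : etk 0 = 0 := etk_zero (by simp)
    simp only [pd, h0, mul_zero, h1]
    simp
  · have hpi : (π : ℂ) ≠ 0 := by exact_mod_cast Real.pi_ne_zero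
    have h1 : HasFDerivAt (fun w : ℂ => (π * w)⁻¹) ((ContinuousLinearMap.toSpanSingleton ℂ
        (-(π * t ^ 2)⁻¹)).restrictScalars ℝ) t := by
      have : HasDerivAt (fun w : ℂ => (π * w)⁻¹) (-(π * t ^ 2)⁻¹) t := by
        refine (((hasDerivAt_id t).const_mul (π : ℂ)).inv (by simp [ht, hpi])).congr_deriv ?_
        simp; field_simp
      exact this.hasFDerivAt.restrictScalars ℝ
    have h2 := ((cut_hasFDeriv (1 / 16) t).sub (cut_hasFDeriv (1 / 4) t)).mul h1
    have h3 : HasFDerivAt kap _ t := h2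
    simp only [pd]
    rw [h3.fderiv]
    have hre : (t.re : ℂ) + Complex.I * t.im = t := by rw [mul_comm]; exact Complex.re_add_im t
    have e1 : (1 / 16 : ℝ) * Complex.normSq (2 * t) = (1 / 4) * Complex.normSq t := by
      rw [Complex.normSq_mul]; norm_num; ring
    simp only [etk, e1]
    generalize deriv Xc (1 / 16 * Complex.normSq t) = A
    generalize deriv Xc (1 / 4 * Complex.normSq t) = B
    generalize cut (1 / 16) t = C
    generalize cut (1 / 4) t = D
    simp [D2_one, D2_I]
    generalize (t.re : ℂ) = x at *
    generalize (t.im : ℂ) = y at *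
    subst hre
    field_simp
    ring_nf
    try simp only [Complex.I_sq]
    ring_nf

lemma half_pow_cast (j : ℕ) : (((1 / 2 : ℝ) ^ j : ℝ) : ℂ) = (1 / 2 : ℂ) ^ j := by push_cast; rfl

lemma gj_deriv {f : ℂ → ℂ} (hf : BC f) (j : ℕ) (x : ℂ) :
    HasFDerivAt (fun x => (1 / 2 : ℂ) ^ j * AA kap ((1 / 2 : ℝ) ^ j) f x)
      (D2 (AA (pd 1 kap) ((1 / 2 : ℝ) ^ j) f x) (AA (pd Complex.I kap) ((1 / 2 : ℝ) ^ j) f x)) x := by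
  have h := (AA_deriv kap_TF (s := (1 / 2 : ℝ) ^ j) (by positivity) hf x).const_mul ((1 / 2 : ℂ) ^ j)
  refine h.congr_fderiv ?_
  apply clm_ext_one_I <;> simp [D2_one, D2_I]

lemma two_rpow_aux {α : ℝ} (j : ℕ) : ((1 / 2 : ℝ) ^ j) ^ α = ((1 / 2 : ℝ) ^ α) ^ j := by
  rw [← Real.rpow_natCast, ← Real.rpow_natCast, ← Real.rpow_mul (by norm_num),
          ← Real.rpow_mul (by norm_num), mul_comm]

lemma two_rpow_aux2 {α : ℝ} (j : ℕ) :
    ((1 / 2 : ℝ) ^ j)⁻¹ * ((1 / 2 : ℝ) ^ α) ^ j = ((2 : ℝ) ^ (1 - α)) ^ j := by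
  rw [← inv_pow, ← mul_pow, Real.rpow_sub (by norm_num), Real.rpow_one, one_div,
    Real.inv_rpow (by norm_num), inv_inv]
  rfl

/-- boundedness: `k * f` is Hölder for `f` bounded continuous -/
lemma kk_H0 {α : ℝ} (hα₀ : 0 < α) (hα₁ : α < 1) {f : ℂ → ℂ} (hf : BC f) :
    H0 α Set.univ (AA kk 1 f) := by
  obtain ⟨hc, M, hM, hb⟩ := id hf
  have e : AA kk 1 f = fun x => ∑' j : ℕ, (1 / 2 : ℂ) ^ j * AA kap ((1 / 2 : ℝ) ^ j) f x := by
    funext x; exact (AA_kk_sum hf x).tsum_eq.symm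
  rw [e]
  set K0 := ∫ t, ‖kap t‖
  set K1 := ∫ t, ‖pd 1 kap t‖
  set K2 := ∫ t, ‖pd Complex.I kap t‖
  have hK0 : 0 ≤ K0 := integral_nonneg fun _ => norm_nonneg _
  have hK1 : 0 ≤ K1 := integral_nonneg fun _ => norm_nonneg _
  have hK2 : 0 ≤ K2 := integral_nonneg fun _ => norm_nonneg _
  have hA : 0 ≤ 2 * ((K0 + K1 + K2) * M) := by positivity
  refine H0.tsum hα₀ hα₁ hA (fun j x => ?_) (fun j x y => ?_)
  · rw [norm_mul, norm_pow]
    have h1 := AA_bound kap_TF.integrable hb ((1 / 2 : ℝ) ^ j) x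
    have h2 : (1 / 2 : ℝ) ≤ (1 / 2 : ℝ) ^ α := by
      conv_lhs => rw [← Real.rpow_one (1 / 2 : ℝ)]
      exact Real.rpow_le_rpow_of_exponent_ge (by norm_num) (by norm_num) hα₁.le
    have h3 : ‖(1 / 2 : ℂ)‖ = 1 / 2 := by simp
    rw [h3, mul_comm]
    refine mul_le_mul (h1.trans ?_) (pow_le_pow_left₀ (by norm_num) h2 j) (by positivity) hA
    nlinarith [mul_nonneg hK0 hM, mul_nonneg hK1 hM, mul_nonneg hK2 hM]
  · have h1 : (1 : ℝ) ≤ ((2 : ℝ) ^ (1 - α)) ^ j :=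
      one_le_pow₀ (Real.one_le_rpow (by norm_num) (by linarith))
    have h2 := lip_of_partials (C := (K0 + K1 + K2) * M) (by positivity) (gj_deriv hf j)
      (fun x => (AA_bound (kap_TF.pd 1).integrable hb _ x).trans (by
        nlinarith [mul_nonneg hK0 hM, mul_nonneg hK1 hM, mul_nonneg hK2 hM]))
      (fun x => (AA_bound (kap_TF.pd Complex.I).integrable hb _ x).trans (by
        nlinarith [mul_nonneg hK0 hM, mul_nonneg hK1 hM, mul_nonneg hK2 hM])) x y
    refine h2.trans (mul_le_mul_of_nonneg_right ?_ (norm_nonneg _))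
    exact le_mul_of_one_le_right hA h1

lemma AA_tsum_H0 {α : ℝ} (hα₀ : 0 < α) (hα₁ : α < 1) {ρ : ℂ → ℂ} (h : TF ρ) (h0 : ∫ t, ρ t = 0)
    {f : ℂ → ℂ} (hf : H0 α Set.univ f) :
    (∃ u : ℕ → ℝ, Summable u ∧ ∀ j x, ‖AA ρ ((1 / 2 : ℝ) ^ j) f x‖ ≤ u j) ∧
    H0 α Set.univ (fun x => ∑' j : ℕ, AA ρ ((1 / 2 : ℝ) ^ j) f x) := by
  have hbc := hf.bc hα₀
  obtain ⟨C0, hC0, hC0'⟩ := AA_holder hα₀ h h0 hf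
  obtain ⟨C1, hC1, hC1'⟩ := AA_holder hα₀ (h.pd 1) h.integral_pd.1 hf
  obtain ⟨C2, hC2, hC2'⟩ := AA_holder hα₀ (h.pd Complex.I) h.integral_pd.2 hf
  have hr1 : (1 / 2 : ℝ) ^ α < 1 := Real.rpow_lt_one (by norm_num) (by norm_num) hα₀
  constructor
  · refine ⟨fun j => C0 * ((1 / 2 : ℝ) ^ α) ^ j,
      (summable_geometric_of_lt_one (by positivity) hr1).mul_left _, fun j x => ?_⟩
    show _ ≤ C0 * ((1 / 2 : ℝ) ^ α) ^ j
    rw [← two_rpow_aux]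
    exact hC0' _ (by positivity) x
  refine H0.tsum (A := C0 + 2 * (C1 + C2)) hα₀ hα₁ (by positivity) (fun j x => ?_) (fun j x y => ?_)
  · rw [← two_rpow_aux]
    refine (hC0' _ (by positivity) x).trans (mul_le_mul_of_nonneg_right (by linarith) (by positivity))
  · rw [← two_rpow_aux2, ← two_rpow_aux]
    set s := (1 / 2 : ℝ) ^ j with hs
    have hs0 : 0 < s := by positivity
    have hsα : 0 ≤ s⁻¹ * s ^ α := by positivity
    have h2 := lip_of_partials (C := (C1 + C2) * (s⁻¹ * s ^ α)) (by positivity)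
      (fun x => AA_deriv h hs0 hbc x) (fun x => by
        rw [norm_mul, Complex.norm_real, Real.norm_of_nonneg (by positivity)]
        have := mul_le_mul_of_nonneg_left (hC1' s hs0 x) (inv_nonneg.2 hs0.le)
        nlinarith [mul_nonneg hC2 hsα]) (fun x => by
        rw [norm_mul, Complex.norm_real, Real.norm_of_nonneg (by positivity)]
        have := mul_le_mul_of_nonneg_left (hC2' s hs0 x) (inv_nonneg.2 hs0.le)
        nlinarith [mul_nonneg hC1 hsα]) x y
    refine h2.trans (mul_le_mul_of_nonneg_right ?_ (norm_nonneg _))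
    nlinarith [mul_nonneg hC0 hsα]

lemma D2_add (a b c d : ℂ) : D2 a b + D2 c d = D2 (a + c) (b + d) := by
  apply clm_ext_one_I <;> simp [D2_one, D2_I]

lemma AA_lim {ρ : ℂ → ℂ} (h : Integrable ρ) {f : ℂ → ℂ} (hf : BC f) (x : ℂ) :
    Filter.Tendsto (fun N : ℕ => AA ρ ((1 / 2 : ℝ) ^ N) f x) Filter.atTop (nhds ((∫ t, ρ t) * f x)) := by
  obtain ⟨hc, M, hM, hb⟩ := id hf
  rw [← integral_mul_const]
  refine tendsto_integral_of_dominated_convergence (fun t => ‖ρ t‖ * M)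
    (fun N => (AA_integrable h hf _ x).aestronglyMeasurable) (h.norm.mul_const M)
    (fun N => Filter.Eventually.of_forall fun t => ?_) (Filter.Eventually.of_forall fun t => ?_)
  · rw [norm_mul]; exact mul_le_mul_of_nonneg_left (hb _) (norm_nonneg _)
  · refine Filter.Tendsto.const_mul _ ?_
    have h1 : Filter.Tendsto (fun N : ℕ => x - (((1 / 2 : ℝ) ^ N : ℝ) : ℂ) * t) Filter.atTop (nhds x) := by
      have := (tendsto_pow_atTop_nhds_zero_of_lt_one (r := (1 / 2 : ℝ)) (by norm_num) (by norm_num))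
      have := ((Complex.continuous_ofReal.tendsto 0).comp this).mul_const t
      simpa using this.const_sub x
    exact (hc.tendsto x).comp h1

lemma kk_C1 {α : ℝ} (hα₀ : 0 < α) (hα₁ : α < 1) {f : ℂ → ℂ} (hf : H0 α Set.univ f) :
    ∃ g₁ g₂ : ℂ → ℂ, H0 α Set.univ g₁ ∧ H0 α Set.univ g₂ ∧
      (∀ x, HasFDerivAt (AA kk 1 f) (D2 (g₁ x) (g₂ x)) x) ∧
      ∀ x, g₁ x + Complex.I * g₂ x = 2 * (f x + AA etk 1 f x) := by
  have hbc := hf.bc hα₀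
  obtain ⟨⟨u1, hu1, hu1'⟩, H1⟩ := AA_tsum_H0 hα₀ hα₁ (kap_TF.pd 1) kap_TF.integral_pd.1 hf
  obtain ⟨⟨u2, hu2, hu2'⟩, H2⟩ := AA_tsum_H0 hα₀ hα₁ (kap_TF.pd Complex.I) kap_TF.integral_pd.2 hf
  refine ⟨_, _, H1, H2, fun x => ?_, fun x => ?_⟩
  · have e : AA kk 1 f = fun x => ∑' j : ℕ, (1 / 2 : ℂ) ^ j * AA kap ((1 / 2 : ℝ) ^ j) f x := by
      funext x; exact (AA_kk_sum hbc x).tsum_eq.symm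
    rw [e]
    have s1 : Summable fun j : ℕ => AA (pd 1 kap) ((1 / 2 : ℝ) ^ j) f x :=
      Summable.of_norm_bounded hu1 fun j => hu1' j x
    have s2 : Summable fun j : ℕ => AA (pd Complex.I kap) ((1 / 2 : ℝ) ^ j) f x :=
      Summable.of_norm_bounded hu2 fun j => hu2' j x
    have hle1 : ∀ j, 0 ≤ u1 j := fun j => (norm_nonneg _).trans (hu1' j 0)
    have hle2 : ∀ j, 0 ≤ u2 j := fun j => (norm_nonneg _).trans (hu2' j 0)
    have hbd : ∀ j x, ‖D2 (AA (pd 1 kap) ((1 / 2 : ℝ) ^ j) f x)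
        (AA (pd Complex.I kap) ((1 / 2 : ℝ) ^ j) f x)‖ ≤ 2 * (u1 j + u2 j) := fun j x =>
      D2_norm_le ((hu1' j x).trans (by linarith [hle2 j])) ((hu2' j x).trans (by linarith [hle1 j]))
    have h := hasFDerivAt_tsum ((hu1.add hu2).mul_left 2) (fun j x => gj_deriv hbc j x)
      hbd (AA_kk_sum hbc 0).summable x
    refine h.congr_fderiv ?_
    have hsum := Summable.of_norm_bounded ((hu1.add hu2).mul_left 2) (fun j => hbd j x)
    have ev : ∀ e : ℂ, (∑' j : ℕ, D2 (AA (pd 1 kap) ((1 / 2 : ℝ) ^ j) f x)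
        (AA (pd Complex.I kap) ((1 / 2 : ℝ) ^ j) f x)) e = ∑' j : ℕ, D2 (AA (pd 1 kap) ((1 / 2 : ℝ) ^ j) f x)
        (AA (pd Complex.I kap) ((1 / 2 : ℝ) ^ j) f x) e := fun e =>
      ContinuousLinearMap.map_tsum (ContinuousLinearMap.apply ℝ ℂ e) hsum
    apply clm_ext_one_I <;> rw [ev] <;> simp only [D2_one, D2_I]
  · have s1 : Summable fun j : ℕ => AA (pd 1 kap) ((1 / 2 : ℝ) ^ j) f x :=
      Summable.of_norm_bounded hu1 fun j => hu1' j x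
    have s2 : Summable fun j : ℕ => AA (pd Complex.I kap) ((1 / 2 : ℝ) ^ j) f x :=
      Summable.of_norm_bounded hu2 fun j => hu2' j x
    have hs := (s1.hasSum.add (s2.hasSum.mul_left Complex.I)).tendsto_sum_nat
    have hj : ∀ s : ℝ, AA (pd 1 kap) s f x + Complex.I * AA (pd Complex.I kap) s f x =
        2 * (AA etk s f x - AA etk (s / 2) f x) := by
      intro s
      have i1 := AA_integrable (kap_TF.pd 1).integrable hbc s x
      have i2 := AA_integrable (kap_TF.pd Complex.I).integrable hbc s x
      have i3 := AA_integrable etk_TF.integrable hbc s x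
      have hi4 : Integrable (fun t : ℂ => etk (2 * t)) := by
        have : Integrable (fun t : ℂ => etk ((2 : ℝ) • t)) := etk_TF.integrable.comp_smul two_ne_zero
        simpa using this
      have i4 := AA_integrable hi4 hbc s x
      have e4 := AA_scale etk s f x
      have e5 : AA etk (s / 2) f x = 4 * AA (fun t => etk (2 * t)) s f x := by rw [e4]; ring
      rw [e5]
      simp only [AA]
      rw [← integral_const_mul, ← integral_add i1 (i2.const_mul _), ← integral_const_mul,
        ← integral_sub i3 (i4.const_mul _), ← integral_const_mul]
      refine integral_congr_ae (Filter.Eventually.of_forall fun t => ?_)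
      have := kap_dbar t
      simp only
      linear_combination (f (x - s * t)) * this
    have hN : ∀ N : ℕ, ∑ j ∈ Finset.range N, (AA (pd 1 kap) ((1 / 2 : ℝ) ^ j) f x + Complex.I *
        AA (pd Complex.I kap) ((1 / 2 : ℝ) ^ j) f x) = 2 * (AA etk 1 f x - AA etk ((1 / 2 : ℝ) ^ N) f x) := by
      intro N
      induction N with
      | zero => simp
      | succ N ih =>
        rw [Finset.sum_range_succ, ih, hj, pow_succ, ← div_eq_mul_one_div]
        ring
    simp_rw [hN] at hs
    have h2 := ((AA_lim etk_TF.integrable hbc x).const_sub (AA etk 1 f x)).const_mul 2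
    rw [tendsto_nhds_unique hs h2, etk_integral]
    ring

lemma kk_step {α : ℝ} (hα₀ : 0 < α) {f f₁ f₂ : ℂ → ℂ} (hf : BC f) (h1 : BC f₁) (h2 : BC f₂)
    (hd : ∀ x, HasFDerivAt f (D2 (f₁ x) (f₂ x)) x) (x : ℂ) :
    HasFDerivAt (AA kk 1 f) (D2 (AA kk 1 f₁ x) (AA kk 1 f₂ x)) x := by
  obtain ⟨c1, M1, hM1, b1⟩ := id h1
  obtain ⟨c2, M2, hM2, b2⟩ := id h2
  have i1 := AA_integrable kk_integrable h1 1 x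
  have i2 := AA_integrable kk_integrable h2 1 x
  have eqD : (fun t => kk t • D2 (f₁ (x - (1 : ℝ) * t)) (f₂ (x - (1 : ℝ) * t))) = fun t =>
      Complex.reCLM.smulRight (kk t * f₁ (x - (1 : ℝ) * t)) + Complex.imCLM.smulRight (kk t * f₂ (x - (1 : ℝ) * t)) := by
    funext t
    apply clm_ext_one_I <;> simp [D2_one, D2_I]
  have iD : Integrable (fun t => kk t • D2 (f₁ (x - (1 : ℝ) * t)) (f₂ (x - (1 : ℝ) * t))) := by
    rw [eqD]
    exact ((ContinuousLinearMap.smulRightL ℝ ℂ ℂ Complex.reCLM).integrable_comp i1).add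
      ((ContinuousLinearMap.smulRightL ℝ ℂ ℂ Complex.imCLM).integrable_comp i2)
  have h := hasFDerivAt_integral_of_dominated_of_fderiv_le (𝕜 := ℝ) (μ := (volume : Measure ℂ)) (x₀ := x)
    (s := Set.univ) (F := fun x t => kk t * f (x - (1 : ℝ) * t))
    (F' := fun x t => kk t • D2 (f₁ (x - (1 : ℝ) * t)) (f₂ (x - (1 : ℝ) * t)))
    (bound := fun t => ‖kk t‖ * (2 * (M1 + M2))) Filter.univ_mem
    (Filter.Eventually.of_forall fun y => (AA_integrable kk_integrable hf 1 y).aestronglyMeasurable)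
    (AA_integrable kk_integrable hf 1 x) iD.aestronglyMeasurable
    (Filter.Eventually.of_forall fun t y _ => by
      rw [norm_smul]
      exact mul_le_mul_of_nonneg_left (D2_norm_le ((b1 _).trans (by linarith))
        ((b2 _).trans (by linarith))) (norm_nonneg _))
    (kk_integrable.norm.mul_const _)
    (Filter.Eventually.of_forall fun t y _ => by
      have := ((hd (y - (1 : ℝ) * t)).comp y ((hasFDerivAt_id y).sub_const ((1 : ℝ) * t))).const_mul (kk t)
      simpa using this)
  refine h.congr_fderiv ?_
  apply clm_ext_one_I <;> rw [ContinuousLinearMap.integral_apply iD] <;> simp [D2_one, D2_I, AA]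

theorem kk_Hol {α : ℝ} (hα₀ : 0 < α) (hα₁ : α < 1) {m : ℕ} {f : ℂ → ℂ} (hf : Hol α Set.univ m f) :
    Hol α Set.univ (m + 1) (AA kk 1 f) := by
  induction m generalizing f with
  | zero =>
    obtain ⟨g₁, g₂, h1, h2, hd, -⟩ := kk_C1 hα₀ hα₁ hf
    exact ⟨kk_H0 hα₀ hα₁ (hf.h0.bc hα₀), g₁, g₂, fun x _ => (hd x).hasFDerivWithinAt, h1, h2⟩
  | succ m ih =>
    obtain ⟨h0, f₁, f₂, hd, h1, h2⟩ := hf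
    refine ⟨kk_H0 hα₀ hα₁ (h0.bc hα₀), _, _, fun x _ => ?_, ih h1, ih h2⟩
    exact (kk_step hα₀ (h0.bc hα₀) (h1.h0.bc hα₀) (h2.h0.bc hα₀)
      (fun x => by simpa using hd x trivial) x).hasFDerivWithinAt

/-- the `∂̄` equation -/
theorem kk_dbar {α : ℝ} (hα₀ : 0 < α) (hα₁ : α < 1) {f : ℂ → ℂ} (hf : H0 α Set.univ f) {x : ℂ}
    (hx : ∀ w, f w ≠ 0 → ‖x - w‖ < 4) :
    fderiv ℝ (AA kk 1 f) x 1 + Complex.I * fderiv ℝ (AA kk 1 f) x Complex.I = 2 * f x := by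
  obtain ⟨g₁, g₂, -, -, hd, hg⟩ := kk_C1 hα₀ hα₁ hf
  rw [(hd x).fderiv, D2_one, D2_I, hg]
  have : AA etk 1 f x = 0 := by
    rw [AA]
    refine (integral_congr_ae (Filter.Eventually.of_forall fun t => ?_)).trans (integral_zero _ _)
    simp only [Complex.ofReal_one, one_mul]
    by_cases h : f (x - t) = 0
    · simp [h]
    · have := hx _ h
      rw [etk_zero (by simpa using this), zero_mul]
  rw [this, add_zero]

/-- phase factor -/
noncomputable def PH (τ : ℝ) (ζ0 z ζ : ℂ) : ℂ :=
  Complex.exp (((τ * ((starRingEnd ℂ) (z - ζ - ζ0) * (z - ζ0)).im : ℝ) : ℂ) * Complex.I)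

lemma PH_norm (τ : ℝ) (ζ0 z ζ : ℂ) : ‖PH τ ζ0 z ζ‖ = 1 := Complex.norm_exp_ofReal_mul_I _

lemma PH_cont (τ : ℝ) (ζ0 : ℂ) : Continuous (fun p : ℂ × ℂ => PH τ ζ0 p.1 p.2) := by
  unfold PH
  fun_prop

section
variable {E : Type*} [NormedAddCommGroup E] [NormedSpace ℂ E]

/-- weighted Cauchy transform -/
noncomputable def Psi (τ : ℝ) (ζ0 : ℂ) (f : ℂ → E) (z : ℂ) : E :=
  ∫ ζ, (GN τ ζ * PH τ ζ0 z ζ) • f (z - ζ)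

/-- bounded, continuous off one point -/
def QC (ζ0 : ℂ) (f : ℂ → E) : Prop :=
  (∀ w, w ≠ ζ0 → ContinuousAt f w) ∧ ∃ M : ℝ, 0 ≤ M ∧ ∀ w, ‖f w‖ ≤ M

lemma QC.aesm {ζ0 : ℂ} {f : ℂ → E} (h : QC ζ0 f) : AEStronglyMeasurable f volume := by
  have h1 : ContinuousOn f {ζ0}ᶜ := fun w hw => (h.1 w hw).continuousWithinAt
  have := h1.aestronglyMeasurable (μ := volume) (MeasurableSet.singleton ζ0).compl
  rwa [restrict_compl_singleton] at this

lemma QC.aesm' {ζ0 : ℂ} {f : ℂ → E} (h : QC ζ0 f) (τ : ℝ) (z : ℂ) :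
    AEStronglyMeasurable (fun ζ => (GN τ ζ * PH τ ζ0 z ζ) • f (z - ζ)) volume := by
  refine AEStronglyMeasurable.smul ?_ ?_
  · refine ((GN_meas τ).aestronglyMeasurable).mul ?_
    exact ((PH_cont τ ζ0).comp (by fun_prop : Continuous fun ζ : ℂ => (z, ζ))).aestronglyMeasurable
  · exact h.aesm.comp_quasiMeasurePreserving (quasiMeasurePreserving_sub_left_of_right_invariant volume z)

lemma Psi_norm_le {τ : ℝ} {ζ0 : ℂ} {f : ℂ → E} {M : ℝ} (hM : ∀ w, ‖f w‖ ≤ M) (z ζ : ℂ) :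
    ‖(GN τ ζ * PH τ ζ0 z ζ) • f (z - ζ)‖ ≤ ‖GN τ ζ‖ * M := by
  rw [norm_smul, norm_mul, PH_norm, mul_one]
  exact mul_le_mul_of_nonneg_left (hM _) (norm_nonneg _)

lemma QC.integrable {ζ0 : ℂ} {f : ℂ → E} (h : QC ζ0 f) {τ : ℝ} (hτ : 0 < τ) (z : ℂ) :
    Integrable (fun ζ => (GN τ ζ * PH τ ζ0 z ζ) • f (z - ζ)) := by
  obtain ⟨M, hM, hb⟩ := h.2
  exact ((GN_integrable hτ).norm.mul_const M).mono' (h.aesm' τ z)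
    (Filter.Eventually.of_forall fun ζ => Psi_norm_le hb z ζ)

lemma Psi_bound {τ : ℝ} (hτ : 0 < τ) {ζ0 : ℂ} {f : ℂ → E} {M : ℝ} (hM : ∀ w, ‖f w‖ ≤ M) (z : ℂ) :
    ‖Psi τ ζ0 f z‖ ≤ √(π / (τ / 2)) * M := by
  rw [← GN_integral hτ, ← integral_mul_const]
  exact norm_integral_le_of_norm_le ((GN_integrable hτ).norm.mul_const M)
    (Filter.Eventually.of_forall fun ζ => Psi_norm_le hM z ζ)

lemma Psi_cont {τ : ℝ} (hτ : 0 < τ) {ζ0 : ℂ} {f : ℂ → E} (h : QC ζ0 f) : Continuous (Psi τ ζ0 f) := by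
  obtain ⟨M, hM, hb⟩ := h.2
  rw [continuous_iff_continuousAt]
  intro z0
  refine continuousAt_of_dominated (bound := fun ζ => ‖GN τ ζ‖ * M)
    (Filter.Eventually.of_forall fun z => h.aesm' τ z)
    (Filter.Eventually.of_forall fun z => Filter.Eventually.of_forall fun ζ => Psi_norm_le hb z ζ)
    ((GN_integrable hτ).norm.mul_const M) ?_
  have : ∀ᵐ ζ : ℂ, ζ ≠ z0 - ζ0 := by
    have := (measure_singleton (μ := (volume : Measure ℂ)) (z0 - ζ0))
    exact compl_mem_ae_iff.2 this
  filter_upwards [this] with ζ hζ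
  refine ContinuousAt.smul ?_ ?_
  · exact (continuous_const.mul ((PH_cont τ ζ0).comp (by fun_prop : Continuous fun z : ℂ => (z, ζ)))).continuousAt
  · refine ContinuousAt.comp (g := f) (f := fun z => z - ζ) (h.1 _ fun h => hζ ?_) (by fun_prop)
    rw [← h]; ring

lemma Psi_sub {τ : ℝ} (hτ : 0 < τ) {ζ0 : ℂ} {f g : ℂ → E} (h : QC ζ0 f) (h' : QC ζ0 g) (z : ℂ) :
    Psi τ ζ0 f z - Psi τ ζ0 g z = Psi τ ζ0 (fun w => f w - g w) z := by
  simp only [Psi]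
  rw [← integral_sub (h.integrable hτ z) (h'.integrable hτ z)]
  simp only [smul_sub]

open BoundedContinuousFunction in
theorem exists_fix [CompleteSpace E] {ζ0 : ℂ} {G : ℂ → E → E} {M : ℝ} (hM : 0 ≤ M)
    (hG0 : ∀ w, G w 0 = 0) (hGL : ∀ w v v', ‖G w v - G w v'‖ ≤ M * ‖v - v'‖)
    (hGc : ∀ V : ℂ → E, Continuous V → ∀ w, w ≠ ζ0 → ContinuousAt (fun w => G w (V w)) w) (a : E) :
    ∃ τ : ℝ, 0 < τ ∧ ∃ V : ℂ → E, Continuous V ∧ QC ζ0 (fun w => G w (V w)) ∧ V ζ0 = a ∧ ∃ c : E,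
      ∀ z, V z = (Real.exp (-(τ / 2) * ‖z - ζ0‖ ^ 2) : ℂ) • c + Psi τ ζ0 (fun w => G w (V w)) z := by
  obtain ⟨τ, hτ, hL⟩ : ∃ τ : ℝ, 0 < τ ∧ √(π / (τ / 2)) * M * 2 ≤ 1 / 2 := by
    refine ⟨2 * π * (4 * M + 1) ^ 2, by positivity, ?_⟩
    have : π / (2 * π * (4 * M + 1) ^ 2 / 2) = (1 / (4 * M + 1)) ^ 2 := by
      have := Real.pi_pos.ne'
      field_simp
    rw [this, Real.sqrt_sq (by positivity)]
    rw [div_mul_eq_mul_div, div_mul_eq_mul_div, div_le_iff₀ (by positivity)]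
    linarith
  set L := √(π / (τ / 2))
  have hGn : ∀ w v, ‖G w v‖ ≤ M * ‖v‖ := fun w v => by simpa [hG0] using hGL w v 0
  have qc : ∀ V : ℂ →ᵇ E, QC ζ0 (fun w => G w (V w)) := fun V =>
    ⟨hGc V V.continuous, M * ‖V‖, by positivity, fun w =>
      (hGn _ _).trans (mul_le_mul_of_nonneg_left (V.norm_coe_le_norm w) hM)⟩
  have hexp : ∀ z : ℂ, ‖(Real.exp (-(τ / 2) * ‖z - ζ0‖ ^ 2) : ℂ)‖ ≤ 1 := fun z => by
    rw [Complex.norm_real, Real.norm_of_nonneg (Real.exp_pos _).le, Real.exp_le_one_iff]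
    have : 0 ≤ (τ / 2) * ‖z - ζ0‖ ^ 2 := by positivity
    linarith
  have hPb : ∀ (V : ℂ →ᵇ E) z, ‖Psi τ ζ0 (fun w => G w (V w)) z‖ ≤ L * (M * ‖V‖) := fun V z =>
    Psi_bound hτ (fun w => (hGn _ _).trans (mul_le_mul_of_nonneg_left (V.norm_coe_le_norm w) hM)) z
  let Th : (ℂ →ᵇ E) → (ℂ →ᵇ E) := fun V => BoundedContinuousFunction.ofNormedAddCommGroup
    (fun z => (Real.exp (-(τ / 2) * ‖z - ζ0‖ ^ 2) : ℂ) • (a - Psi τ ζ0 (fun w => G w (V w)) ζ0) +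
      Psi τ ζ0 (fun w => G w (V w)) z)
    (by
      refine Continuous.add (Continuous.smul (by fun_prop) continuous_const) (Psi_cont hτ (qc V)))
    (‖a - Psi τ ζ0 (fun w => G w (V w)) ζ0‖ + L * (M * ‖V‖)) (fun z => by
      refine (norm_add_le _ _).trans (add_le_add ?_ (hPb V z))
      rw [norm_smul]
      exact mul_le_of_le_one_left (norm_nonneg _) (hexp z))
  have hTh : ∀ V z, Th V z = (Real.exp (-(τ / 2) * ‖z - ζ0‖ ^ 2) : ℂ) • (a - Psi τ ζ0 (fun w => G w (V w)) ζ0) +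
      Psi τ ζ0 (fun w => G w (V w)) z := fun V z => rfl
  have hd : ∀ (V V' : ℂ →ᵇ E) z, ‖Psi τ ζ0 (fun w => G w (V w)) z - Psi τ ζ0 (fun w => G w (V' w)) z‖ ≤
      L * (M * dist V V') := fun V V' z => by
    rw [Psi_sub hτ (qc V) (qc V')]
    refine Psi_bound hτ (fun w => (hGL _ _ _).trans (mul_le_mul_of_nonneg_left ?_ hM)) z
    rw [← dist_eq_norm]
    exact V.dist_coe_le_dist w
  have hK : ContractingWith (1 / 2) Th := by
    refine ⟨by rw [← NNReal.coe_lt_coe]; norm_num, LipschitzWith.of_dist_le_mul fun V V' => ?_⟩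
    rw [BoundedContinuousFunction.dist_le (by positivity)]
    intro z
    rw [dist_eq_norm, hTh, hTh]
    have e : ∀ (s : ℂ) (x y p q : E), s • (a - x) + p - (s • (a - y) + q) = (p - q) - s • (x - y) := by
      intro s x y p q
      simp only [smul_sub]; abel
    rw [e]
    refine (norm_sub_le _ _).trans ?_
    rw [norm_smul]
    have h1 := hd V V' z
    have h2 := hd V V' ζ0
    have h3 := mul_le_of_le_one_left (norm_nonneg (Psi τ ζ0 (fun w => G w (V w)) ζ0 - Psi τ ζ0 (fun w => G w (V' w)) ζ0)) (hexp z)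
    have h4 := mul_le_mul_of_nonneg_right hL (dist_nonneg (x := V) (y := V'))
    have h5 : (((1 / 2 : NNReal) : NNReal) : ℝ) = 1 / 2 := by norm_num
    rw [h5]
    linarith
  have : Nonempty (ℂ →ᵇ E) := ⟨0⟩
  set V := ContractingWith.fixedPoint Th hK
  have hV : Th V = V := hK.fixedPoint_isFixedPt
  refine ⟨τ, hτ, V, V.continuous, qc V, ?_, a - Psi τ ζ0 (fun w => G w (V w)) ζ0, fun z => ?_⟩
  · rw [← hV, hTh]; simp
  · rw [← hTh, hV]

end

/-- holomorphic parameter integrals -/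
lemma differentiable_param {Q Q' : ℂ → ℂ → ℂ} (hQ : Continuous (Function.uncurry Q))
    (hQ' : Continuous (Function.uncurry Q')) (hd : ∀ z w, HasDerivAt (fun z => Q z w) (Q' z w) z)
    {f : ℂ → ℂ} (hf : Integrable f) (h0 : ∀ w, 2 < ‖w‖ → f w = 0) :
    Differentiable ℂ (fun z => ∫ w, Q z w * f w) := by
  intro z0
  have hbd : ∀ {R : ℂ → ℂ → ℂ}, Continuous (Function.uncurry R) → ∃ C, ∀ z ∈ Metric.closedBall z0 1,
      ∀ w ∈ Metric.closedBall (0 : ℂ) 2, ‖R z w‖ ≤ C := by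
    intro R hR
    obtain ⟨C, hC⟩ := ((isCompact_closedBall z0 1).prod (isCompact_closedBall (0 : ℂ) 2)).exists_bound_of_continuousOn
      hR.continuousOn
    exact ⟨C, fun z hz w hw => hC (z, w) ⟨hz, hw⟩⟩
  have hle : ∀ {R : ℂ → ℂ → ℂ} {C : ℝ}, (∀ z ∈ Metric.closedBall z0 1,
      ∀ w ∈ Metric.closedBall (0 : ℂ) 2, ‖R z w‖ ≤ C) → ∀ z ∈ Metric.closedBall z0 1, ∀ w, ‖R z w * f w‖ ≤ C * ‖f w‖ := by
    intro R C hR z hz w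
    by_cases hw : ‖w‖ ≤ 2
    · rw [norm_mul]
      exact mul_le_mul_of_nonneg_right (hR z hz w (by simpa using hw)) (norm_nonneg _)
    · simp [h0 w (not_le.1 hw)]
  obtain ⟨C, hC⟩ := hbd hQ
  obtain ⟨C', hC'⟩ := hbd hQ'
  have hm : ∀ {R : ℂ → ℂ → ℂ}, Continuous (Function.uncurry R) → ∀ z, AEStronglyMeasurable (fun w => R z w * f w) volume := by
    intro R hR z
    exact (hR.comp (by fun_prop : Continuous fun w : ℂ => (z, w))).aestronglyMeasurable.mul hf.aestronglyMeasurable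
  have := hasDerivAt_integral_of_dominated_loc_of_deriv_le (μ := (volume : Measure ℂ)) (𝕜 := ℂ) (x₀ := z0)
    (s := Metric.closedBall z0 1) (F := fun z w => Q z w * f w) (F' := fun z w => Q' z w * f w)
    (bound := fun w => C' * ‖f w‖) (Metric.closedBall_mem_nhds z0 one_pos)
    (Filter.Eventually.of_forall fun z => hm hQ z)
    ((hf.norm.const_mul C).mono' (hm hQ z0) (Filter.Eventually.of_forall (hle hC z0 (by simp))))
    (hm hQ' z0) (Filter.Eventually.of_forall fun w z hz => hle hC' z hz w) (hf.norm.const_mul C')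
    (Filter.Eventually.of_forall fun w z hz => (hd z w).mul_const (f w))
  exact this.2.differentiableAt

/-- weight -/
noncomputable def wt (τ : ℝ) (ζ0 z : ℂ) : ℝ := Real.exp ((τ / 2) * ‖z - ζ0‖ ^ 2)

lemma wt_cont (τ : ℝ) (ζ0 : ℂ) : Continuous (wt τ ζ0) := by unfold wt; fun_prop

lemma norm_sq_cast (z : ℂ) : ((‖z‖ : ℝ) : ℂ) ^ 2 = (starRingEnd ℂ) z * z := by
  rw [← Complex.normSq_eq_conj_mul_self, Complex.normSq_eq_norm_sq]; push_cast; rfl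

lemma kernel_id (τ : ℝ) (ζ0 z ζ : ℂ) : (wt τ ζ0 z : ℂ) * (GN τ ζ * PH τ ζ0 z ζ) =
    Complex.exp (τ * (starRingEnd ℂ) (z - ζ - ζ0) * ζ) / (π * ζ) * (wt τ ζ0 (z - ζ) : ℂ) := by
  have him : ∀ x : ℂ, (x.im : ℂ) * Complex.I = (x - (starRingEnd ℂ) x) / 2 := by
    intro x
    apply Complex.ext <;> simp
  have key : (((τ / 2) * ‖z - ζ0‖ ^ 2 : ℝ) : ℂ) + ((-(τ / 2) * ‖ζ‖ ^ 2 : ℝ) : ℂ) +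
      ((τ * ((starRingEnd ℂ) (z - ζ - ζ0) * (z - ζ0)).im : ℝ) : ℂ) * Complex.I =
      τ * (starRingEnd ℂ) (z - ζ - ζ0) * ζ + (((τ / 2) * ‖z - ζ - ζ0‖ ^ 2 : ℝ) : ℂ) := by
    push_cast
    rw [mul_assoc (τ : ℂ) _ Complex.I, him]
    simp only [norm_sq_cast, map_sub, map_mul, Complex.conj_conj]
    ring
  simp only [wt, GN, PH, Complex.ofReal_exp]
  calc _ = (Complex.exp (((τ / 2) * ‖z - ζ0‖ ^ 2 : ℝ) : ℂ) * Complex.exp ((-(τ / 2) * ‖ζ‖ ^ 2 : ℝ) : ℂ) *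
      Complex.exp (((τ * ((starRingEnd ℂ) (z - ζ - ζ0) * (z - ζ0)).im : ℝ) : ℂ) * Complex.I)) / (π * ζ) := by ring
    _ = _ := by
      rw [← Complex.exp_add, ← Complex.exp_add, key, Complex.exp_add]; ring

lemma Psi_rep (τ : ℝ) (ζ0 z : ℂ) (f : ℂ → ℂ) : (wt τ ζ0 z : ℂ) * Psi τ ζ0 f z =
    ∫ w, Complex.exp (τ * (starRingEnd ℂ) (w - ζ0) * (z - w)) / (π * (z - w)) * (wt τ ζ0 w * f w) := by
  rw [Psi, ← integral_const_mul, ← integral_sub_left_eq_self _ volume z]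
  refine integral_congr_ae (Filter.Eventually.of_forall fun ζ => ?_)
  have := kernel_id τ ζ0 z (z - ζ)
  simp only [smul_eq_mul, sub_sub_cancel] at this ⊢
  rw [← mul_assoc, this]; ring

/-- the entire kernel -/
noncomputable def QQ (τ : ℝ) (ζ0 : ℂ) (j : ℕ) (z w : ℂ) : ℂ :=
  (z - ζ0) ^ j * (τ * (starRingEnd ℂ) (w - ζ0)) * dslope Complex.exp 0 (τ * (starRingEnd ℂ) (w - ζ0) * (z - w)) +
    ∑ i ∈ Finset.range j, (z - ζ0) ^ i * (w - ζ0) ^ (j - 1 - i)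

noncomputable def QQ' (τ : ℝ) (ζ0 : ℂ) (j : ℕ) (z w : ℂ) : ℂ :=
  (j * (z - ζ0) ^ (j - 1) * (τ * (starRingEnd ℂ) (w - ζ0)) * dslope Complex.exp 0 (τ * (starRingEnd ℂ) (w - ζ0) * (z - w)) +
  (z - ζ0) ^ j * (τ * (starRingEnd ℂ) (w - ζ0)) *
    (deriv (dslope Complex.exp 0) (τ * (starRingEnd ℂ) (w - ζ0) * (z - w)) * (τ * (starRingEnd ℂ) (w - ζ0)))) +
    ∑ i ∈ Finset.range j, i * (z - ζ0) ^ (i - 1) * (w - ζ0) ^ (j - 1 - i)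

lemma dsl_diff : Differentiable ℂ (dslope Complex.exp 0) := by
  rw [← differentiableOn_univ, Complex.differentiableOn_dslope Filter.univ_mem, differentiableOn_univ]
  exact Complex.differentiable_exp

lemma QQ_cont (τ : ℝ) (ζ0 : ℂ) (j : ℕ) : Continuous (Function.uncurry (QQ τ ζ0 j)) := by
  have h := dsl_diff.continuous
  unfold QQ Function.uncurry
  simp only
  refine Continuous.add (Continuous.mul (by fun_prop) (h.comp (by fun_prop))) (by fun_prop)

lemma QQ'_cont (τ : ℝ) (ζ0 : ℂ) (j : ℕ) : Continuous (Function.uncurry (QQ' τ ζ0 j)) := by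
  have h := dsl_diff.continuous
  have h' : Continuous (deriv (dslope Complex.exp 0)) := (dsl_diff.contDiff (n := 1)).continuous_deriv le_rfl
  unfold QQ' Function.uncurry
  simp only
  refine Continuous.add (Continuous.add (Continuous.mul (by fun_prop) (h.comp (by fun_prop)))
    (Continuous.mul (by fun_prop) (Continuous.mul (h'.comp (by fun_prop)) (by fun_prop)))) (by fun_prop)

lemma QQ_deriv (τ : ℝ) (ζ0 : ℂ) (j : ℕ) (z w : ℂ) : HasDerivAt (fun z => QQ τ ζ0 j z w) (QQ' τ ζ0 j z w) z := by
  have hp : ∀ i : ℕ, HasDerivAt (fun z : ℂ => (z - ζ0) ^ i) (i * (z - ζ0) ^ (i - 1)) z := fun i => by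
    simpa using ((hasDerivAt_id z).sub_const ζ0).fun_pow i
  have h1 : HasDerivAt (fun z : ℂ => τ * (starRingEnd ℂ) (w - ζ0) * (z - w)) (τ * (starRingEnd ℂ) (w - ζ0)) z := by
    simpa using ((hasDerivAt_id z).sub_const w).const_mul (τ * (starRingEnd ℂ) (w - ζ0))
  have h2 := (dsl_diff (τ * (starRingEnd ℂ) (w - ζ0) * (z - w))).hasDerivAt.comp z h1
  have h3 := ((hp j).mul_const (τ * (starRingEnd ℂ) (w - ζ0))).mul h2
  exact h3.add (HasDerivAt.fun_sum fun i _ => (hp i).mul_const _)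

lemma QQ_mul (τ : ℝ) (ζ0 : ℂ) (j : ℕ) (z w : ℂ) : QQ τ ζ0 j z w * (z - w) =
    (z - ζ0) ^ j * Complex.exp (τ * (starRingEnd ℂ) (w - ζ0) * (z - w)) - (w - ζ0) ^ j := by
  have h1 := sub_smul_dslope Complex.exp 0 (τ * (starRingEnd ℂ) (w - ζ0) * (z - w))
  have h2 := geom_sum₂_mul (z - ζ0) (w - ζ0) j
  rw [sub_zero, smul_eq_mul, Complex.exp_zero] at h1
  rw [sub_sub_sub_cancel_right] at h2
  rw [QQ, add_mul, h2]
  linear_combination (z - ζ0) ^ j * h1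

lemma kk_eq {t : ℂ} (h : ‖t‖ ≤ 4) : kk t = 1 / (π * t) := by
  rw [kk, cut_one]
  rw [Complex.normSq_eq_norm_sq]
  nlinarith [norm_nonneg t]

lemma mul_integrable {R : ℂ → ℂ} (hR : Continuous R) {f : ℂ → ℂ} (hf : Integrable f) (h0 : ∀ w, 2 < ‖w‖ → f w = 0) :
    Integrable (fun w => R w * f w) := by
  obtain ⟨C, hC⟩ := (isCompact_closedBall (0 : ℂ) 2).exists_bound_of_continuousOn hR.continuousOn
  refine (hf.norm.const_mul C).mono' (hR.aestronglyMeasurable.mul hf.aestronglyMeasurable)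
    (Filter.Eventually.of_forall fun w => ?_)
  by_cases hw : ‖w‖ ≤ 2
  · rw [norm_mul]
    exact mul_le_mul_of_nonneg_right (hC w (by simpa using hw)) (norm_nonneg _)
  · simp [h0 w (not_le.1 hw)]

lemma cauchy_rep {τ : ℝ} {ζ0 : ℂ} {j : ℕ} {g : ℂ → ℂ} (hg : Integrable g) (h0 : ∀ w, 2 < ‖w‖ → g w = 0)
    (hF : BC (fun w => (w - ζ0) ^ j * g w)) {z : ℂ} (hz : ‖z‖ ≤ 2) :
    (z - ζ0) ^ j * ∫ w, Complex.exp (τ * (starRingEnd ℂ) (w - ζ0) * (z - w)) / (π * (z - w)) * g w =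
    AA kk 1 (fun w => (w - ζ0) ^ j * g w) z + ∫ w, QQ τ ζ0 j z w * (g w / π) := by
  have e : AA kk 1 (fun w => (w - ζ0) ^ j * g w) z = ∫ w, kk (z - w) * ((w - ζ0) ^ j * g w) := by
    rw [AA, ← integral_sub_left_eq_self _ volume z]
    simp
  have i1 : Integrable (fun w => kk (z - w) * ((w - ζ0) ^ j * g w)) := by
    have := (AA_integrable kk_integrable hF 1 z).comp_sub_left z
    simpa using this
  have i2 : Integrable (fun w => QQ τ ζ0 j z w * (g w / π)) :=
    mul_integrable ((QQ_cont τ ζ0 j).comp (by fun_prop : Continuous fun w : ℂ => (z, w)))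
      (hg.div_const _) (fun w hw => by simp [h0 w hw])
  rw [e, ← integral_add i1 i2, ← integral_const_mul]
  have hne : ∀ᵐ w : ℂ, w ≠ z := compl_mem_ae_iff.2 (measure_singleton (μ := (volume : Measure ℂ)) z)
  refine integral_congr_ae ?_
  filter_upwards [hne] with w hw
  by_cases hg0 : g w = 0
  · simp [hg0]
  · have hw2 : ‖w‖ ≤ 2 := by by_contra h; exact hg0 (h0 w (not_le.1 h))
    have hzw : z - w ≠ 0 := sub_ne_zero.2 hw.symm
    have hpi : (π : ℂ) ≠ 0 := by exact_mod_cast Real.pi_ne_zero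
    rw [kk_eq ((norm_sub_le _ _).trans (by linarith))]
    have := QQ_mul τ ζ0 j z w
    rw [← eq_div_iff hzw] at this
    rw [this]
    field_simp
    ring

lemma mulVec_bound {n : ℕ} {A : Matrix (Fin n) (Fin n) ℂ} {C : Fin n → Fin n → ℝ} (hC : ∀ i j, 0 ≤ C i j)
    (h : ∀ i j, ‖A i j‖ ≤ C i j) (v : Fin n → ℂ) : ‖A *ᵥ v‖ ≤ (∑ i, ∑ j, C i j) * ‖v‖ := by
  have hn : 0 ≤ ∑ i, ∑ j, C i j := Finset.sum_nonneg fun i _ => Finset.sum_nonneg fun j _ => hC i j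
  rw [pi_norm_le_iff_of_nonneg (by positivity)]
  intro i
  have h1 : ‖(A *ᵥ v) i‖ ≤ ∑ j, C i j * ‖v‖ := by
    rw [Matrix.mulVec, dotProduct]
    refine (norm_sum_le _ _).trans (Finset.sum_le_sum fun j _ => ?_)
    rw [norm_mul]
    exact mul_le_mul (h i j) (norm_le_pi_norm v j) (norm_nonneg _) (hC i j)
  rw [← Finset.sum_mul] at h1
  refine h1.trans (mul_le_mul_of_nonneg_right ?_ (norm_nonneg _))
  exact Finset.single_le_sum (f := fun i => ∑ j, C i j) (fun i _ => Finset.sum_nonneg fun j _ => hC i j) (Finset.mem_univ i)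

lemma vecConj_norm {n : ℕ} (v : Fin n → ℂ) : ‖vecConj v‖ = ‖v‖ := by
  simp [Pi.norm_def, vecConj]

lemma vecConj_sub {n : ℕ} (v w : Fin n → ℂ) : vecConj (v - w) = vecConj v - vecConj w := by
  ext i; simp [vecConj]

/-- conj quotient -/
noncomputable def qq (ζ0 : ℂ) (j : ℕ) (w : ℂ) : ℂ := ((starRingEnd ℂ) (w - ζ0) / (w - ζ0)) ^ j

lemma qq_norm (ζ0 : ℂ) (j : ℕ) (w : ℂ) : ‖qq ζ0 j w‖ ≤ 1 := by
  rw [qq, norm_pow, norm_div, Complex.norm_conj]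
  exact pow_le_one₀ (by positivity) (div_self_le_one _)

lemma qq_mul (ζ0 : ℂ) (j : ℕ) (w : ℂ) : (w - ζ0) ^ j * qq ζ0 j w = (starRingEnd ℂ) ((w - ζ0) ^ j) := by
  rw [qq, map_pow, ← mul_pow]
  by_cases h : w - ζ0 = 0
  · simp [h]
  · rw [mul_div_cancel₀ _ h]

/-- the right-hand side after removing the zero -/
noncomputable def GG {n : ℕ} (B₁ B₂ : ℂ → Matrix (Fin n) (Fin n) ℂ) (ζ0 : ℂ) (j : ℕ) (w : ℂ) (v : Fin n → ℂ) :
    Fin n → ℂ := B₁ w *ᵥ v + B₂ w *ᵥ (qq ζ0 j w • vecConj v)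

lemma GG_smul {n : ℕ} (B₁ B₂ : ℂ → Matrix (Fin n) (Fin n) ℂ) (ζ0 : ℂ) (j : ℕ) (w : ℂ) (v : Fin n → ℂ) (r : ℝ) :
    GG B₁ B₂ ζ0 j w ((r : ℂ) • v) = (r : ℂ) • GG B₁ B₂ ζ0 j w v := by
  have : vecConj ((r : ℂ) • v) = (r : ℂ) • vecConj v := by ext i; simp [vecConj]
  rw [GG, GG, this, smul_comm, Matrix.mulVec_smul, Matrix.mulVec_smul, smul_add]

lemma GG_pow {n : ℕ} (B₁ B₂ : ℂ → Matrix (Fin n) (Fin n) ℂ) (ζ0 : ℂ) (j : ℕ) (w : ℂ) (v : Fin n → ℂ) :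
    (w - ζ0) ^ j • GG B₁ B₂ ζ0 j w v =
      B₁ w *ᵥ ((w - ζ0) ^ j • v) + B₂ w *ᵥ vecConj ((w - ζ0) ^ j • v) := by
  have : vecConj ((w - ζ0) ^ j • v) = ((w - ζ0) ^ j * qq ζ0 j w) • vecConj v := by
    rw [qq_mul]; ext i; simp [vecConj]
  simp only [GG, this, smul_add, mul_smul, Matrix.mulVec_smul]

lemma GG_zero {n : ℕ} {B₁ B₂ : ℂ → Matrix (Fin n) (Fin n) ℂ} {ζ0 : ℂ} {j : ℕ} {w : ℂ}
    (h1 : B₁ w = 0) (h2 : B₂ w = 0) (v : Fin n → ℂ) : GG B₁ B₂ ζ0 j w v = 0 := by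
  simp [GG, h1, h2]

theorem exists_local {α : ℝ} (hα₀ : 0 < α) (hα₁ : α < 1) {n m : ℕ} {B₁ B₂ : ℂ → Matrix (Fin n) (Fin n) ℂ}
    (hB₁ : ∀ i l, Hol α Set.univ m (fun z => B₁ z i l)) (hB₂ : ∀ i l, Hol α Set.univ m (fun z => B₂ z i l))
    (h01 : ∀ z, 2 < ‖z‖ → B₁ z = 0) (h02 : ∀ z, 2 < ‖z‖ → B₂ z = 0) (ζ0 : ℂ) (j : ℕ) (a : Fin n → ℂ) :
    ∃ U : ℂ → Fin n → ℂ, (∀ i, Hol α Set.univ (m + 1) (fun z => U z i)) ∧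
      (∀ z, ‖z‖ < 2 → wirtingerZbar U z = B₁ z *ᵥ U z + B₂ z *ᵥ vecConj (U z)) ∧
      ∃ v : ℂ → Fin n → ℂ, Continuous v ∧ v ζ0 = a ∧ ∀ z, ‖z‖ ≤ 2 → U z = (z - ζ0) ^ j • v z := by
  have hc1 : ∀ i l, Continuous (fun z => B₁ z i l) := fun i l => (hB₁ i l).h0.continuous hα₀
  have hc2 : ∀ i l, Continuous (fun z => B₂ z i l) := fun i l => (hB₂ i l).h0.continuous hα₀
  obtain ⟨M, hM, hGb⟩ : ∃ M : ℝ, 0 ≤ M ∧ ∀ w v, ‖GG B₁ B₂ ζ0 j w v‖ ≤ M * ‖v‖ := by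
    choose C1 hC1 hC1' _ using fun i l => (hB₁ i l).h0
    choose C2 hC2 hC2' _ using fun i l => (hB₂ i l).h0
    have p1 : 0 ≤ ∑ i, ∑ l, C1 i l := Finset.sum_nonneg fun i _ => Finset.sum_nonneg fun j _ => hC1 i j
    have p2 : 0 ≤ ∑ i, ∑ l, C2 i l := Finset.sum_nonneg fun i _ => Finset.sum_nonneg fun j _ => hC2 i j
    refine ⟨(∑ i, ∑ l, C1 i l) + (∑ i, ∑ l, C2 i l), by positivity, fun w v => ?_⟩
    rw [GG, add_mul]
    refine (norm_add_le _ _).trans (add_le_add (mulVec_bound hC1 (fun i l => hC1' i l w trivial) v) ?_)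
    refine (mulVec_bound hC2 (fun i l => hC2' i l w trivial) _).trans (mul_le_mul_of_nonneg_left ?_ p2)
    rw [norm_smul, vecConj_norm]
    exact mul_le_of_le_one_left (norm_nonneg _) (qq_norm _ _ _)
  have hGs : ∀ w v v', GG B₁ B₂ ζ0 j w v - GG B₁ B₂ ζ0 j w v' = GG B₁ B₂ ζ0 j w (v - v') := by
    intro w v v'
    simp only [GG, vecConj_sub, smul_sub, Matrix.mulVec_sub]; abel
  obtain ⟨τ, hτ, V, hVc, hqc, hVa, c, hV⟩ := exists_fix (ζ0 := ζ0) (G := GG B₁ B₂ ζ0 j) hM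
    (fun w => by simpa using hGb w 0) (fun w v v' => by rw [hGs]; exact hGb _ _) (fun V hV w hw => by
      have hq : ContinuousAt (qq ζ0 j) w := by
        unfold qq
        have h1 : ContinuousAt (fun w : ℂ => (starRingEnd ℂ) (w - ζ0)) w :=
          (Complex.continuous_conj.comp (continuous_id.sub continuous_const)).continuousAt
        have h2 : ContinuousAt (fun w : ℂ => w - ζ0) w := by fun_prop
        exact (h1.div h2 (sub_ne_zero.2 hw)).pow j
      rw [continuousAt_pi]
      intro i
      have hVi : ∀ l, Continuous fun w => V w l := fun l => (continuous_apply l).comp hV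
      have e : (fun w => GG B₁ B₂ ζ0 j w (V w) i) = fun w => ∑ l, B₁ w i l * V w l +
          ∑ l, B₂ w i l * (qq ζ0 j w * (starRingEnd ℂ) (V w l)) := by
        funext w
        simp [GG, Matrix.mulVec, dotProduct, vecConj]
      rw [e]
      refine ContinuousAt.add ?_ ?_
      · exact (continuous_finsetSum _ fun l _ => (hc1 i l).mul (hVi l)).continuousAt
      · refine tendsto_finsetSum _ fun l _ => ?_
        exact ((hc2 i l).continuousAt.mul (hq.mul (Complex.continuous_conj.comp (hVi l)).continuousAt))) a
  set v : ℂ → Fin n → ℂ := fun z => (wt τ ζ0 z : ℂ) • V z with hv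
  have hvc : Continuous v := (Complex.continuous_ofReal.comp (wt_cont τ ζ0)).smul hVc
  set u : ℂ → Fin n → ℂ := fun z => (z - ζ0) ^ j • v z with hu
  have huc : Continuous u := by
    have h1 : Continuous fun z : ℂ => (z - ζ0) ^ j := by fun_prop
    exact h1.smul hvc
  set g : Fin n → ℂ → ℂ := fun i w => (wt τ ζ0 w : ℂ) * GG B₁ B₂ ζ0 j w (V w) i with hg
  set F : Fin n → ℂ → ℂ := fun i w => (w - ζ0) ^ j * g i w with hF
  have hFu : ∀ i w, F i w = (B₁ w *ᵥ u w + B₂ w *ᵥ vecConj (u w)) i := by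
    intro i w
    rw [hu]
    simp only
    rw [← GG_pow, hv]
    simp only
    rw [GG_smul]
    rfl
  have hg0 : ∀ i w, 2 < ‖w‖ → g i w = 0 := fun i w hw => by
    simp [hg, GG_zero (h01 w hw) (h02 w hw)]
  have hFc : ∀ i, Continuous (F i) := by
    intro i
    have hui : ∀ l, Continuous fun w => u w l := fun l => (continuous_apply l).comp huc
    have e : F i = fun w => ∑ l, B₁ w i l * u w l + ∑ l, B₂ w i l * (starRingEnd ℂ) (u w l) := by
      funext w
      rw [hFu]
      simp [Matrix.mulVec, dotProduct, vecConj]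
    rw [e]
    refine Continuous.add (continuous_finsetSum _ fun l _ => (hc1 i l).mul (hui l))
      (continuous_finsetSum _ fun l _ => (hc2 i l).mul (Complex.continuous_conj.comp (hui l)))
  have hF0 : ∀ i w, 2 < ‖w‖ → F i w = 0 := fun i w hw => by simp [hF, hg0 i w hw]
  have hFbc : ∀ i, BC (F i) := by
    intro i
    refine ⟨hFc i, ?_⟩
    obtain ⟨C, hC⟩ := (isCompact_closedBall (0 : ℂ) 2).exists_bound_of_continuousOn (hFc i).continuousOn
    refine ⟨|C|, abs_nonneg _, fun w => ?_⟩
    by_cases hw : ‖w‖ ≤ 2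
    · exact (hC w (by simpa using hw)).trans (le_abs_self C)
    · rw [hF0 i w (not_le.1 hw)]; simp
  have hgi : ∀ i, Integrable (g i) := by
    intro i
    have h1 : AEStronglyMeasurable (fun w => GG B₁ B₂ ζ0 j w (V w) i) volume :=
      (continuous_apply i).comp_aestronglyMeasurable hqc.aesm
    obtain ⟨-, N, hN, hNb⟩ := hqc
    have h2 : IntegrableOn (fun w => GG B₁ B₂ ζ0 j w (V w) i) (Metric.closedBall 0 2) := by
      refine Measure.integrableOn_of_bounded (M := N) measure_closedBall_lt_top.ne h1 (Filter.Eventually.of_forall fun w => ?_)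
      exact (norm_le_pi_norm _ i).trans (hNb w)
    have h3 : Integrable (fun w => GG B₁ B₂ ζ0 j w (V w) i) := by
      refine (integrableOn_iff_integrable_of_support_subset fun w hw => ?_).1 h2
      by_contra h
      have h' : 2 < ‖w‖ := by simpa using h
      exact hw (by simp [GG_zero (h01 w h') (h02 w h')])
    refine mul_integrable (R := fun w => (wt τ ζ0 w : ℂ)) (Complex.continuous_ofReal.comp (wt_cont τ ζ0)) h3 fun w hw => ?_
    simp [GG_zero (h01 w hw) (h02 w hw)]
  -- the entire part
  set E : Fin n → ℂ → ℂ := fun i z => (z - ζ0) ^ j * c i + ∫ w, QQ τ ζ0 j z w * (g i w / π) with hE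
  have hEd : ∀ i, Differentiable ℂ (E i) := by
    intro i
    refine Differentiable.add (by fun_prop) (differentiable_param (QQ_cont τ ζ0 j) (QQ'_cont τ ζ0 j)
      (QQ_deriv τ ζ0 j) ((hgi i).div_const _) fun w hw => by simp [hg0 i w hw])
  have hrep : ∀ i z, ‖z‖ ≤ 2 → u z i = AA kk 1 (F i) z + E i z := by
    intro i z hz
    have h1 := cauchy_rep (τ := τ) (ζ0 := ζ0) (j := j) (hgi i) (hg0 i) (hFbc i) hz
    have h2 := Psi_rep τ ζ0 z (fun w => GG B₁ B₂ ζ0 j w (V w) i)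
    have h3 : Psi τ ζ0 (fun w => GG B₁ B₂ ζ0 j w (V w)) z i = Psi τ ζ0 (fun w => GG B₁ B₂ ζ0 j w (V w) i) z := by
      have := (ContinuousLinearMap.proj (R := ℂ) (φ := fun _ : Fin n => ℂ) i).integral_comp_comm (hqc.integrable hτ z)
      simpa [Psi] using this.symm
    have h4 : (wt τ ζ0 z : ℂ) * (Real.exp (-(τ / 2) * ‖z - ζ0‖ ^ 2) : ℂ) = 1 := by
      rw [wt, ← Complex.ofReal_mul, ← Real.exp_add]; simp
    have h5 : u z i = (z - ζ0) ^ j * (c i + (wt τ ζ0 z : ℂ) * Psi τ ζ0 (fun w => GG B₁ B₂ ζ0 j w (V w) i) z) := by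
      simp only [hu, hv, Pi.smul_apply, smul_eq_mul]
      rw [hV z]
      simp only [Pi.add_apply, Pi.smul_apply, smul_eq_mul]
      rw [h3]
      linear_combination (z - ζ0) ^ j * c i * h4
    rw [h5, mul_add, h2, h1, hE]
    ring
  set U : ℂ → Fin n → ℂ := fun z i => AA kk 1 (F i) z + cut (1 / 4) z * E i z with hU
  have hcut : ∀ z : ℂ, ‖z‖ ≤ 2 → cut (1 / 4) z = 1 := fun z hz => cut_one (by
    rw [Complex.normSq_eq_norm_sq]; nlinarith [norm_nonneg z])
  have hUu : ∀ z, ‖z‖ ≤ 2 → U z = u z := fun z hz => by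
    funext i
    simp only [hU]
    rw [hcut z hz, one_mul, hrep i z hz]
  have hFU : ∀ i w, F i w = (B₁ w *ᵥ U w + B₂ w *ᵥ vecConj (U w)) i := by
    intro i w
    by_cases hw : ‖w‖ ≤ 2
    · rw [hFu, hUu w hw]
    · rw [hF0 i w (not_le.1 hw), h01 w (not_le.1 hw), h02 w (not_le.1 hw)]; simp
  have hEs : ∀ i l, Hol α Set.univ l (fun z => cut (1 / 4) z * E i z) := fun i l =>
    Hol.of_smooth hα₀ hα₁ l ((cut_contDiff (1 / 4)).mul ((hEd i).contDiff.restrict_scalars ℝ))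
      ((cut_hcs (by norm_num)).mul_right)
  have hHol : ∀ l, l ≤ m + 1 → ∀ i, Hol α Set.univ l (fun z => U z i) := by
    intro l
    induction l with
    | zero => exact fun _ i => Hol.add (m := 0) (kk_H0 hα₀ hα₁ (hFbc i)) (hEs i 0)
    | succ l ih =>
      intro hl i
      refine Hol.add (kk_Hol hα₀ hα₁ ?_) (hEs i _)
      have e : F i = fun w => ∑ l, B₁ w i l * U w l + ∑ l, B₂ w i l * (starRingEnd ℂ) (U w l) := by
        funext w
        rw [hFU]
        simp [Matrix.mulVec, dotProduct, vecConj]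
      rw [e]
      exact Hol.add (Hol.sum _ fun p _ => ((hB₁ i p).le (by omega)).mul (ih (by omega) p))
        (Hol.sum _ fun p _ => ((hB₂ i p).le (by omega)).mul (ih (by omega) p).conj)
  have hFh : ∀ i, H0 α Set.univ (F i) := by
    intro i
    have e : F i = fun w => ∑ l, B₁ w i l * U w l + ∑ l, B₂ w i l * (starRingEnd ℂ) (U w l) := by
        funext w
        rw [hFU]
        simp [Matrix.mulVec, dotProduct, vecConj]
    rw [e]
    exact Hol.add (m := 0) (Hol.sum _ fun p _ => ((hB₁ i p).le (by omega)).mul (hHol 0 (by omega) p))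
        (Hol.sum _ fun p _ => ((hB₂ i p).le (by omega)).mul (hHol 0 (by omega) p).conj)
  refine ⟨U, hHol _ le_rfl, fun z hz => ?_, v, hvc, ?_, hUu⟩
  · have hdA : ∀ i, DifferentiableAt ℝ (AA kk 1 (F i)) z := fun i =>
      ((Hol.contDiff hα₀ (kk_Hol hα₀ hα₁ (m := 0) (hFh i))).differentiable (by simp)) z
    have hEe : ∀ i, (fun z => cut (1 / 4) z * E i z) =ᶠ[nhds z] E i := fun i => by
      have : Metric.ball (0 : ℂ) 2 ∈ nhds z := Metric.isOpen_ball.mem_nhds (by simpa using hz)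
      filter_upwards [this] with y hy
      rw [hcut y (by simpa using (Metric.mem_ball.1 hy).le), one_mul]
    have hdE : ∀ i, HasFDerivAt (fun z => cut (1 / 4) z * E i z)
        ((fderiv ℂ (E i) z).restrictScalars ℝ) z := fun i =>
      (((hEd i) z).hasFDerivAt.restrictScalars ℝ).congr_of_eventuallyEq (hEe i)
    have hdU : ∀ i, HasFDerivAt (fun z => U z i) (fderiv ℝ (AA kk 1 (F i)) z + (fderiv ℂ (E i) z).restrictScalars ℝ) z :=
      fun i => (hdA i).hasFDerivAt.add (hdE i)
    have hdU' := hasFDerivAt_pi.2 hdU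
    have hdU'' : HasFDerivAt U _ z := hdU'
    rw [wirtingerZbar, hdU''.fderiv]
    funext i
    rw [← hFU]
    have h1 := kk_dbar hα₀ hα₁ (hFh i) (x := z) (fun w hw => by
      have : ‖w‖ ≤ 2 := by by_contra h; exact hw (hF0 i w (not_le.1 h))
      exact (norm_sub_le _ _).trans_lt (by linarith))
    have h2 : fderiv ℂ (E i) z Complex.I = Complex.I * fderiv ℂ (E i) z 1 := by
      rw [← smul_eq_mul, ← map_smul]; simp
    simp only [Pi.smul_apply, Pi.add_apply, ContinuousLinearMap.coe_pi', _root_.add_apply, smul_eq_mul,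
      ContinuousLinearMap.coe_restrictScalars']
    rw [h2]
    linear_combination (1 / 2 : ℂ) * h1 + (1 / 2 : ℂ) * fderiv ℂ (E i) z 1 * Complex.I_sq
  · simp [hv, wt, hVa]

/-- first order constant coefficient operator -/
noncomputable def OP (a b : ℂ) (f : ℂ → ℂ) : ℂ → ℂ := fun z => a * fderiv ℝ f z 1 + b * fderiv ℝ f z Complex.I

/-- the Wirtinger derivative -/
noncomputable def WZ : (ℂ → ℂ) → ℂ → ℂ := OP (1 / 2) (-Complex.I / 2)

/-- the conjugate Wirtinger derivative -/
noncomputable def WZb : (ℂ → ℂ) → ℂ → ℂ := OP (1 / 2) (Complex.I / 2)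

lemma OP_contDiff {a b : ℂ} {i : ℕ} {f : ℂ → ℂ} (hf : ContDiff ℝ (i + 1 : ℕ) f) : ContDiff ℝ i (OP a b f) := by
  have h : ContDiff ℝ i (fderiv ℝ f) := hf.fderiv_right (by norm_cast)
  unfold OP
  exact (contDiff_const.mul (h.clm_apply contDiff_const)).add (contDiff_const.mul (h.clm_apply contDiff_const))

lemma OP_iter_contDiff {a b : ℂ} {i l : ℕ} {f : ℂ → ℂ} (hf : ContDiff ℝ (l + i : ℕ) f) :
    ContDiff ℝ l ((OP a b)^[i] f) := by
  induction i generalizing f with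
  | zero => exact hf
  | succ i ih =>
    rw [Function.iterate_succ_apply]
    exact ih (OP_contDiff hf)

lemma OP_lin {a b c d : ℂ} {f g : ℂ → ℂ} (hf : Differentiable ℝ f) (hg : Differentiable ℝ g) :
    OP a b (fun z => c * f z + d * g z) = fun z => c * OP a b f z + d * OP a b g z := by
  funext z
  have h := ((hf z).hasFDerivAt.const_mul c).add ((hg z).hasFDerivAt.const_mul d)
  have h' : fderiv ℝ (fun z => c * f z + d * g z) z = c • fderiv ℝ f z + d • fderiv ℝ g z := h.fderiv
  simp only [OP, h']
  simp
  ring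

lemma OP_iter_lin {a b c d : ℂ} {i : ℕ} {f g : ℂ → ℂ} (hf : ContDiff ℝ i f) (hg : ContDiff ℝ i g) :
    (OP a b)^[i] (fun z => c * f z + d * g z) = fun z => c * (OP a b)^[i] f z + d * (OP a b)^[i] g z := by
  induction i generalizing f g with
  | zero => rfl
  | succ i ih =>
    simp only [Function.iterate_succ_apply]
    rw [OP_lin (hf.differentiable (by simp)) (hg.differentiable (by simp)), ih (OP_contDiff hf) (OP_contDiff hg)]

lemma OP_dir (e : ℂ) (f : ℂ → ℂ) : OP e.re e.im f = fun z => e * WZ f z + (starRingEnd ℂ) e * WZb f z := by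
  funext z
  simp only [OP, WZ, WZb]
  have h1 : (e.re : ℂ) = (e + (starRingEnd ℂ) e) / 2 := by rw [Complex.add_conj]; simp
  have h2 : (e.im : ℂ) = -Complex.I * (e - (starRingEnd ℂ) e) / 2 := by
    rw [Complex.sub_conj]; push_cast; linear_combination (e.im : ℂ) * Complex.I_sq
  rw [h1, h2]; ring

lemma OP_poly {i : ℕ} {f : ℂ → ℂ} (hf : ContDiff ℝ i f) (z : ℂ) : ∃ P : Polynomial ℂ, P.natDegree ≤ i ∧
    P.coeff i = WZ^[i] f z ∧ ∀ e : ℂ, ‖e‖ = 1 → (OP e.re e.im)^[i] f z = ((starRingEnd ℂ) e) ^ i * P.eval (e ^ 2) := by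
  induction i generalizing f with
  | zero => exact ⟨Polynomial.C (f z), by simp, by simp, fun e _ => by simp⟩
  | succ i ih =>
    obtain ⟨P1, hd1, hc1, he1⟩ := ih (f := WZ f) (OP_contDiff hf)
    obtain ⟨P2, hd2, hc2, he2⟩ := ih (f := WZb f) (OP_contDiff hf)
    refine ⟨Polynomial.X * P1 + P2, ?_, ?_, fun e he => ?_⟩
    · refine (Polynomial.natDegree_add_le _ _).trans (max_le ?_ (by omega))
      exact Polynomial.natDegree_mul_le.trans (by rw [Polynomial.natDegree_X]; omega)
    · rw [Polynomial.coeff_add, Polynomial.coeff_X_mul, hc1, Polynomial.coeff_eq_zero_of_natDegree_lt (by omega),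
        add_zero, Function.iterate_succ_apply]
    · rw [Function.iterate_succ_apply, OP_dir,
        OP_iter_lin (f := WZ f) (g := WZb f) (OP_contDiff hf) (OP_contDiff hf)]
      beta_reduce
      rw [he1 e he, he2 e he]
      have h : (starRingEnd ℂ) e * e = 1 := by
        rw [← Complex.normSq_eq_conj_mul_self, Complex.normSq_eq_norm_sq, he]; simp
      simp only [Polynomial.eval_add, Polynomial.eval_mul, Polynomial.eval_X]
      rw [pow_succ ((starRingEnd ℂ) e) i]
      linear_combination -(starRingEnd ℂ) e ^ i * e * P1.eval (e ^ 2) * h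

lemma poly_zero {P : Polynomial ℂ} (h : ∀ e : ℂ, ‖e‖ = 1 → P.eval (e ^ 2) = 0) : P = 0 := by
  apply Polynomial.eq_zero_of_infinite_isRoot
  refine Set.infinite_of_injOn_mapsTo (s := Set.Ioo (0 : ℝ) 1) (f := fun t : ℝ => Complex.exp (t * Complex.I) ^ 2)
    (fun s hs t ht hst => ?_) (fun t _ => h _ (Complex.norm_exp_ofReal_mul_I t)) (Set.Ioo_infinite one_pos)
  simp only [← Complex.exp_nat_mul] at hst
  have hpi := Real.pi_gt_three
  have := Complex.exp_inj_of_neg_pi_lt_of_le_pi (by simp; linarith [hs.1]) (by simp; linarith [hs.2])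
    (by simp; linarith [ht.1]) (by simp; linarith [ht.2]) hst
  simpa using congrArg Complex.im this

open Asymptotics in
lemma iter_1d {i : ℕ} {h : ℝ → ℂ} (hh : ContDiff ℝ i h) (ho : h =o[nhds 0] fun t => t ^ i) :
    iteratedDeriv i h 0 = 0 := by
  induction i using Nat.strong_induction_on with
  | _ i ih =>
    have hlow : ∀ l < i, iteratedDeriv l h 0 = 0 := fun l hl => by
      refine ih l hl (hh.of_le (by exact_mod_cast hl.le)) (ho.trans_isBigO ?_)
      have : (fun t : ℝ => t ^ i) = fun t => t ^ l * t ^ (i - l) := by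
        funext t; rw [← pow_add]; congr 1; omega
      rw [this]
      have h1 : (fun t : ℝ => t ^ (i - l)) =O[nhds 0] fun _ => (1 : ℝ) :=
        (by fun_prop : Continuous fun t : ℝ => t ^ (i - l)).continuousAt.isBigO_one ℝ
      simpa using (isBigO_refl (fun t : ℝ => t ^ l) (nhds 0)).mul h1
    have ht := taylor_isLittleO_univ (x₀ := 0) hh
    have e : ∀ t, taylorWithinEval h i Set.univ 0 t = ((i.factorial : ℝ)⁻¹ * t ^ i) • iteratedDeriv i h 0 := by
      intro t
      rw [taylor_within_apply, Finset.sum_range_succ, Finset.sum_eq_zero, zero_add]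
      · simp [iteratedDerivWithin_univ]
      · intro l hl
        rw [iteratedDerivWithin_univ, hlow l (Finset.mem_range.1 hl), smul_zero]
    simp only [e, sub_zero] at ht
    have h2 := ho.sub ht
    simp only [sub_sub_cancel] at h2
    have h3 : Filter.Tendsto (fun t : ℝ => (t ^ i)⁻¹ • (((i.factorial : ℝ)⁻¹ * t ^ i) • iteratedDeriv i h 0))
        (nhdsWithin 0 {0}ᶜ) (nhds 0) := by
      have := (h2.mono (nhdsWithin_le_nhds (s := {(0 : ℝ)}ᶜ))).tendsto_inv_smul_nhds_zero
      exact this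
    have h4 : Filter.Tendsto (fun t : ℝ => (t ^ i)⁻¹ • (((i.factorial : ℝ)⁻¹ * t ^ i) • iteratedDeriv i h 0))
        (nhdsWithin 0 {0}ᶜ) (nhds ((i.factorial : ℝ)⁻¹ • iteratedDeriv i h 0)) := by
      refine tendsto_const_nhds.congr' ?_
      filter_upwards [self_mem_nhdsWithin] with t ht
      have ht' : t ^ i ≠ 0 := pow_ne_zero _ ht
      rw [smul_smul]; congr 1; field_simp
    have h5 := tendsto_nhds_unique h3 h4
    have h6 : (i.factorial : ℝ)⁻¹ ≠ 0 := by positivity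
    exact (smul_eq_zero.1 h5.symm).resolve_left h6

lemma iter_line {i : ℕ} {f : ℂ → ℂ} (hf : ContDiff ℝ i f) (x e : ℂ) :
    iteratedDeriv i (fun t : ℝ => f (x + t * e)) = fun t : ℝ => (OP e.re e.im)^[i] f (x + t * e) := by
  induction i generalizing f with
  | zero => simp
  | succ i ih =>
    rw [iteratedDeriv_succ', Function.iterate_succ_apply, ← ih (OP_contDiff hf)]
    congr 1
    funext t
    have h1 : HasDerivAt (fun t : ℝ => x + t * e) e t := by
      simpa using ((Complex.ofRealCLM.hasDerivAt (x := t)).mul_const e).const_add x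
    have h2 := (hf.differentiable (by simp) (x + t * e)).hasFDerivAt.comp_hasDerivAt t h1
    have h3 : deriv (fun t : ℝ => f (x + t * e)) t = fderiv ℝ f (x + t * e) e := h2.deriv
    rw [h3, OP]
    have h4 := eq_D2 (fderiv ℝ f (x + t * e))
    conv_lhs => rw [h4, D2_apply]

open Asymptotics in
lemma WZ_zero {i : ℕ} {f : ℂ → ℂ} (hf : ContDiff ℝ i f) {x : ℂ} (ho : f =o[nhds x] fun z => ‖z - x‖ ^ i) :
    WZ^[i] f x = 0 := by
  obtain ⟨P, -, hc, he⟩ := OP_poly hf x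
  have : P = 0 := by
    refine poly_zero fun e hn => ?_
    have h1 := iter_1d (i := i) (h := fun t : ℝ => f (x + t * e))
      (hf.comp (contDiff_const.add (Complex.ofRealCLM.contDiff.mul contDiff_const))) (by
        have ht : Filter.Tendsto (fun t : ℝ => x + t * e) (nhds 0) (nhds x) := by
          have : Continuous fun t : ℝ => x + t * e := by fun_prop
          simpa using this.tendsto 0
        have := ho.comp_tendsto ht
        have e1 : ((fun z => ‖z - x‖ ^ i) ∘ fun t : ℝ => x + t * e) = fun t : ℝ => ‖t ^ i‖ := by
          funext t
          simp [hn]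
        rw [e1] at this
        exact this.of_norm_right)
    rw [iter_line hf] at h1
    simp only [Complex.ofReal_zero, zero_mul, add_zero] at h1
    rw [he e hn] at h1
    refine (mul_eq_zero.1 h1).resolve_left (pow_ne_zero _ ?_)
    intro h0
    have : e = 0 := by simpa using h0
    simp [this] at hn
  rw [← hc, this]; simp

lemma WZ_pow (x : ℂ) (l : ℕ) (c : ℂ) : WZ^[l] (fun z => c * (z - x) ^ l) x = c * l.factorial := by
  induction l generalizing c with
  | zero => simp
  | succ l ih =>
    rw [Function.iterate_succ_apply]
    have : WZ (fun z => c * (z - x) ^ (l + 1)) = fun z => (c * (l + 1)) * (z - x) ^ l := by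
      funext z
      have h : HasDerivAt (fun z : ℂ => c * (z - x) ^ (l + 1)) (c * ((l + 1) * (z - x) ^ l)) z := by
        have := (((hasDerivAt_id z).sub_const x).fun_pow (l + 1)).const_mul c
        simpa using this
      have h' := h.hasFDerivAt.restrictScalars ℝ
      simp only [WZ, OP]
      rw [h'.fderiv]
      simp
      linear_combination -(1 / 2 : ℂ) * (c * ((l + 1) * (z - x) ^ l)) * Complex.I_sq
    rw [this, ih, Nat.factorial_succ]
    push_cast; ring

open Asymptotics in
lemma WZ_low {f v : ℂ → ℂ} {x : ℂ} {j i : ℕ} (hij : i < j) (hf : ContDiff ℝ i f) (hv : Continuous v)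
    (h : f =ᶠ[nhds x] fun z => (z - x) ^ j * v z) : WZ^[i] f x = 0 := by
  refine WZ_zero hf ?_
  refine IsLittleO.congr' (f₁ := fun z => (z - x) ^ i * ((z - x) ^ (j - i) * v z)) (g₁ := fun z => ‖z - x‖ ^ i * 1) ?_ ?_ ?_
  · refine IsBigO.mul_isLittleO ?_ ?_
    · exact IsBigO.of_norm_le fun z => by simp
    · rw [isLittleO_one_iff]
      have : Continuous fun z => (z - x) ^ (j - i) * v z := by fun_prop
      have h2 := this.tendsto x
      have h3 : j - i ≠ 0 := by omega
      simpa [h3] using h2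
  · filter_upwards [h] with z hz
    rw [hz, ← mul_assoc, ← pow_add]; congr 2; omega
  · exact Filter.Eventually.of_forall fun z => by simp

open Asymptotics in
lemma WZ_top {f v : ℂ → ℂ} {x : ℂ} {j : ℕ} (hf : ContDiff ℝ j f) (hv : Continuous v)
    (h : f =ᶠ[nhds x] fun z => (z - x) ^ j * v z) : WZ^[j] f x = v x * j.factorial := by
  have hp : ContDiff ℝ j (fun z : ℂ => v x * (z - x) ^ j) := by fun_prop
  have h0 : WZ^[j] (fun z => 1 * f z + (-1) * (v x * (z - x) ^ j)) x = 0 := by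
    refine WZ_zero (by fun_prop) ?_
    refine IsLittleO.congr' (f₁ := fun z => (z - x) ^ j * (v z - v x)) (g₁ := fun z => ‖z - x‖ ^ j * 1) ?_ ?_ ?_
    · refine IsBigO.mul_isLittleO ?_ ?_
      · exact IsBigO.of_norm_le fun z => by simp
      · rw [isLittleO_one_iff]
        have : Continuous fun z => v z - v x := by fun_prop
        simpa using this.tendsto x
    · filter_upwards [h] with z hz
      rw [hz]; ring
    · exact Filter.Eventually.of_forall fun z => by simp
  rw [WZ, OP_iter_lin hf hp] at h0
  have := WZ_pow x j (v x)
  rw [WZ] at this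
  simp only [this] at h0
  rw [WZ]
  linear_combination h0

/-- the jet of a vector valued function -/
noncomputable def JJ {n : ℕ} (k : ℕ) (u : ℂ → Fin n → ℂ) (ζ : ℂ) : Fin (k + 1) → Fin n → ℂ :=
  fun i c => WZ^[(i : ℕ)] (fun z => u z c) ζ

lemma JJ_continuous {n k : ℕ} {u : ℂ → Fin n → ℂ} (hu : ∀ c, ContDiff ℝ k (fun z => u z c)) :
    Continuous (JJ k u) := by
  refine continuous_pi fun i => continuous_pi fun c => ?_
  have h : ContDiff ℝ (0 : ℕ) (WZ^[(i : ℕ)] (fun z => u z c)) :=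
    OP_iter_contDiff ((hu c).of_le (by have := i.2; norm_cast; omega))
  exact h.continuous

lemma WZ_iter_sum {k N : ℕ} {f : Fin N → ℂ → ℂ} (hf : ∀ l, ContDiff ℝ k (f l)) (c : Fin N → ℝ) (s : Finset (Fin N)) (z : ℂ) :
    WZ^[k] (fun ω => ∑ l ∈ s, (c l : ℂ) * f l ω) z = ∑ l ∈ s, (c l : ℂ) * WZ^[k] (f l) z := by
  classical
  induction s using Finset.induction_on with
  | empty =>
    simp only [Finset.sum_empty]
    have := OP_iter_lin (a := 1 / 2) (b := -Complex.I / 2) (c := 0) (d := 0) (i := k) (f := fun _ => 0) (g := fun _ => 0)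
      contDiff_const contDiff_const
    simpa [WZ] using congrFun this z
  | insert a s ha ih =>
    simp only [Finset.sum_insert ha]
    have hs : ContDiff ℝ k (fun ω => ∑ l ∈ s, (c l : ℂ) * f l ω) :=
      ContDiff.sum fun l _ => contDiff_const.mul (hf l)
    have := congrFun (OP_iter_lin (a := 1 / 2) (b := -Complex.I / 2) (c := c a) (d := 1) (hf a) hs) z
    simp only [one_mul] at this
    rw [← ih]
    exact this

lemma within_iter {n k : ℕ} {u : ℂ → Fin n → ℂ} (hu : ∀ c, ContDiff ℝ k (fun z => u z c)) {j : ℕ} (hj : j ≤ k) :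
    ∀ ζ ∈ DD, (wirtingerZWithin DD)^[j] u ζ = fun c => WZ^[j] (fun z => u z c) ζ := by
  induction j with
  | zero => intro ζ _; rfl
  | succ j ih =>
    intro ζ hζ
    rw [Function.iterate_succ_apply']
    have ih' := ih (by omega)
    have hd : ∀ c, ContDiff ℝ (1 : ℕ) (WZ^[j] (fun z => u z c)) := fun c =>
      OP_iter_contDiff ((hu c).of_le (by norm_cast; omega))
    have hd' : ∀ c, DifferentiableAt ℝ (WZ^[j] (fun z => u z c)) ζ := fun c => (hd c).differentiable (by simp) ζ
    have h1 : HasFDerivAt (fun z => fun c => WZ^[j] (fun z => u z c) z)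
        (ContinuousLinearMap.pi fun c => fderiv ℝ (WZ^[j] (fun z => u z c)) ζ) ζ :=
      hasFDerivAt_pi.2 fun c => (hd' c).hasFDerivAt
    have h2 : fderivWithin ℝ ((wirtingerZWithin DD)^[j] u) DD ζ =
        ContinuousLinearMap.pi fun c => fderiv ℝ (WZ^[j] (fun z => u z c)) ζ := by
      rw [fderivWithin_congr ih' (ih' ζ hζ)]
      exact h1.hasFDerivWithinAt.fderivWithin (DD_uniqueDiff ζ hζ)
    funext c
    rw [Function.iterate_succ_apply', wirtingerZWithin, h2]
    simp [WZ, OP]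
    ring

/-- good solutions -/
def GS (α : ℝ) {n : ℕ} (k : ℕ) (B₁ B₂ : ℂ → Matrix (Fin n) (Fin n) ℂ) (u : ℂ → Fin n → ℂ) : Prop :=
  (∀ i, Hol α Set.univ k (fun z => u z i)) ∧
    ∀ z, ‖z‖ < 2 → wirtingerZbar u z = B₁ z *ᵥ u z + B₂ z *ᵥ vecConj (u z)

lemma GS.cd {α : ℝ} (hα₀ : 0 < α) {n k : ℕ} {B₁ B₂ : ℂ → Matrix (Fin n) (Fin n) ℂ} {u : ℂ → Fin n → ℂ}
    (h : GS α k B₁ B₂ u) (c : Fin n) : ContDiff ℝ k (fun z => u z c) := (h.1 c).contDiff hα₀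

lemma GS.add {α : ℝ} (hα₀ : 0 < α) {n k : ℕ} (hk : 1 ≤ k) {B₁ B₂ : ℂ → Matrix (Fin n) (Fin n) ℂ} {u v : ℂ → Fin n → ℂ}
    (hu : GS α k B₁ B₂ u) (hv : GS α k B₁ B₂ v) : GS α k B₁ B₂ (fun z => u z + v z) := by
  refine ⟨fun i => (hu.1 i).add (hv.1 i), fun z hz => ?_⟩
  have h1 : DifferentiableAt ℝ u z :=
    (contDiff_pi.2 (hu.cd hα₀)).differentiable (by norm_cast; omega) z
  have h2 : DifferentiableAt ℝ v z :=
    (contDiff_pi.2 (hv.cd hα₀)).differentiable (by norm_cast; omega) z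
  have h3 : fderiv ℝ (fun z => u z + v z) z = fderiv ℝ u z + fderiv ℝ v z := fderiv_fun_add h1 h2
  have e1 := hu.2 z hz
  have e2 := hv.2 z hz
  have h4 : vecConj (u z + v z) = vecConj (u z) + vecConj (v z) := by
    funext i; simp [vecConj]
  have h5 : wirtingerZbar (fun z => u z + v z) z = wirtingerZbar u z + wirtingerZbar v z := by
    simp only [wirtingerZbar, h3, _root_.add_apply, smul_add]
    abel
  rw [h5, e1, e2, h4, Matrix.mulVec_add, Matrix.mulVec_add]
  abel

lemma jet_local {α : ℝ} (hα₀ : 0 < α) (hα₁ : α < 1) {n m : ℕ} {B₁ B₂ : ℂ → Matrix (Fin n) (Fin n) ℂ}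
    (hB₁ : ∀ i l, Hol α Set.univ m (fun z => B₁ z i l)) (hB₂ : ∀ i l, Hol α Set.univ m (fun z => B₂ z i l))
    (h01 : ∀ z, 2 < ‖z‖ → B₁ z = 0) (h02 : ∀ z, 2 < ‖z‖ → B₂ z = 0) {ζ0 : ℂ} (hζ : ‖ζ0‖ < 2) (b : ℕ → Fin n → ℂ)
    (p : ℕ) (hp : p ≤ m + 1) :
    ∃ u, GS α (m + 1) B₁ B₂ u ∧ ∀ i ≤ p, ∀ c, WZ^[i] (fun z => u z c) ζ0 = b i c := by
  have step : ∀ j ≤ m + 1, ∀ a : Fin n → ℂ, ∃ U, GS α (m + 1) B₁ B₂ U ∧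
      (∀ i < j, ∀ c, WZ^[i] (fun z => U z c) ζ0 = 0) ∧ ∀ c, WZ^[j] (fun z => U z c) ζ0 = a c := by
    intro j hj a
    obtain ⟨U, h1, h2, v, hv, hva, hU⟩ := exists_local hα₀ hα₁ hB₁ hB₂ h01 h02 ζ0 j (fun c => a c / j.factorial)
    have hG : GS α (m + 1) B₁ B₂ U := ⟨h1, h2⟩
    have hev : ∀ c, (fun z => U z c) =ᶠ[nhds ζ0] fun z => (z - ζ0) ^ j * v z c := by
      intro c
      have : ∀ᶠ z : ℂ in nhds ζ0, ‖z‖ < 2 := continuous_norm.continuousAt.eventually_lt_const hζ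
      filter_upwards [this] with z hz
      rw [hU z hz.le]; rfl
    have hvc : ∀ c, Continuous fun z => v z c := fun c => (continuous_apply c).comp hv
    refine ⟨U, hG, fun i hi c => ?_, fun c => ?_⟩
    · exact WZ_low (v := fun z => v z c) hi ((hG.cd hα₀ c).of_le (by norm_cast; omega)) (hvc c) (hev c)
    · rw [WZ_top (v := fun z => v z c) ((hG.cd hα₀ c).of_le (by norm_cast)) (hvc c) (hev c)]
      simp only [hva]
      have : (j.factorial : ℂ) ≠ 0 := by exact_mod_cast j.factorial_ne_zero
      field_simp
  induction p with
  | zero =>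
    obtain ⟨U, hG, -, h⟩ := step 0 (by omega) (b 0)
    refine ⟨U, hG, fun i hi c => ?_⟩
    obtain rfl : i = 0 := by omega
    exact h c
  | succ p ih =>
    obtain ⟨u, hu, hub⟩ := ih (by omega)
    obtain ⟨U, hG, hlow, htop⟩ := step (p + 1) hp (fun c => b (p + 1) c - WZ^[p + 1] (fun z => u z c) ζ0)
    refine ⟨fun z => u z + U z, hu.add hα₀ (by omega) hG, fun i hi c => ?_⟩
    have hl := congrFun (OP_iter_lin (a := 1 / 2) (b := -Complex.I / 2) (c := 1) (d := 1) (i := i)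
      ((hu.cd hα₀ c).of_le (by norm_cast; omega)) ((hG.cd hα₀ c).of_le (by norm_cast; omega))) ζ0
    simp only [one_mul] at hl
    have hl' : WZ^[i] (fun z => (u z + U z) c) ζ0 = WZ^[i] (fun z => u z c) ζ0 + WZ^[i] (fun z => U z c) ζ0 := hl
    rw [hl']
    rcases Nat.lt_or_ge i (p + 1) with h | h
    · rw [hlow i h c, hub i (by omega) c, add_zero]
    · obtain rfl : i = p + 1 := by omega
      rw [htop c]; ring

lemma jet_nhds {α : ℝ} (hα₀ : 0 < α) (hα₁ : α < 1) {n m : ℕ} {B₁ B₂ : ℂ → Matrix (Fin n) (Fin n) ℂ}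
    (hB₁ : ∀ i l, Hol α Set.univ m (fun z => B₁ z i l)) (hB₂ : ∀ i l, Hol α Set.univ m (fun z => B₂ z i l))
    (h01 : ∀ z, 2 < ‖z‖ → B₁ z = 0) (h02 : ∀ z, 2 < ‖z‖ → B₂ z = 0) {ζ0 : ℂ} (hζ : ‖ζ0‖ < 2) :
    ∃ S : Set (ℂ → Fin n → ℂ), S.Finite ∧ (∀ u ∈ S, GS α (m + 1) B₁ B₂ u) ∧
      ∀ᶠ ζ in nhds ζ0, Submodule.span ℝ ((fun u => JJ (m + 1) u ζ) '' S) = ⊤ := by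
  classical
  let b := Module.finBasis ℝ (Fin (m + 1 + 1) → Fin n → ℂ)
  have hex : ∀ l, ∃ u, GS α (m + 1) B₁ B₂ u ∧ JJ (m + 1) u ζ0 = b l := by
    intro l
    obtain ⟨u, hu, h⟩ := jet_local hα₀ hα₁ hB₁ hB₂ h01 h02 hζ
      (fun i => if hi : i < m + 1 + 1 then b l ⟨i, hi⟩ else 0) (m + 1) le_rfl
    refine ⟨u, hu, ?_⟩
    funext i c
    have := h i (by have := i.2; omega) c
    rw [dif_pos i.2] at this
    exact this
  choose u hu huj using hex
  refine ⟨Set.range u, Set.finite_range u, by rintro _ ⟨l, rfl⟩; exact hu l, ?_⟩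
  have hcont : Continuous fun ζ => b.det (fun l => JJ (m + 1) (u l) ζ) := by
    simp only [Module.Basis.det_apply]
    refine Continuous.matrix_det ?_
    refine continuous_matrix fun i l => ?_
    simp only [Module.Basis.toMatrix_apply]
    have h1 : Continuous (b.coord i) := LinearMap.continuous_of_finiteDimensional _
    exact h1.comp (JJ_continuous ((hu l).cd hα₀))
  have h0 : b.det (fun l => JJ (m + 1) (u l) ζ0) ≠ 0 := by
    have : (fun l => JJ (m + 1) (u l) ζ0) = b := funext huj
    rw [this, Module.Basis.det_self]; exact one_ne_zero
  filter_upwards [hcont.continuousAt.eventually_ne h0] with ζ hζ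
  have := ((Module.Basis.is_basis_iff_det b).2 (isUnit_iff_ne_zero.2 hζ)).2
  rw [← Set.range_comp]
  exact this

lemma jet_cover {α : ℝ} (hα₀ : 0 < α) (hα₁ : α < 1) {n m : ℕ} {B₁ B₂ : ℂ → Matrix (Fin n) (Fin n) ℂ}
    (hB₁ : ∀ i l, Hol α Set.univ m (fun z => B₁ z i l)) (hB₂ : ∀ i l, Hol α Set.univ m (fun z => B₂ z i l))
    (h01 : ∀ z, 2 < ‖z‖ → B₁ z = 0) (h02 : ∀ z, 2 < ‖z‖ → B₂ z = 0) :
    ∃ S : Set (ℂ → Fin n → ℂ), S.Finite ∧ (∀ u ∈ S, GS α (m + 1) B₁ B₂ u) ∧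
      ∀ ζ ∈ DD, Submodule.span ℝ ((fun u => JJ (m + 1) u ζ) '' S) = ⊤ := by
  have hc : IsCompact DD := isCompact_closedBall _ _
  refine hc.induction_on (p := fun s => ∃ S : Set (ℂ → Fin n → ℂ), S.Finite ∧ (∀ u ∈ S, GS α (m + 1) B₁ B₂ u) ∧
      ∀ ζ ∈ s, Submodule.span ℝ ((fun u => JJ (m + 1) u ζ) '' S) = ⊤) ?_ ?_ ?_ ?_
  · exact ⟨∅, Set.finite_empty, by simp, by simp⟩
  · rintro s t hst ⟨S, h1, h2, h3⟩
    exact ⟨S, h1, h2, fun ζ hζ => h3 ζ (hst hζ)⟩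
  · rintro s t ⟨S, h1, h2, h3⟩ ⟨T, k1, k2, k3⟩
    refine ⟨S ∪ T, h1.union k1, fun u hu => hu.elim (h2 u) (k2 u), fun ζ hζ => ?_⟩
    rw [Set.image_union, Submodule.span_union]
    rcases hζ with h | h
    · rw [h3 ζ h, top_sup_eq]
    · rw [k3 ζ h, sup_top_eq]
  · intro ζ hζ
    have hζ' : ‖ζ‖ < 2 := by
      have : ‖ζ‖ ≤ 1 := by simpa [DD] using hζ
      linarith
    obtain ⟨S, h1, h2, h3⟩ := jet_nhds hα₀ hα₁ hB₁ hB₂ h01 h02 hζ'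
    exact ⟨_, mem_nhdsWithin_of_mem_nhds h3, S, h1, h2, fun z hz => hz⟩

lemma ext_matrix {α : ℝ} (hα₀ : 0 < α) (hα₁ : α < 1) {n m : ℕ} {B : ℂ → Matrix (Fin n) (Fin n) ℂ}
    (hB : ∀ i j, HolderOn m α DD (fun ζ => B ζ i j)) :
    ∃ C : ℂ → Matrix (Fin n) (Fin n) ℂ, (∀ i l, Hol α Set.univ m (fun z => C z i l)) ∧
      (∀ z ∈ DD, C z = B z) ∧ ∀ z, 2 < ‖z‖ → C z = 0 := by
  choose g h1 h2 h3 using fun i j => exists_extension hα₀ hα₁ (Hol.of_holderOn hα₀ hα₁ (hB i j))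
  refine ⟨fun z => Matrix.of fun i j => g i j z, h1, fun z hz => ?_, fun z hz => ?_⟩
  · ext i j; exact h2 i j z hz
  · ext i j; exact h3 i j z hz

/-- there is a finite-dimensional subspace `V` of the real vector
space `𝒱` of `C^{k,α}` solutions of `∂u/∂ζ̄ = B₁u + B₂ū` such that for every
`ζ ∈ D̄` the `k`-jet evaluation map `j^k_ζ : V → (ℂⁿ)^{k+1}` is surjective. -/
theorem stmt16 (n : ℕ) (k : ℕ) (hk : 1 ≤ k) (α : ℝ) (hα₀ : 0 < α) (hα₁ : α < 1)
    (B₁ B₂ : ℂ → Matrix (Fin n) (Fin n) ℂ)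
    (hB₁ : ∀ i j, HolderOn (k - 1) α (closure unitDisc) (fun ζ => B₁ ζ i j))
    (hB₂ : ∀ i j, HolderOn (k - 1) α (closure unitDisc) (fun ζ => B₂ ζ i j)) :
    ∃ (N : ℕ) (u : Fin N → (ℂ → (Fin n → ℂ))),
      (∀ l, HolderOn k α (closure unitDisc) (u l) ∧
        ∀ ζ ∈ unitDisc,
          wirtingerZbar (u l) ζ = B₁ ζ *ᵥ u l ζ + B₂ ζ *ᵥ vecConj (u l ζ)) ∧
      ∀ ζ ∈ closure unitDisc, ∀ a : ℕ → (Fin n → ℂ), ∃ c : Fin N → ℝ,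
        ∀ j ≤ k,
          (wirtingerZWithin (closure unitDisc))^[j]
            (fun ω => ∑ l, c l • u l ω) ζ = a j := by
  rw [closure_unitDisc] at *
  obtain ⟨C₁, c1, c2, c3⟩ := ext_matrix hα₀ hα₁ hB₁
  obtain ⟨C₂, d1, d2, d3⟩ := ext_matrix hα₀ hα₁ hB₂
  obtain ⟨S, hS, hG, hspan⟩ := jet_cover hα₀ hα₁ c1 d1 c3 d3
  rw [Nat.sub_add_cancel hk] at hG hspan
  obtain ⟨N, u, -, rfl⟩ := hS.fin_param
  have hG' : ∀ l, GS α k C₁ C₂ (u l) := fun l => hG _ ⟨l, rfl⟩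
  refine ⟨N, u, fun l => ⟨HolderOn.of_hol hα₀ (hG' l).1, fun ζ hζ => ?_⟩, fun ζ hζ a => ?_⟩
  · have hz : ‖ζ‖ < 1 := by simpa [unitDisc] using hζ
    have hD : ζ ∈ DD := by simpa [DD] using hz.le
    rw [← c2 ζ hD, ← d2 ζ hD]
    exact (hG' l).2 ζ (by linarith)
  · have hm : (fun i c => a i c : Fin (k + 1) → Fin n → ℂ) ∈
        Submodule.span ℝ (Set.range fun l => JJ k (u l) ζ) := by
      have := hspan ζ hζ
      rw [← Set.range_comp] at this
      have e : (Set.range fun l => JJ k (u l) ζ) = Set.range ((fun u => JJ k u ζ) ∘ u) := rfl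
      rw [e, this]; trivial
    obtain ⟨c, hc⟩ := (Submodule.mem_span_range_iff_exists_fun ℝ).1 hm
    refine ⟨c, fun j hj => ?_⟩
    have hcd : ∀ l i, ContDiff ℝ k (fun z => u l z i) := fun l i => (hG' l).cd hα₀ i
    have e1 : ∀ i, (fun ω => (∑ l, c l • u l ω) i) = fun ω => ∑ l, (c l : ℂ) * u l ω i := by
      intro i; funext ω
      simp [Finset.sum_apply]
    rw [within_iter (u := fun ω => ∑ l, c l • u l ω) (fun i => ?_) hj ζ hζ]
    · funext i
      simp only [e1]
      rw [WZ_iter_sum (f := fun l z => u l z i) (fun l => (hcd l i).of_le (by exact_mod_cast hj))]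
      have := congrFun (congrFun hc ⟨j, by omega⟩) i
      simpa [JJ, Finset.sum_apply] using this
    · rw [e1]
      exact ContDiff.sum fun l _ => contDiff_const.mul (hcd l i)
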